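/- arXiv:2504.14711 — 2 statements merged into one kernel-verified Lean document; each statement's English description precedes it below -/
import Mathlib

section
/- Let G be a graph such that ‖X,Y‖ ≤ 2|X ∪ Y| − 4 for all disjoint subsets X, Y ⊆ V(G) with |X ∪ Y| ≥ 3, where ‖X,Y‖ denotes the number of edges of G with one endpoint in X and the other in Y. Then G is strongly equitably (SE) k-choosable for every integer k ≥ max{9, Δ(G)}. -/
/-- `n mod* k`: the unique integer `m` with `1 ≤ m ≤ k` such that `k` divides `n - m`. -/
def modStar (n k : ℕ) : ℕ := if n % k = 0 then k else n % k

/-- `G` has a strongly equitable (SE) `L`-coloring for the `k`-list assignment `L`: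
a proper coloring `f` with `f v ∈ L v` for all `v` such that every color class has at
most `⌈n/k⌉` vertices, and at most `n mod* k` color classes are full, i.e. have exactly
`⌈n/k⌉` vertices. -/
def SELColorable {V : Type*} [Fintype V] (G : SimpleGraph V) (k : ℕ)
    (L : V → Finset ℕ) : Prop :=
  ∃ f : V → ℕ, (∀ v : V, f v ∈ L v) ∧ (∀ ⦃u v : V⦄, G.Adj u v → f u ≠ f v) ∧
    (∀ c : ℕ, (Finset.univ.filter fun v => f v = c).card ≤ (Fintype.card V + k - 1) / k) ∧
    ((Finset.univ.image f).filter fun c =>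
        (Finset.univ.filter fun v => f v = c).card = (Fintype.card V + k - 1) / k).card ≤
      modStar (Fintype.card V) k

/-- `G` is SE `k`-choosable: it has an SE `L`-coloring for every `k`-list assignment. -/
def SEChoosable {V : Type*} [Fintype V] (G : SimpleGraph V) (k : ℕ) : Prop :=
  ∀ L : V → Finset ℕ, (∀ v : V, (L v).card = k) → SELColorable G k L

set_option linter.unusedSectionVars false

open Finset Relation

section ListRecoloring

variable {V : Type*} [DecidableEq V] {G : SimpleGraph V} [DecidableRel G.Adj]
  {L : V → Finset ℕ} {U : Finset V} {f g : V → ℕ}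

/-- The neighbours of `x` inside `U`. -/
def nbrs (G : SimpleGraph V) [DecidableRel G.Adj] (U : Finset V) (x : V) : Finset V :=
  U.filter (G.Adj x ·)

/-- The number of vertices of `U` with color `c`. -/
def classSize (U : Finset V) (f : V → ℕ) (c : ℕ) : ℕ := (U.filter (f · = c)).card

/-- The vertices of `U` whose color lies in `C`. -/
def colored (U : Finset V) (f : V → ℕ) (C : Finset ℕ) : Finset V := U.filter (f · ∈ C)

/-- `f` is a proper coloring of `G[U]` from the lists `L`. -/
def ProperOn (G : SimpleGraph V) (L : V → Finset ℕ) (U : Finset V) (f : V → ℕ) : Prop :=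
  (∀ x ∈ U, f x ∈ L x) ∧ ∀ x ∈ U, ∀ y ∈ U, G.Adj x y → f x ≠ f y

/-- Some vertex of color `c` can be recolored with `d`. -/
def CanMove (G : SimpleGraph V) (L : V → Finset ℕ) (U : Finset V) (f : V → ℕ) (c d : ℕ) : Prop :=
  ∃ x ∈ U, f x = c ∧ d ∈ L x ∧ d ≠ c ∧ ∀ y ∈ U, G.Adj x y → f y ≠ d

/-- A simple directed path of recoloring moves from `c` to `d` through colors of `M`. -/
inductive Route (G : SimpleGraph V) (L : V → Finset ℕ) (U : Finset V) (f : V → ℕ) :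
    Finset ℕ → ℕ → ℕ → Prop
  | nil {M : Finset ℕ} {c : ℕ} : c ∈ M → Route G L U f M c c
  | cons {M : Finset ℕ} {c c' d : ℕ} : c ∈ M → CanMove G L U f c c' →
      Route G L U f (M.erase c) c' d → Route G L U f M c d

/-- No recoloring move leaves the color set `C`. -/
def MoveClosed (G : SimpleGraph V) (L : V → Finset ℕ) (U : Finset V) (f : V → ℕ)
    (C : Finset ℕ) : Prop :=
  ∀ c ∈ C, ∀ d, CanMove G L U f c d → d ∈ C

lemma mem_nbrs {x y : V} : y ∈ nbrs G U x ↔ y ∈ U ∧ G.Adj x y := by simp [nbrs]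

lemma mem_colored {C : Finset ℕ} {x : V} : x ∈ colored U f C ↔ x ∈ U ∧ f x ∈ C := by
  simp [colored]

lemma classSize_update {x : V} (hx : x ∈ U) (c e : ℕ) :
    classSize U (Function.update f x c) e + (if e = f x then 1 else 0) =
      classSize U f e + (if e = c then 1 else 0) := by
  have key : ∀ h : V → ℕ, classSize U h e =
      ((U.erase x).filter (h · = e)).card + (if e = h x then 1 else 0) := by
    intro h
    unfold classSize
    conv_lhs => rw [← insert_erase hx, filter_insert]
    split_ifs with h1 h2 h2
    · rw [card_insert_of_notMem (by simp)]
    · exact absurd h1.symm h2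
    · exact absurd h2.symm h1
    · simp
  have hsame : (U.erase x).filter (Function.update f x c · = e) =
      (U.erase x).filter (f · = e) := by
    apply filter_congr
    intro y hy
    rw [Function.update_of_ne (ne_of_mem_erase hy)]
  rw [key (Function.update f x c), key f, hsame, Function.update_self]
  omega

lemma classSize_insert {v : V} (hv : v ∉ U) (c e : ℕ) :
    classSize (insert v U) (Function.update f v c) e =
      classSize U f e + (if e = c then 1 else 0) := by
  have hsame : U.filter (Function.update f v c · = e) = U.filter (f · = e) := by
    apply filter_congr
    intro y hy
    rw [Function.update_of_ne (by rintro rfl; exact hv hy)]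
  unfold classSize
  rw [filter_insert, hsame, Function.update_self]
  split_ifs with h1 h2 h2
  · rw [card_insert_of_notMem (by simp [hv])]
  · exact absurd h1.symm h2
  · exact absurd h2.symm h1
  · simp

lemma ProperOn.update (hf : ProperOn G L U f) {x : V} {c : ℕ} (hc : c ∈ L x)
    (hfree : ∀ y ∈ U, G.Adj x y → f y ≠ c) : ProperOn G L U (Function.update f x c) := by
  refine ⟨fun y hy => ?_, fun y hy z hz hyz => ?_⟩
  · rcases eq_or_ne y x with rfl | h
    · simpa using hc
    · simpa [h] using hf.1 y hy
  · rcases eq_or_ne y x with rfl | h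
    · have hz' : z ≠ y := hyz.ne'
      simpa [hz'] using (hfree z hz hyz).symm
    · rcases eq_or_ne z x with rfl | h'
      · simpa [h] using hfree y hy hyz.symm
      · simpa [h, h'] using hf.2 y hy z hz hyz

lemma Route.mono {M M' : Finset ℕ} {c d : ℕ} (h : Route G L U f M c d) (hM : M ⊆ M') :
    Route G L U f M' c d := by
  induction h generalizing M' with
  | nil hc => exact .nil (hM hc)
  | cons hc hm _ ih => exact .cons (hM hc) hm (ih (erase_subset_erase _ hM))

lemma Route.avoid_or {M : Finset ℕ} {c' d : ℕ} (h : Route G L U f M c' d) (c : ℕ) :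
    Route G L U f (M.erase c) c' d ∨ Route G L U f M c d := by
  induction h with
  | @nil M e he =>
    rcases eq_or_ne e c with rfl | hne
    · exact .inr (.nil he)
    · exact .inl (.nil (mem_erase.2 ⟨hne, he⟩))
  | @cons M e e' d he hm ht ih =>
    rcases eq_or_ne e c with rfl | hne
    · exact .inr (.cons he hm ht)
    · rcases ih with h | h
      · refine .inl (.cons (mem_erase.2 ⟨hne, he⟩) hm ?_)
        rwa [erase_right_comm]
      · exact .inr (h.mono (erase_subset _ _))

lemma MoveClosed.route {B : Finset ℕ} (hB : MoveClosed G L U f B) {c d : ℕ} (hc : c ∈ B)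
    (h : ReflTransGen (CanMove G L U f) c d) : Route G L U f B c d := by
  induction h using ReflTransGen.head_induction_on with
  | refl => exact .nil hc
  | @head a b hab _ ih =>
    rcases (ih (hB a hc b hab)).avoid_or a with h | h
    · exact .cons hc hab h
    · exact h

lemma Route.target_mem {M : Finset ℕ} {c d : ℕ} (h : Route G L U f M c d) : d ∈ M := by
  induction h with
  | nil hc => exact hc
  | cons _ _ _ ih => exact mem_of_mem_erase ih

/-- Performing all moves along a route. -/
lemma Route.exists_shift {M : Finset ℕ} {c d : ℕ} (h : Route G L U f M c d)
    (hf : ProperOn G L U f) :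
    ∃ g : V → ℕ, ProperOn G L U g ∧
      (∀ e, classSize U g e + (if e = c then 1 else 0) =
        classSize U f e + (if e = d then 1 else 0)) ∧
      (∀ x ∈ U, g x = c → f x = c) ∧ (∀ x ∈ U, f x = d → g x = d) ∧
      (∀ x ∈ U, f x ∉ M → g x = f x) ∧ (∀ x ∈ U, f x ∈ M → g x ∈ M) := by
  induction h with
  | nil hc =>
    exact ⟨f, hf, fun e => rfl, fun x _ h => h, fun x _ h => h, fun x _ _ => rfl,
      fun x _ h => h⟩
  | @cons M c c' d hc hm ht ih =>
    obtain ⟨g, hg, hsize, hstart, hend, hout, hin⟩ := ih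
    obtain ⟨x₀, hx₀, rfl, hL, hne, hfree⟩ := hm
    have hd := ht.target_mem
    have hg0 : g x₀ = f x₀ := hout x₀ hx₀ (by simp)
    have hc' : c' ∈ M.erase (f x₀) := by cases ht <;> assumption
    refine ⟨Function.update g x₀ c', hg.update hL fun y hy hxy hgy =>
      hfree y hy hxy (hstart y hy hgy), fun e => ?_, fun x hx hxc => ?_, fun x hx hxd => ?_,
      fun x hx hxM => ?_, fun x hx hxM => ?_⟩
    · have h1 := classSize_update (f := g) hx₀ c' e
      have h2 := hsize e
      rw [hg0] at h1
      omega
    · rcases eq_or_ne x x₀ with rfl | hxx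
      · rfl
      · rw [Function.update_of_ne hxx] at hxc
        by_contra hcon
        by_cases hxM : f x ∈ M
        · have := hin x hx (mem_erase.2 ⟨hcon, hxM⟩)
          rw [hxc] at this
          simp at this
        · have := hout x hx (fun h => hxM (mem_of_mem_erase h))
          exact hcon (this ▸ hxc)
    · have hxx : x ≠ x₀ := by
        rintro rfl
        rw [hxd] at hd
        simp at hd
      rw [Function.update_of_ne hxx]
      exact hend x hx hxd
    · have hxx : x ≠ x₀ := by rintro rfl; exact hxM hc
      rw [Function.update_of_ne hxx]
      exact hout x hx fun h => hxM (mem_of_mem_erase h)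
    · rcases eq_or_ne x x₀ with rfl | hxx
      · simpa using mem_of_mem_erase hc'
      · rw [Function.update_of_ne hxx]
        by_cases h : f x = f x₀
        · rw [hout x hx (by simp [h]), h]; exact hc
        · exact mem_of_mem_erase (hin x hx (mem_erase.2 ⟨h, hxM⟩))

/-- A route stays valid when colors outside it change and its target class loses a vertex. -/
lemma Route.congr {M : Finset ℕ} {c d : ℕ} (h : Route G L U f M c d) {y : V} (hy : f y = d)
    (h1 : ∀ x ∈ U, f x ∈ M → x ≠ y → g x = f x) (h2 : ∀ x ∈ U, g x ∈ M → g x = f x) :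
    Route G L U g M c d := by
  induction h with
  | nil hc => exact .nil hc
  | @cons M c c' d hc hm ht ih =>
    have hd := ht.target_mem
    have hc' : c' ∈ M.erase c := by cases ht <;> assumption
    refine .cons hc ?_ (ih hy (fun x hx hxM => h1 x hx (mem_of_mem_erase hxM))
      (fun x hx hxM => h2 x hx (mem_of_mem_erase hxM)))
    obtain ⟨x, hx, rfl, hL, hne, hfree⟩ := hm
    have hxy : x ≠ y := by
      rintro rfl
      rw [← hy] at hd
      simp at hd
    refine ⟨x, hx, h1 x hx hc hxy, hL, hne, fun z hz hxz hgz => hfree z hz hxz ?_⟩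
    rw [← h2 z hz (hgz ▸ mem_of_mem_erase hc'), hgz]

/-- The colors whose class has exactly `s` vertices. -/
def fullColors (U : Finset V) (f : V → ℕ) (s : ℕ) : Finset ℕ :=
  (U.image f).filter (classSize U f · = s)

/-- A proper list coloring with classes of size at most `s`, at most `b` of them of size `s`. -/
structure Near (G : SimpleGraph V) (L : V → Finset ℕ) (U : Finset V) (s b : ℕ) (f : V → ℕ) :
    Prop where
  proper : ProperOn G L U f
  size_le : ∀ c, classSize U f c ≤ s
  full_le : (fullColors U f s).card ≤ b

open Classical in
/-- The full colors from which only full colors can be reached by moves. -/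
noncomputable def stuck (G : SimpleGraph V) (L : V → Finset ℕ) (U : Finset V) (s : ℕ)
    (f : V → ℕ) : Finset ℕ :=
  (fullColors U f s).filter fun c =>
    ∀ d, ReflTransGen (CanMove G L U f) c d → d ∈ fullColors U f s

/-- The colors of `L v` that do not occur on the neighbours of `v`. -/
def freeColors (G : SimpleGraph V) [DecidableRel G.Adj] (L : V → Finset ℕ) (U : Finset V)
    (f : V → ℕ) (v : V) : Finset ℕ :=
  L v \ (nbrs G U v).image f

/-- The situation in which the vertex `v` cannot be added to the colored set `U`. -/
structure Blocked (G : SimpleGraph V) [DecidableRel G.Adj] (L : V → Finset ℕ) (U : Finset V)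
    (s b k : ℕ) (v : V) : Prop where
  nine_le : 9 ≤ k
  s_pos : 0 < s
  list_card : ∀ x, (L x).card = k
  deg_le : ∀ x, (nbrs G U x).card ≤ k
  notMem : v ∉ U
  deg_v : (nbrs G U v).card ≤ 6
  card_add : U.card + k = s * k + b
  b_lt : b < k
  sparse : ∀ X Y : Finset V, Disjoint X Y → 3 ≤ X.card + Y.card →
    ∑ x ∈ X, (nbrs G Y x).card + 4 ≤ 2 * (X.card + Y.card)
  no_extension : ¬ ∃ g, Near G L (insert v U) s (b + 1) g

/-- A closed set of stuck colors contained in every other such set with at least three colors. -/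
structure IsCore (G : SimpleGraph V) (L : V → Finset ℕ) (U : Finset V) (s : ℕ) (f : V → ℕ)
    (D : Finset ℕ) : Prop where
  subset : D ⊆ stuck G L U s f
  closed : MoveClosed G L U f D
  three_le : 3 ≤ D.card
  least : ∀ C ⊆ stuck G L U s f, MoveClosed G L U f C → 3 ≤ C.card → D ⊆ C

variable {s b k : ℕ} {v : V} {D : Finset ℕ}

lemma mem_fullColors (hs : 0 < s) {c : ℕ} : c ∈ fullColors U f s ↔ classSize U f c = s := by
  unfold fullColors
  rw [mem_filter, and_iff_right_iff_imp]
  intro h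
  have : 0 < (U.filter (f · = c)).card := by unfold classSize at h; omega
  obtain ⟨x, hx⟩ := card_pos.1 this
  rw [mem_filter] at hx
  exact mem_image.2 ⟨x, hx.1, hx.2⟩

lemma stuck_subset : stuck G L U s f ⊆ fullColors U f s := by
  classical exact filter_subset _ _

lemma mem_stuck {c : ℕ} : c ∈ stuck G L U s f ↔
    ∀ d, ReflTransGen (CanMove G L U f) c d → d ∈ fullColors U f s := by
  classical
  unfold stuck
  rw [mem_filter, and_iff_right_iff_imp]
  exact fun h => h c .refl

lemma moveClosed_stuck : MoveClosed G L U f (stuck G L U s f) := fun _ hc _ hd =>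
  mem_stuck.2 fun e he => mem_stuck.1 hc e (.head hd he)

lemma MoveClosed.inter {C C' : Finset ℕ} (h : MoveClosed G L U f C)
    (h' : MoveClosed G L U f C') : MoveClosed G L U f (C ∩ C') := fun c hc d hd =>
  mem_inter.2 ⟨h c (mem_inter.1 hc).1 d hd, h' c (mem_inter.1 hc).2 d hd⟩

lemma MoveClosed.exists_adj {C : Finset ℕ} (hC : MoveClosed G L U f C) {x : V} (hx : x ∈ U)
    (hfx : f x ∈ C) {d : ℕ} (hd : d ∈ L x) (hdC : d ∉ C) : ∃ y ∈ U, G.Adj x y ∧ f y = d := by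
  by_contra! hcon
  exact hdC (hC _ hfx d ⟨x, hx, rfl, hd, by rintro rfl; exact hdC hfx, hcon⟩)

lemma card_le_nbrs_of_hit {E : Finset ℕ} {x : V} {W : Finset V}
    (h : ∀ d ∈ E, ∃ y ∈ W, G.Adj x y ∧ f y = d) : E.card ≤ (nbrs G W x).card := by
  refine le_trans (card_le_card (t := (nbrs G W x).image f) fun d hd => ?_) card_image_le
  obtain ⟨y, hy, hxy, rfl⟩ := h d hd
  exact mem_image_of_mem _ (mem_nbrs.2 ⟨hy, hxy⟩)

lemma MoveClosed.card_le_nbrs {C E : Finset ℕ} (hC : MoveClosed G L U f C) {x : V} (hx : x ∈ U)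
    (hfx : f x ∈ C) {W : Finset V} (hE : E ⊆ L x \ C) (hW : ∀ y ∈ U, f y ∈ E → y ∈ W) :
    E.card ≤ (nbrs G W x).card := by
  refine card_le_nbrs_of_hit (f := f) fun d hd => ?_
  obtain ⟨hdL, hdC⟩ := mem_sdiff.1 (hE hd)
  obtain ⟨y, hy, hxy, rfl⟩ := hC.exists_adj hx hfx hdL hdC
  exact ⟨y, hW y hy hd, hxy, rfl⟩

lemma card_colored (hs : 0 < s) {C : Finset ℕ} (hC : C ⊆ fullColors U f s) :
    (colored U f C).card = C.card * s := by
  rw [card_eq_sum_card_fiberwise (f := f) (t := C) fun x hx => (mem_colored.1 hx).2]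
  rw [sum_const_nat (m := s)]
  intro c hc
  rw [← (mem_fullColors hs).1 (hC hc)]
  unfold classSize
  congr 1
  ext x
  simp only [mem_filter, mem_colored]
  constructor
  · rintro ⟨⟨h1, _⟩, h2⟩; exact ⟨h1, h2⟩
  · rintro ⟨h1, h2⟩; exact ⟨⟨h1, h2 ▸ hc⟩, h2⟩

lemma Route.reflTransGen {M : Finset ℕ} {c d : ℕ} (h : Route G L U f M c d) :
    ReflTransGen (CanMove G L U f) c d := by
  induction h with
  | nil _ => exact .refl
  | cons _ hm _ ih => exact .head hm ih

lemma mem_freeColors {c : ℕ} :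
    c ∈ freeColors G L U f v ↔ c ∈ L v ∧ ∀ y ∈ U, G.Adj v y → f y ≠ c := by
  unfold freeColors
  simp only [mem_sdiff, mem_image, mem_nbrs, not_exists, not_and, and_imp, ne_eq]

namespace Blocked

variable (H : Blocked G L U s b k v)
include H

lemma card_U_lt : U.card < s * k := by
  have := H.card_add; have := H.b_lt; omega

lemma sparse_U {X Y : Finset V} (hX : X ⊆ U) (hY : Y ⊆ U) (hXY : Disjoint X Y)
    (h3 : 3 ≤ X.card + Y.card) : ∑ x ∈ X, (nbrs G Y x).card + 4 ≤ 2 * U.card := by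
  have h1 := H.sparse X Y hXY h3
  have h2 : X.card + Y.card ≤ U.card := by
    rw [← card_union_of_disjoint hXY]; exact card_le_card (union_subset hX hY)
  omega

lemma le_card_freeColors : k ≤ (freeColors G L U f v).card + 6 := by
  have h1 := le_card_sdiff ((nbrs G U v).image f) (L v)
  have h2 : ((nbrs G U v).image f).card ≤ _ := card_image_le
  have h3 := H.deg_v
  have h4 := H.list_card v
  unfold freeColors
  omega

lemma mem_full_of_reach (hf : Near G L U s b f) {c d : ℕ} (hc : c ∈ freeColors G L U f v)
    (hcd : ReflTransGen (CanMove G L U f) c d) : d ∈ fullColors U f s := by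
  by_contra hd
  have hM : MoveClosed G L U f (insert c (U.biUnion L)) := by
    rintro e he d ⟨x, hx, _, hdx, _⟩
    exact mem_insert_of_mem (mem_biUnion.2 ⟨x, hx, hdx⟩)
  obtain ⟨g, hg, hsize, hstart, -, -, -⟩ :=
    (hM.route (mem_insert_self _ _) hcd).exists_shift hf.proper
  rw [mem_freeColors] at hc
  have hsz : ∀ e, classSize (insert v U) (Function.update g v c) e =
      classSize U f e + (if e = d then 1 else 0) := by
    intro e
    rw [classSize_insert H.notMem, hsize]
  have hvne : ∀ y ∈ U, y ≠ v := by rintro y hy rfl; exact H.notMem hy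
  refine H.no_extension ⟨Function.update g v c, ⟨?_, ?_⟩, ?_, ?_⟩
  · intro x hx
    rcases mem_insert.1 hx with rfl | hx
    · simpa using hc.1
    · simpa [hvne x hx] using hg.1 x hx
  · intro x hx y hy hxy
    rcases mem_insert.1 hx with rfl | hxU <;> rcases mem_insert.1 hy with rfl | hyU
    · exact absurd hxy (G.irrefl)
    · simp only [Function.update_self, Function.update_of_ne (hvne y hyU)]
      exact fun h => hc.2 y hyU hxy (hstart y hyU h.symm)
    · simp only [Function.update_self, Function.update_of_ne (hvne x hxU)]
      exact fun h => hc.2 x hxU hxy.symm (hstart x hxU h)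
    · simpa [hvne x hxU, hvne y hyU] using hg.2 x hxU y hyU hxy
  · intro e
    rw [hsz]
    have h1 := hf.size_le e
    rw [mem_fullColors H.s_pos] at hd
    split_ifs with h
    · subst h; omega
    · omega
  · have hsub : fullColors (insert v U) (Function.update g v c) s ⊆
        insert d (fullColors U f s) := by
      intro e he
      rw [mem_fullColors H.s_pos, hsz] at he
      rw [mem_insert, mem_fullColors H.s_pos]
      split_ifs at he with h
      · exact .inl h
      · exact .inr he
    have h1 := card_le_card hsub
    have h2 := card_insert_le d (fullColors U f s)
    have h3 := hf.full_le
    omega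

lemma freeColors_subset (hf : Near G L U s b f) : freeColors G L U f v ⊆ stuck G L U s f :=
  fun _ hc => mem_stuck.2 fun _ hd => H.mem_full_of_reach hf hc hd

lemma two_mul_lt {a : ℕ} (ha : 3 ≤ a) (hak : a + 3 ≤ k) : 2 * k ≤ a * (k - a) := by
  obtain ⟨i, rfl⟩ := Nat.exists_eq_add_of_le ha
  obtain ⟨j, rfl⟩ := Nat.exists_eq_add_of_le hak
  have h9 := H.nine_le
  have : 3 + i + 3 + j - (3 + i) = 3 + j := by omega
  rw [this]
  nlinarith [Nat.zero_le (i * j)]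

lemma closed_card {C : Finset ℕ} (hC : MoveClosed G L U f C) (hCF : C ⊆ fullColors U f s) :
    C.card ≤ 2 ∨ k ≤ C.card + 2 := by
  by_contra! hcon
  have h2 := H.two_mul_lt (a := C.card) (by omega) (by omega)
  have hX := card_colored H.s_pos hCF
  have hs := H.s_pos
  have h3 : 3 ≤ (colored U f C).card := by
    rw [hX]; nlinarith [hcon.1]
  have hcut := H.sparse_U (X := colored U f C) (Y := U \ colored U f C) (filter_subset _ _)
    sdiff_subset disjoint_sdiff (by omega)
  have hsum : (colored U f C).card * (k - C.card) ≤
      ∑ x ∈ colored U f C, (nbrs G (U \ colored U f C) x).card := by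
    rw [← smul_eq_mul]
    refine card_nsmul_le_sum _ _ _ fun x hx => ?_
    rw [mem_colored] at hx
    have := hC.card_le_nbrs hx.1 hx.2 (W := U \ colored U f C) Subset.rfl fun y hy hyE =>
      mem_sdiff.2 ⟨hy, fun h => (mem_sdiff.1 hyE).2 (mem_colored.1 h).2⟩
    have h5 := le_card_sdiff C (L x)
    rw [H.list_card] at h5
    omega
  have hU := H.card_U_lt
  rw [hX] at hsum
  nlinarith

lemma le_card_stuck (hf : Near G L U s b f) : k ≤ (stuck G L U s f).card + 2 := by
  have h1 := card_le_card (H.freeColors_subset hf)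
  have h2 := H.le_card_freeColors (f := f)
  have h3 := H.nine_le
  rcases H.closed_card moveClosed_stuck (stuck_subset (s := s) (f := f) (G := G) (L := L))
    with h | h <;> omega

lemma card_stuck_lt (hf : Near G L U s b f) : (stuck G L U s f).card < k := by
  have h1 := card_le_card (stuck_subset (s := s) (f := f) (G := G) (L := L) (U := U))
  have h2 := hf.full_le
  have h3 := H.b_lt
  omega

lemma exists_core (hf : Near G L U s b f) : ∃ D, IsCore G L U s f D := by
  classical
  have h9 := H.nine_le
  have hB := H.le_card_stuck hf
  have hB' := H.card_stuck_lt hf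
  obtain ⟨D, hD, hmin⟩ := exists_min_image
    ((stuck G L U s f).powerset.filter fun C => MoveClosed G L U f C ∧ 3 ≤ C.card) card
    ⟨stuck G L U s f, by
      simp only [mem_filter, mem_powerset, Subset.rfl, true_and]
      exact ⟨moveClosed_stuck, by omega⟩⟩
  simp only [mem_filter, mem_powerset] at hD hmin
  refine ⟨D, hD.1, hD.2.1, hD.2.2, fun C hC hCc hC3 => ?_⟩
  have hDk := H.closed_card hD.2.1 (hD.1.trans stuck_subset)
  have hCk := H.closed_card hCc (hC.trans stuck_subset)
  have h1 := card_union_add_card_inter C D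
  have h2 := card_le_card (union_subset hC hD.1)
  have h3 := hmin (C ∩ D) ⟨inter_subset_right.trans hD.1, hCc.inter hD.2.1, by omega⟩
  exact inter_eq_right.1 (eq_of_subset_of_card_le inter_subset_right h3)

lemma le_card_core (hD : IsCore G L U s f D) : k ≤ D.card + 2 := by
  have := hD.three_le
  rcases H.closed_card hD.closed (hD.subset.trans stuck_subset) with h | h <;> omega

omit H in
lemma exists_route (hD : IsCore G L U s f D) {M : Finset ℕ} (hM : M ⊆ stuck G L U s f)
    (hcard : 3 ≤ M.card ∨ 2 ≤ M.card ∧ ¬ MoveClosed G L U f M) {d : ℕ} (hd : d ∈ D) :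
    ∃ c ∈ M, Route G L U f (stuck G L U s f) c d := by
  classical
  set C := (stuck G L U s f).filter fun d => ∃ c ∈ M, ReflTransGen (CanMove G L U f) c d with hC
  have hMC : M ⊆ C := fun c hc => mem_filter.2 ⟨hM hc, c, hc, .refl⟩
  have hCc : MoveClosed G L U f C := by
    intro c hc e he
    obtain ⟨hcB, a, ha, hac⟩ := mem_filter.1 hc
    exact mem_filter.2 ⟨moveClosed_stuck c hcB e he, a, ha, hac.tail he⟩
  have h3 : 3 ≤ C.card := by
    rcases hcard with h | ⟨h, hcl⟩
    · exact h.trans (card_le_card hMC)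
    · have hlt : M.card < C.card := card_lt_card
        (hMC.ssubset_of_ne (by rintro h; rw [h] at hcl; exact hcl hCc))
      omega
  obtain ⟨-, c, hc, hcd⟩ := mem_filter.1 (hD.least C (filter_subset _ _) hCc h3 hd)
  exact ⟨c, hc, moveClosed_stuck.route (hM hc) hcd⟩

/-- A vertex of core color cannot be freed without disturbing the other stuck vertices. -/
lemma not_freed (hf : Near G L U s b f) (hD : IsCore G L U s f D) {y : V}
    (hyD : f y ∈ D) (hg : Near G L U s b g)
    (h1 : ∀ x ∈ U, f x ∈ stuck G L U s f → x ≠ y → g x = f x)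
    (h2 : ∀ x ∈ U, g x ∈ stuck G L U s f → g x = f x) : s ≤ classSize U g (f y) := by
  by_contra hlt
  have h3 := H.le_card_freeColors (f := f)
  have h9 := H.nine_le
  obtain ⟨c, hc, hr⟩ := exists_route hD (H.freeColors_subset hf) (.inl (by omega)) hyD
  have hr' := hr.congr rfl h1 h2
  have hcg : c ∈ freeColors G L U g v := by
    have hcB := H.freeColors_subset hf hc
    rw [mem_freeColors] at hc ⊢
    refine ⟨hc.1, fun z hz hvz hgz => hc.2 z hz hvz ?_⟩
    rw [← h2 z hz (hgz ▸ hcB), hgz]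
  have := (mem_fullColors H.s_pos).1 (H.mem_full_of_reach hg hcg hr'.reflTransGen)
  omega

end Blocked

lemma ProperOn.update_update (hf : ProperOn G L U f) {x y : V} {c d : ℕ}
    (hc : c ∈ L x) (hd : d ∈ L y) (hcd : c ≠ d)
    (hx : ∀ z ∈ U, G.Adj x z → z ≠ y → f z ≠ c) (hy : ∀ z ∈ U, G.Adj y z → z ≠ x → f z ≠ d) :
    ProperOn G L U (Function.update (Function.update f x c) y d) := by
  refine ⟨fun z hz => ?_, fun z hz z' hz' hzz => ?_⟩
  · rcases eq_or_ne z y with rfl | h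
    · simpa using hd
    · rcases eq_or_ne z x with rfl | h'
      · simpa [h] using hc
      · simpa [h, h'] using hf.1 z hz
  · have hne := hzz.ne
    rcases eq_or_ne z y with rfl | h
    · rcases eq_or_ne z' x with rfl | h'
      · simpa [hne.symm] using hcd.symm
      · simpa [hne.symm, h'] using (hy z' hz' hzz h').symm
    · rcases eq_or_ne z' y with rfl | h2
      · rcases eq_or_ne z x with rfl | h3
        · simpa [h] using hcd
        · simpa [h, h3] using hy z hz hzz.symm h3
      · rcases eq_or_ne z x with rfl | h3
        · simpa [h, h2, hne.symm] using (hx z' hz' hzz h2).symm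
        · rcases eq_or_ne z' x with rfl | h4
          · simpa [h, h2, h3] using hx z hz hzz.symm h
          · simpa [h, h2, h3, h4] using hf.2 z hz z' hz' hzz

lemma classSize_update_update {x y : V} (hx : x ∈ U) (hy : y ∈ U) (hxy : x ≠ y) (c d e : ℕ) :
    classSize U (Function.update (Function.update f x c) y d) e +
        (if e = f x then 1 else 0) + (if e = f y then 1 else 0) =
      classSize U f e + (if e = c then 1 else 0) + (if e = d then 1 else 0) := by
  have h1 := classSize_update (f := f) hx c e
  have h2 := classSize_update (f := Function.update f x c) hy d e
  rw [Function.update_of_ne hxy.symm] at h2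
  omega

lemma Near.of_shift (hs : 0 < s) (hf : Near G L U s b f) (hg : ProperOn G L U g) {a d : ℕ}
    (ha : a ∈ fullColors U f s) (hd : d ∉ fullColors U f s)
    (hsize : ∀ e, classSize U g e + (if e = a then 1 else 0) =
      classSize U f e + (if e = d then 1 else 0)) : Near G L U s b g := by
  have had : a ≠ d := by rintro rfl; exact hd ha
  have hfa := (mem_fullColors hs).1 ha
  have hfd : classSize U f d < s :=
    lt_of_le_of_ne (hf.size_le d) fun h => hd ((mem_fullColors hs).2 h)
  refine ⟨hg, fun e => ?_, ?_⟩
  · have h1 := hsize e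
    have h2 := hf.size_le e
    split_ifs at h1 with h3 h4 h4 <;> subst_vars <;> omega
  · have hsub : fullColors U g s ⊆ insert d ((fullColors U f s).erase a) := by
      intro e he
      rw [mem_fullColors hs] at he
      rw [mem_insert, mem_erase, mem_fullColors hs]
      have h1 := hsize e
      have h2 := hf.size_le e
      by_cases h3 : e = d
      · exact .inl h3
      · rw [if_neg h3] at h1
        split_ifs at h1 with h4
        · omega
        · exact .inr ⟨h4, by omega⟩
    have h1 := card_le_card hsub
    have h2 := card_insert_le d ((fullColors U f s).erase a)
    have h3 := card_erase_add_one ha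
    have h4 := hf.full_le
    omega

lemma Near.of_same (hs : 0 < s) (hf : Near G L U s b f) (hg : ProperOn G L U g)
    (hsize : ∀ e, classSize U g e = classSize U f e) :
    Near G L U s b g ∧ fullColors U g s = fullColors U f s := by
  have hF : fullColors U g s = fullColors U f s := by
    ext e
    rw [mem_fullColors hs, mem_fullColors hs, hsize]
  exact ⟨⟨hg, fun e => by rw [hsize]; exact hf.size_le e, by rw [hF]; exact hf.full_le⟩, hF⟩

/-- The neighbours of `w` with a color of `D` that could take the color of `w` if only `w` lost
it. -/
def soloNbrs (G : SimpleGraph V) [DecidableRel G.Adj] (L : V → Finset ℕ) (U : Finset V)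
    (f : V → ℕ) (D : Finset ℕ) (w : V) : Finset V :=
  (colored U f D).filter fun y =>
    G.Adj w y ∧ f w ∈ L y ∧ ∀ z ∈ U, G.Adj y z → f z = f w → z = w

lemma mem_soloNbrs {w y : V} : y ∈ soloNbrs G L U f D w ↔ (y ∈ U ∧ f y ∈ D) ∧
    G.Adj w y ∧ f w ∈ L y ∧ ∀ z ∈ U, G.Adj y z → f z = f w → z = w := by
  simp only [soloNbrs, mem_filter, mem_colored]

/-- The vertices `w` and `y` can trade places, possibly after shifting along a route. -/
def Usable (G : SimpleGraph V) (L : V → Finset ℕ) (U : Finset V) (s : ℕ) (f : V → ℕ)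
    (w y : V) : Prop :=
  ∃ ψ ∈ L w, Route G L U f (stuck G L U s f) ψ (f y) ∧ ∀ z ∈ U, G.Adj w z → f z = ψ → z = y

lemma Usable.exists_swap {w y : V} (hu : Usable G L U s f w y) (hf : ProperOn G L U f)
    (hw : w ∈ U) (hy : y ∈ soloNbrs G L U f (stuck G L U s f) w)
    (hwF : f w ∉ stuck G L U s f) :
    ∃ g, ProperOn G L U g ∧ (∀ e, classSize U g e = classSize U f e) ∧
      (∀ x ∈ U, f x ∉ stuck G L U s f → x ≠ w → g x = f x) ∧
      (∀ x ∈ U, f x ∈ stuck G L U s f → x ≠ y → g x ∈ stuck G L U s f) ∧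
      g w ∈ stuck G L U s f ∧ g y = f w := by
  obtain ⟨ψ, hψ, hr, hfree⟩ := hu
  obtain ⟨⟨hyU, hyB⟩, hwy, hLy, hsolo⟩ := mem_soloNbrs.1 hy
  have hψB : ψ ∈ stuck G L U s f := by cases hr <;> assumption
  obtain ⟨h, hh, hsize, hstart, hend, hout, hin⟩ := hr.exists_shift hf
  have hwy' : w ≠ y := hwy.ne
  have hhw : h w = f w := hout w hw hwF
  have hhy : h y = f y := hend y hyU rfl
  refine ⟨Function.update (Function.update h w ψ) y (f w), ?_, fun e => ?_, fun x hx hxB hxw => ?_,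
    fun x hx hxB hxy => ?_, ?_, ?_⟩
  · refine hh.update_update hψ hLy (by rintro rfl; exact hwF hψB) (fun z hz hwz hzy hhz => ?_)
      fun z hz hyz hzw hhz => ?_
    · exact hzy (hfree z hz hwz (hstart z hz hhz))
    · by_cases hzB : f z ∈ stuck G L U s f
      · exact hwF (hhz ▸ hin z hz hzB)
      · exact hzw (hsolo z hz hyz (hout z hz hzB ▸ hhz))
  · have h1 := classSize_update_update (f := h) hw hyU hwy' ψ (f w) e
    have h2 := hsize e
    rw [hhw, hhy] at h1
    omega
  · have hxy : x ≠ y := by rintro rfl; exact hxB hyB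
    rw [Function.update_of_ne hxy, Function.update_of_ne hxw, hout x hx hxB]
  · have hxw : x ≠ w := by rintro rfl; exact hwF hxB
    rw [Function.update_of_ne hxy, Function.update_of_ne hxw]
    exact hin x hx hxB
  · simpa [hwy'] using hψB
  · simp

lemma card_eq_card_add_sum_fiber (A : Finset V) (f : V → ℕ) (Λ : Finset ℕ) :
    A.card = (A.filter (f · ∉ Λ)).card + ∑ ψ ∈ Λ, (A.filter (f · = ψ)).card := by
  rw [← card_filter_add_card_filter_not (s := A) (f · ∈ Λ), add_comm]
  congr 1
  rw [card_eq_sum_card_fiberwise (s := A.filter (f · ∈ Λ)) (f := f) (t := Λ)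
    fun x hx => (mem_filter.1 (mem_coe.1 hx)).2]
  refine sum_congr rfl fun ψ hψ => ?_
  congr 1
  ext x
  simp only [mem_filter]
  exact ⟨fun h => ⟨h.1.1, h.2⟩, fun h => ⟨⟨h.1, h.2 ▸ hψ⟩, h.2⟩⟩

/-- If a weighted estimate holds for every color class, then it holds for the whole set. -/
lemma card_le_of_fiberwise {A J : Finset V} {Λ : Finset ℕ} (p q : ℕ) (hpq : p ≤ q) (hAJ : A ⊆ J)
    (hJ : J.card ≤ Λ.card + 1)
    (h : ∀ ψ ∈ Λ, p * (A.filter (f · = ψ)).card + q ≤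
      q * (J.filter (f · = ψ)).card + q * if (∀ z ∈ J, f z ≠ ψ) then 1 else 0) :
    p * A.card ≤ q * (Λ.filter fun ψ => ∀ z ∈ J, f z ≠ ψ).card + q := by
  have h1 := card_eq_card_add_sum_fiber A f Λ
  have h2 := card_eq_card_add_sum_fiber J f Λ
  have h3 := sum_le_sum h
  simp only [sum_add_distrib, ← mul_sum, sum_const, smul_eq_mul] at h3
  rw [← card_filter] at h3
  have h4 : (A.filter (f · ∉ Λ)).card ≤ (J.filter (f · ∉ Λ)).card :=
    card_le_card (filter_subset_filter _ hAJ)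
  have h5 : p * (A.filter (f · ∉ Λ)).card ≤ q * (J.filter (f · ∉ Λ)).card :=
    Nat.mul_le_mul hpq h4
  have h6 := Nat.mul_le_mul_left q hJ
  rw [h2] at h6
  rw [h1]
  nlinarith

lemma card_filter_multi {S J : Finset V} {Λ : Finset ℕ} (hSJ : S ⊆ J)
    (hJ : J.card ≤ Λ.card + 1) :
    S.card ≤ (S.filter fun y => f y ∈ Λ ∧ ∀ z ∈ J, f z = f y → z = y).card +
      2 * (Λ.filter fun ψ => ∀ z ∈ J, f z ≠ ψ).card + 2 := by
  rw [← card_filter_add_card_filter_not (s := S)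
    (fun y => f y ∈ Λ ∧ ∀ z ∈ J, f z = f y → z = y)]
  set A := S.filter fun y => ¬ (f y ∈ Λ ∧ ∀ z ∈ J, f z = f y → z = y) with hA
  have hAJ : A ⊆ J := (filter_subset _ _).trans hSJ
  have := card_le_of_fiberwise (f := f) 1 2 (by norm_num) hAJ hJ fun ψ hψ => by
    have h1 : (A.filter (f · = ψ)).card ≤ (J.filter (f · = ψ)).card :=
      card_le_card (filter_subset_filter _ hAJ)
    by_cases h0 : ∀ z ∈ J, f z ≠ ψ
    · rw [if_pos h0]
      have : J.filter (f · = ψ) = ∅ := filter_eq_empty_iff.2 fun z hz => h0 z hz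
      rw [this, card_empty] at h1 ⊢
      omega
    · rw [if_neg h0]
      push Not at h0
      obtain ⟨z, hz, hzψ⟩ := h0
      have hpos : 0 < (J.filter (f · = ψ)).card := card_pos.2 ⟨z, mem_filter.2 ⟨hz, hzψ⟩⟩
      rcases Nat.eq_or_lt_of_le (Nat.succ_le_of_lt hpos) with h2 | h2
      · have : A.filter (f · = ψ) = ∅ := by
          refine filter_eq_empty_iff.2 fun y hy hyψ => ?_
          refine (mem_filter.1 hy).2 ⟨hyψ ▸ hψ, fun z' hz' hzy => ?_⟩
          exact card_le_one.1 h2.symm.le z' (mem_filter.2 ⟨hz', hzy.trans hyψ⟩) y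
            (mem_filter.2 ⟨hAJ hy, hyψ⟩)
        rw [this, card_empty]
        omega
      · omega
  omega

lemma card_filter_multi_of_no_pair {S J : Finset V} {Λ : Finset ℕ} (hSJ : S ⊆ J)
    (hJ : J.card ≤ Λ.card + 1)
    (hpair : ¬ ∃ y ∈ S, ∃ y' ∈ S, y ≠ y' ∧ f y = f y' ∧ f y ∈ Λ ∧
      ∀ z ∈ J, f z = f y → z = y ∨ z = y') :
    2 * S.card ≤ 2 * (S.filter fun y => f y ∈ Λ ∧ ∀ z ∈ J, f z = f y → z = y).card +
      3 * (Λ.filter fun ψ => ∀ z ∈ J, f z ≠ ψ).card + 3 := by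
  rw [← card_filter_add_card_filter_not (s := S)
    (fun y => f y ∈ Λ ∧ ∀ z ∈ J, f z = f y → z = y)]
  set A := S.filter fun y => ¬ (f y ∈ Λ ∧ ∀ z ∈ J, f z = f y → z = y) with hA
  have hAJ : A ⊆ J := (filter_subset _ _).trans hSJ
  have := card_le_of_fiberwise (f := f) 2 3 (by norm_num) hAJ hJ fun ψ hψ => by
    have h1 : (A.filter (f · = ψ)).card ≤ (J.filter (f · = ψ)).card :=
      card_le_card (filter_subset_filter _ hAJ)
    by_cases h0 : ∀ z ∈ J, f z ≠ ψ
    · rw [if_pos h0]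
      have : J.filter (f · = ψ) = ∅ := filter_eq_empty_iff.2 fun z hz => h0 z hz
      rw [this, card_empty] at h1 ⊢
      omega
    · rw [if_neg h0]
      push Not at h0
      obtain ⟨z, hz, hzψ⟩ := h0
      have hpos : 0 < (J.filter (f · = ψ)).card := card_pos.2 ⟨z, mem_filter.2 ⟨hz, hzψ⟩⟩
      rcases Nat.eq_or_lt_of_le (Nat.succ_le_of_lt hpos) with h2 | h2
      · have : A.filter (f · = ψ) = ∅ := by
          refine filter_eq_empty_iff.2 fun y hy hyψ => ?_
          refine (mem_filter.1 hy).2 ⟨hyψ ▸ hψ, fun z' hz' hzy => ?_⟩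
          exact card_le_one.1 h2.symm.le z' (mem_filter.2 ⟨hz', hzy.trans hyψ⟩) y
            (mem_filter.2 ⟨hAJ hy, hyψ⟩)
        rw [this, card_empty]
        omega
      · rcases Nat.eq_or_lt_of_le h2 with h3 | h3
        · have h4 : (A.filter (f · = ψ)).card ≤ 1 := by
            by_contra! h4
            have heq := eq_of_subset_of_card_le (filter_subset_filter (f · = ψ) hAJ) (by omega)
            obtain ⟨y, y', hyy, h5⟩ := card_eq_two.1 h3.symm
            have hy : y ∈ A.filter (f · = ψ) := by rw [heq, h5]; simp
            have hy' : y' ∈ A.filter (f · = ψ) := by rw [heq, h5]; simp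
            rw [mem_filter] at hy hy'
            refine hpair ⟨y, (mem_filter.1 hy.1).1, y', (mem_filter.1 hy'.1).1, hyy,
              hy.2.trans hy'.2.symm, hy.2 ▸ hψ, fun z hz hzy => ?_⟩
            have : z ∈ J.filter (f · = ψ) := mem_filter.2 ⟨hz, hzy.trans hy.2⟩
            rw [h5] at this
            simpa using this
          omega
        · omega
  omega

namespace Blocked

variable (H : Blocked G L U s b k v)
include H

lemma exists_adj_of_solo (hf : Near G L U s b f) (hD : IsCore G L U s f D) {w y : V}
    (hw : w ∈ U) (hwF : f w ∉ fullColors U f s) (hy : y ∈ soloNbrs G L U f D w) {δ : ℕ}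
    (hδ : δ ∈ L w) (hδF : δ ∉ fullColors U f s) (hδw : δ ≠ f w) :
    ∃ z ∈ U, G.Adj w z ∧ f z = δ := by
  by_contra! hcon
  obtain ⟨⟨hyU, hyD⟩, hwy, hLy, hsolo⟩ := mem_soloNbrs.1 hy
  have hsub := stuck_subset (G := G) (L := L) (U := U) (s := s) (f := f)
  have hyF : f y ∈ fullColors U f s := hsub (hD.subset hyD)
  have hg : ProperOn G L U (Function.update (Function.update f w δ) y (f w)) :=
    hf.proper.update_update hδ hLy hδw (fun z hz hwz _ => hcon z hz hwz)
      fun z hz hyz hzw h => hzw (hsolo z hz hyz h)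
  have hsize : ∀ e, classSize U (Function.update (Function.update f w δ) y (f w)) e +
      (if e = f y then 1 else 0) = classSize U f e + (if e = δ then 1 else 0) := by
    intro e
    have := classSize_update_update (f := f) hw hyU hwy.ne δ (f w) e
    omega
  have h1 := H.not_freed hf hD hyD (hf.of_shift H.s_pos hg hyF hδF hsize)
    (fun x hx hxB hxy => by
      have hxw : x ≠ w := by rintro rfl; exact hwF (hsub hxB)
      rw [Function.update_of_ne hxy, Function.update_of_ne hxw])
    (fun x hx hxB => by
      rcases eq_or_ne x y with rfl | hxy
      · rw [Function.update_self] at hxB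
        exact absurd (hsub hxB) hwF
      · rw [Function.update_of_ne hxy] at hxB ⊢
        rcases eq_or_ne x w with rfl | hxw
        · rw [Function.update_self] at hxB
          exact absurd (hsub hxB) hδF
        · rw [Function.update_of_ne hxw])
  have h2 := hsize (f y)
  have h3 := (mem_fullColors H.s_pos).1 hyF
  rw [if_pos rfl, if_neg (by rintro rfl; exact hδF hyF)] at h2
  omega

lemma exists_adj_of_solo_of_move (hf : Near G L U s b f) (hD : IsCore G L U s f D) {w y x₀ : V}
    (hw : w ∈ U) (hwF : f w ∉ fullColors U f s) (hy : y ∈ soloNbrs G L U f D w)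
    (hx₀ : x₀ ∈ U) (hXF : f x₀ ∈ fullColors U f s) (hXB : f x₀ ∉ stuck G L U s f) {δ : ℕ}
    (hδ : δ ∈ L x₀) (hδF : δ ∉ fullColors U f s) (hfree : ∀ z ∈ U, G.Adj x₀ z → f z ≠ δ)
    (hxy₀ : ¬ G.Adj x₀ y) (hX : f x₀ ∈ L w) : ∃ z ∈ U, G.Adj w z ∧ f z = f x₀ := by
  by_contra! hcon
  obtain ⟨⟨hyU, hyD⟩, hwy, hLy, hsolo⟩ := mem_soloNbrs.1 hy
  have hsub := stuck_subset (G := G) (L := L) (U := U) (s := s) (f := f)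
  have hyF : f y ∈ fullColors U f s := hsub (hD.subset hyD)
  have hδX : δ ≠ f x₀ := by rintro rfl; exact hδF hXF
  have hwx : w ≠ x₀ := by rintro rfl; exact hwF hXF
  have hyx : y ≠ x₀ := by rintro rfl; exact hXB (hD.subset hyD)
  set f₁ := Function.update f x₀ δ with hf₁
  have hf₁w : f₁ w = f w := Function.update_of_ne hwx _ _
  have hf₁y : f₁ y = f y := Function.update_of_ne hyx _ _
  have hg₁ : ProperOn G L U f₁ := hf.proper.update hδ hfree
  have hg : ProperOn G L U (Function.update (Function.update f₁ w (f x₀)) y (f w)) := by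
    refine hg₁.update_update hX hLy (by rintro h; exact hwF (h ▸ hXF))
      (fun z hz hwz hzy h => ?_) fun z hz hyz hzw h => ?_
    · rcases eq_or_ne z x₀ with rfl | hzx
      · exact hcon _ hz hwz rfl
      · rw [hf₁, Function.update_of_ne hzx] at h
        exact hcon z hz hwz h
    · rcases eq_or_ne z x₀ with rfl | hzx
      · exact hxy₀ hyz.symm
      · rw [hf₁, Function.update_of_ne hzx] at h
        exact hzw (hsolo z hz hyz h)
  have hsize : ∀ e, classSize U (Function.update (Function.update f₁ w (f x₀)) y (f w)) e +
      (if e = f y then 1 else 0) = classSize U f e + (if e = δ then 1 else 0) := by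
    intro e
    have h1 := classSize_update_update (f := f₁) hw hyU hwy.ne (f x₀) (f w) e
    have h2 := classSize_update (f := f) hx₀ δ e
    rw [hf₁w, hf₁y] at h1
    rw [← hf₁] at h2
    omega
  have h1 := H.not_freed hf hD hyD (hf.of_shift H.s_pos hg hyF hδF hsize)
    (fun x hx hxB hxy => by
      have hxw : x ≠ w := by rintro rfl; exact hwF (hsub hxB)
      have hxx : x ≠ x₀ := by rintro rfl; exact hXB hxB
      rw [Function.update_of_ne hxy, Function.update_of_ne hxw, hf₁, Function.update_of_ne hxx])
    (fun x hx hxB => by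
      rcases eq_or_ne x y with rfl | hxy
      · rw [Function.update_self] at hxB
        exact absurd (hsub hxB) hwF
      · rw [Function.update_of_ne hxy] at hxB ⊢
        rcases eq_or_ne x w with rfl | hxw
        · rw [Function.update_self] at hxB
          exact absurd hxB hXB
        · rw [Function.update_of_ne hxw] at hxB ⊢
          rcases eq_or_ne x x₀ with rfl | hxx
          · rw [hf₁, Function.update_self] at hxB
            exact absurd (hsub hxB) hδF
          · rw [hf₁, Function.update_of_ne hxx])
  have h2 := hsize (f y)
  have h3 := (mem_fullColors H.s_pos).1 hyF
  rw [if_pos rfl, if_neg (by rintro rfl; exact hδF hyF)] at h2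
  omega

lemma card_nbrs_colored_le {w : V} (B : Finset ℕ)
    (hhit : ∀ d ∈ L w, d ∉ B → d ≠ f w → ∃ z ∈ U, G.Adj w z ∧ f z = d) :
    (nbrs G (colored U f B) w).card ≤ (L w ∩ B).card + 1 := by
  have h1 : ((L w \ B).erase (f w)).card ≤ (nbrs G (U \ colored U f B) w).card := by
    refine card_le_nbrs_of_hit (f := f) fun d hd => ?_
    obtain ⟨hdw, hd⟩ := mem_erase.1 hd
    obtain ⟨hdL, hdB⟩ := mem_sdiff.1 hd
    obtain ⟨z, hz, hwz, rfl⟩ := hhit d hdL hdB hdw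
    exact ⟨z, mem_sdiff.2 ⟨hz, fun h => hdB (mem_colored.1 h).2⟩, hwz, rfl⟩
  have h2 : (nbrs G (colored U f B) w).card + (nbrs G (U \ colored U f B) w).card ≤
      (nbrs G U w).card := by
    rw [← card_union_of_disjoint]
    · refine card_le_card fun z hz => ?_
      rcases mem_union.1 hz with h | h
      · exact mem_nbrs.2 ⟨(mem_colored.1 (mem_nbrs.1 h).1).1, (mem_nbrs.1 h).2⟩
      · exact mem_nbrs.2 ⟨(mem_sdiff.1 (mem_nbrs.1 h).1).1, (mem_nbrs.1 h).2⟩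
    · exact (disjoint_sdiff (s := colored U f B) (t := U)).mono (filter_subset _ _)
        (filter_subset _ _)
  have h3 := H.deg_le w
  have h4 := pred_card_le_card_erase (s := L w \ B) (a := f w)
  have h5 := card_sdiff_add_card_inter (L w) B
  have h6 := H.list_card w
  omega

lemma exists_not_adj {w : V} {S S' : Finset V} (hS : ∀ y ∈ S, G.Adj w y) (hS5 : 5 ≤ S.card)
    (hS' : S' ⊆ S) (hS2 : 2 ≤ S'.card) :
    ∃ y₁ ∈ S', ∃ y₂ ∈ S, y₂ ≠ y₁ ∧ ¬ G.Adj y₁ y₂ := by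
  by_contra! hcon
  obtain ⟨a, ha, c, hc, hac⟩ := one_lt_card.1 hS2
  obtain ⟨Y, hY, hY3⟩ := exists_subset_card_eq (s := (S.erase a).erase c) (n := 3) (by
    have h1 := pred_card_le_card_erase (s := S) (a := a)
    have h2 := pred_card_le_card_erase (s := S.erase a) (a := c)
    omega)
  have hYS : ∀ y ∈ Y, y ∈ S ∧ y ≠ a ∧ y ≠ c := by
    intro y hy
    have := hY hy
    simp only [mem_erase] at this
    tauto
  have hwa := (hS a (hS' ha)).ne
  have hwc := (hS c (hS' hc)).ne
  have hX : ({w, a, c} : Finset V).card = 3 := card_eq_three.2 ⟨w, a, c, hwa, hwc, hac, rfl⟩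
  have hdisj : Disjoint ({w, a, c} : Finset V) Y := by
    rw [disjoint_right]
    intro y hy hyX
    obtain ⟨h1, h2, h3⟩ := hYS y hy
    simp only [mem_insert, mem_singleton, h2, h3, or_false] at hyX
    exact G.irrefl (hyX ▸ hS y h1)
  have h1 := H.sparse {w, a, c} Y hdisj (by omega)
  have hall : ∀ x ∈ ({w, a, c} : Finset V), (nbrs G Y x).card = 3 := by
    intro x hx
    rw [← hY3]
    congr 1
    refine filter_true_of_mem fun y hy => ?_
    obtain ⟨hyS, hya, hyc⟩ := hYS y hy
    simp only [mem_insert, mem_singleton] at hx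
    rcases hx with rfl | rfl | rfl
    · exact hS y hyS
    · exact hcon _ ha y hyS hya
    · exact hcon _ hc y hyS hyc
  rw [sum_congr rfl hall, sum_const, hX, hY3] at h1
  norm_num at h1

/-- Many solo neighbours yield a recoloring with the same class sizes in which a stuck color
is released. -/
lemma exists_release (hf : Near G L U s b f) (hD : IsCore G L U s f D) {w : V} (hw : w ∈ U)
    (hwF : f w ∉ fullColors U f s) {S : Finset V} (hS : S ⊆ soloNbrs G L U f D w)
    (hhit : ∀ d ∈ L w, d ∉ stuck G L U s f → d ≠ f w → ∃ z ∈ U, G.Adj w z ∧ f z = d)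
    (hS6 : 6 ≤ S.card)
    (halt : 8 ≤ S.card ∨ (∀ C ⊆ stuck G L U s f, C.card = 2 → ¬ MoveClosed G L U f C) ∨
      7 ≤ S.card ∧ ¬ ∃ y ∈ S, ∃ y' ∈ S, y ≠ y' ∧ f y = f y' ∧ f y ∈ L w ∧
        ∀ z ∈ U, G.Adj w z → f z = f y → z = y ∨ z = y') :
    ∃ g, ∃ y₁ ∈ S, Near G L U s b g ∧ fullColors U g s = fullColors U f s ∧
      (∃ c ∈ stuck G L U s f, c ∉ stuck G L U s g) ∧
      (∀ x ∈ U, f x ∉ stuck G L U s f → x ≠ w → g x = f x) ∧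
      (∀ x ∈ U, f x ∈ stuck G L U s f → x ≠ y₁ → g x ∈ stuck G L U s f) ∧
      g w ∈ stuck G L U s f ∧ g y₁ = f w := by
  classical
  set B := stuck G L U s f with hB
  have hBF : B ⊆ fullColors U f s := stuck_subset
  have hwB : f w ∉ B := fun h => hwF (hBF h)
  set J := nbrs G (colored U f B) w with hJ
  set Λ := L w ∩ B with hΛ
  set M₀ := Λ.filter fun ψ => ∀ z ∈ J, f z ≠ ψ with hM₀
  set T := S.filter fun y => f y ∈ Λ ∧ ∀ z ∈ J, f z = f y → z = y with hT
  have hSolo : ∀ y ∈ S, y ∈ soloNbrs G L U f B w := by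
    intro y hy
    have := mem_soloNbrs.1 (hS hy)
    exact mem_soloNbrs.2 ⟨⟨this.1.1, hD.subset this.1.2⟩, this.2⟩
  have hSJ : S ⊆ J := by
    intro y hy
    have := mem_soloNbrs.1 (hSolo y hy)
    exact mem_nbrs.2 ⟨mem_colored.2 this.1, this.2.1⟩
  have hmemJ : ∀ z ∈ U, G.Adj w z → f z ∈ B → z ∈ J := fun z hz hwz hzB =>
    mem_nbrs.2 ⟨mem_colored.2 ⟨hz, hzB⟩, hwz⟩
  have hJc : J.card ≤ Λ.card + 1 := H.card_nbrs_colored_le B hhit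
  have hmulti := card_filter_multi (f := f) hSJ hJc
  rw [← hM₀, ← hT] at hmulti
  have hM₀B : M₀ ⊆ B := (filter_subset _ _).trans inter_subset_right
  have hTu : ∀ y ∈ T, Usable G L U s f w y := by
    intro y hy
    obtain ⟨-, hyΛ, huniq⟩ := mem_filter.1 hy
    obtain ⟨hyL, hyB⟩ := mem_inter.1 hyΛ
    exact ⟨f y, hyL, .nil hyB, fun z hz hwz hzy => huniq z (hmemJ z hz hwz (hzy ▸ hyB)) hzy⟩
  have hRu : (3 ≤ M₀.card ∨ 2 ≤ M₀.card ∧ ¬ MoveClosed G L U f M₀) →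
      ∀ y ∈ S, Usable G L U s f w y := by
    intro h y hy
    obtain ⟨ψ, hψ, hr⟩ := exists_route hD hM₀B h (mem_soloNbrs.1 (hS hy)).1.2
    obtain ⟨hψΛ, hno⟩ := mem_filter.1 hψ
    refine ⟨ψ, (mem_inter.1 hψΛ).1, hr, fun z hz hwz hzψ => ?_⟩
    exact absurd hzψ (hno z (hmemJ z hz hwz (hzψ ▸ hM₀B hψ)))
  have htwo : 2 ≤ (S.filter fun y => Usable G L U s f w y).card := by
    by_cases hcase : 3 ≤ M₀.card ∨ 2 ≤ M₀.card ∧ ¬ MoveClosed G L U f M₀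
    · rw [filter_true_of_mem (hRu hcase)]
      omega
    · have hTle : T.card ≤ (S.filter fun y => Usable G L U s f w y).card :=
        card_le_card fun y hy => mem_filter.2 ⟨(mem_filter.1 hy).1, hTu y hy⟩
      refine le_trans ?_ hTle
      rcases Nat.lt_or_ge M₀.card 2 with h2 | h2
      · omega
      · have hM2 : M₀.card = 2 := by
          by_contra; exact hcase (.inl (by omega))
        rcases halt with h8 | hcl | ⟨h7, hpair⟩
        · omega
        · exact absurd (.inr ⟨h2, hcl M₀ hM₀B hM2⟩) hcase
        · have := card_filter_multi_of_no_pair (f := f) hSJ hJc (by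
            rintro ⟨y, hy, y', hy', hne, heq, hyΛ, huniq⟩
            obtain ⟨hyL, hyB⟩ := mem_inter.1 hyΛ
            exact hpair ⟨y, hy, y', hy', hne, heq, hyL, fun z hz hwz hzy =>
              huniq z (hmemJ z hz hwz (hzy ▸ hyB)) hzy⟩)
          rw [← hM₀, ← hT] at this
          omega
  obtain ⟨y₁, hy₁, y₂, hy₂, hne, hnadj⟩ := H.exists_not_adj
    (fun y hy => (mem_soloNbrs.1 (hS hy)).2.1) (by omega) (filter_subset _ _) htwo
  obtain ⟨hy₁S, hu⟩ := mem_filter.1 hy₁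
  obtain ⟨g, hg, hsize, hout, hin, hgw, hgy⟩ :=
    hu.exists_swap hf.proper hw (hSolo y₁ hy₁S) hwB
  obtain ⟨hgN, hgF⟩ := hf.of_same H.s_pos hg hsize
  obtain ⟨⟨hy₂U, hy₂B⟩, -, hLy, hsolo⟩ := mem_soloNbrs.1 (hSolo y₂ hy₂)
  have hgy₂ := hin y₂ hy₂U hy₂B hne
  refine ⟨g, y₁, hy₁S, hgN, hgF, ⟨g y₂, hgy₂, fun hst => ?_⟩, hout, hin, hgw, hgy⟩
  have hmove : CanMove G L U g (g y₂) (f w) := by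
    refine ⟨y₂, hy₂U, rfl, hLy, fun h => hwB (h ▸ hgy₂), fun z hz hyz hgz => ?_⟩
    have hzy : z ≠ y₁ := by rintro rfl; exact hnadj hyz.symm
    have hzw : z ≠ w := by rintro rfl; exact hwB (hgz ▸ hgw)
    by_cases hzB : f z ∈ B
    · exact hwB (hgz ▸ hin z hz hzB hzy)
    · exact hzw (hsolo z hz hyz (hout z hz hzB hzw ▸ hgz))
  exact hwF (hgF ▸ mem_stuck.1 hst _ (.single hmove))

end Blocked

/-- The vertices whose color is not full. -/
def low (U : Finset V) (f : V → ℕ) (s : ℕ) : Finset V := U \ colored U f (fullColors U f s)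

lemma mem_low {x : V} : x ∈ low U f s ↔ x ∈ U ∧ f x ∉ fullColors U f s := by
  simp only [low, mem_sdiff, mem_colored]
  tauto

lemma sum_nbrs_comm (X Y : Finset V) :
    ∑ x ∈ X, (nbrs G Y x).card = ∑ y ∈ Y, (nbrs G X y).card := by
  unfold nbrs
  simp only [card_filter]
  rw [sum_comm]
  simp only [G.adj_comm]

lemma card_nbrs_union {X Y : Finset V} (h : Disjoint X Y) (x : V) :
    (nbrs G (X ∪ Y) x).card = (nbrs G X x).card + (nbrs G Y x).card := by
  unfold nbrs
  rw [filter_union, card_union_of_disjoint (disjoint_filter_filter h)]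

lemma card_low_add (hs : 0 < s) :
    (low U f s).card + (fullColors U f s).card * s = U.card := by
  unfold low
  rw [← card_colored hs Subset.rfl]
  exact card_sdiff_add_card_eq_card (filter_subset _ _)

lemma MoveClosed.card_sdiff_full_le {C : Finset ℕ} (hC : MoveClosed G L U f C)
    (hCF : C ⊆ fullColors U f s) {x : V} (hx : x ∈ U) (hfx : f x ∈ C) :
    (L x \ fullColors U f s).card ≤ (nbrs G (low U f s) x).card :=
  hC.card_le_nbrs hx hfx (sdiff_subset_sdiff Subset.rfl hCF) fun _ hy hyE =>
    mem_low.2 ⟨hy, (mem_sdiff.1 hyE).2⟩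

lemma MoveClosed.two_mul_le_add_solo {C : Finset ℕ} (hC : MoveClosed G L U f C)
    (hCF : C ⊆ fullColors U f s) {y : V} (hy : y ∈ U) (hfy : f y ∈ C) :
    2 * (L y \ fullColors U f s).card ≤ (nbrs G (low U f s) y).card +
      ((low U f s).filter fun w => y ∈ soloNbrs G L U f C w).card := by
  rw [card_eq_card_add_sum_fiber (nbrs G (low U f s) y) f (L y \ fullColors U f s),
    card_eq_card_add_sum_fiber ((low U f s).filter fun w => y ∈ soloNbrs G L U f C w) f
      (L y \ fullColors U f s)]
  have key : ∀ α ∈ L y \ fullColors U f s, 2 ≤ ((nbrs G (low U f s) y).filter (f · = α)).card +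
      (((low U f s).filter fun w => y ∈ soloNbrs G L U f C w).filter (f · = α)).card := by
    intro α hα
    obtain ⟨hαL, hαF⟩ := mem_sdiff.1 hα
    obtain ⟨w, hw, hyw, rfl⟩ := hC.exists_adj hy hfy hαL fun h => hαF (hCF h)
    have hwl : w ∈ low U f s := mem_low.2 ⟨hw, hαF⟩
    have hw1 : w ∈ (nbrs G (low U f s) y).filter (f · = f w) :=
      mem_filter.2 ⟨mem_nbrs.2 ⟨hwl, hyw⟩, rfl⟩
    have hpos : 0 < ((nbrs G (low U f s) y).filter (f · = f w)).card := card_pos.2 ⟨w, hw1⟩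
    by_cases h1 : ((nbrs G (low U f s) y).filter (f · = f w)).card ≤ 1
    · have : 0 < (((low U f s).filter fun w => y ∈ soloNbrs G L U f C w).filter
          (f · = f w)).card := by
        refine card_pos.2 ⟨w, mem_filter.2 ⟨mem_filter.2 ⟨hwl, mem_soloNbrs.2
          ⟨⟨hy, hfy⟩, hyw.symm, hαL, fun z hz hyz hzw => ?_⟩⟩, rfl⟩⟩
        refine card_le_one.1 h1 z (mem_filter.2 ⟨mem_nbrs.2 ⟨mem_low.2 ⟨hz, ?_⟩, hyz⟩, hzw⟩) w hw1
        rw [hzw]; exact hαF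
      omega
    · omega
  have := sum_le_sum key
  rw [sum_const, smul_eq_mul, sum_add_distrib] at this
  omega

/-- Averaging over the vertices of low color finds one with many solo neighbours. -/
lemma MoveClosed.exists_many_solo {C : Finset ℕ} (hC : MoveClosed G L U f C)
    (hCF : C ⊆ fullColors U f s) {Y : Finset V} (hY : Y ⊆ colored U f C) {m : ℕ}
    (h : ∑ y ∈ Y, (nbrs G (low U f s) y).card + (low U f s).card * m <
      ∑ y ∈ Y, 2 * (L y \ fullColors U f s).card) :
    ∃ w ∈ U, f w ∉ fullColors U f s ∧ m < (soloNbrs G L U f C w ∩ Y).card := by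
  by_contra! hcon
  have h1 : ∑ y ∈ Y, 2 * (L y \ fullColors U f s).card ≤
      ∑ y ∈ Y, ((nbrs G (low U f s) y).card +
        ((low U f s).filter fun w => y ∈ soloNbrs G L U f C w).card) :=
    sum_le_sum fun y hy =>
      hC.two_mul_le_add_solo hCF (mem_colored.1 (hY hy)).1 (mem_colored.1 (hY hy)).2
  have h2 : ∑ y ∈ Y, ((low U f s).filter fun w => y ∈ soloNbrs G L U f C w).card =
      ∑ w ∈ low U f s, (soloNbrs G L U f C w ∩ Y).card := by
    simp only [card_filter]
    rw [sum_comm]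
    refine sum_congr rfl fun w _ => ?_
    rw [← card_filter, inter_comm, filter_mem_eq_inter]
  have h3 : ∑ w ∈ low U f s, (soloNbrs G L U f C w ∩ Y).card ≤ (low U f s).card * m := by
    rw [← smul_eq_mul]
    exact sum_le_card_nsmul _ _ _ fun w hw => hcon w (mem_low.1 hw).1 (mem_low.1 hw).2
  rw [sum_add_distrib] at h1
  omega

namespace Blocked

variable (H : Blocked G L U s b k v)
include H

lemma sum_nbrs_low_le (Y : Finset V) (hY : Y ⊆ U) :
    ∑ y ∈ Y, (nbrs G (low U f s) y).card ≤ (low U f s).card * k := by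
  rw [sum_nbrs_comm, ← smul_eq_mul]
  refine sum_le_card_nsmul _ _ _ fun w _ => le_trans (card_le_card ?_) (H.deg_le w)
  exact filter_subset_filter _ hY

/-- Edge count for a closed pair of colors inside a closed set. -/
lemma sum_add_sum_le {B C : Finset ℕ} (hB : MoveClosed G L U f B) (hC : MoveClosed G L U f C)
    (hCB : C ⊆ B) (h3 : 3 ≤ U.card) :
    ∑ x ∈ colored U f C, (L x ∩ (B \ C)).card +
      ∑ x ∈ colored U f (B \ C), (L x \ B).card + 4 ≤ 2 * U.card := by
  have hsub : colored U f (B \ C) ⊆ U := filter_subset _ _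
  have hcut := H.sparse_U (X := colored U f (B \ C)) (Y := U \ colored U f (B \ C)) hsub
    sdiff_subset disjoint_sdiff (by rw [add_comm, card_sdiff_add_card_eq_card hsub]; exact h3)
  have hdisj : Disjoint (colored U f C) (U \ colored U f B) := by
    refine disjoint_left.2 fun x hx hx' => ?_
    exact (mem_sdiff.1 hx').2 (mem_colored.2 ⟨(mem_colored.1 hx).1, hCB (mem_colored.1 hx).2⟩)
  have heq : U \ colored U f (B \ C) = colored U f C ∪ (U \ colored U f B) := by
    ext x
    simp only [mem_sdiff, mem_colored, mem_union]
    have := @hCB (f x)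
    tauto
  rw [heq, sum_congr rfl fun x _ => card_nbrs_union hdisj x, sum_add_distrib, sum_nbrs_comm]
    at hcut
  have h1 : ∑ x ∈ colored U f C, (L x ∩ (B \ C)).card ≤
      ∑ x ∈ colored U f C, (nbrs G (colored U f (B \ C)) x).card := by
    refine sum_le_sum fun x hx => ?_
    rw [mem_colored] at hx
    refine hC.card_le_nbrs hx.1 hx.2 (fun d hd => ?_) fun y hy hyE =>
      mem_colored.2 ⟨hy, (mem_inter.1 hyE).2⟩
    simp only [mem_inter, mem_sdiff] at hd ⊢
    tauto
  have h2 : ∑ x ∈ colored U f (B \ C), (L x \ B).card ≤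
      ∑ x ∈ colored U f (B \ C), (nbrs G (U \ colored U f B) x).card := by
    refine sum_le_sum fun x hx => ?_
    rw [mem_colored] at hx
    exact hB.card_le_nbrs hx.1 (mem_sdiff.1 hx.2).1 Subset.rfl fun y hy hyE =>
      mem_sdiff.2 ⟨hy, fun h => (mem_sdiff.1 hyE).2 (mem_colored.1 h).2⟩
  omega

lemma le_card_list_sdiff (x : V) (B : Finset ℕ) : k ≤ (L x \ B).card + B.card := by
  have := le_card_sdiff B (L x)
  rw [H.list_card] at this
  omega

lemma le_card_list_inter {B C : Finset ℕ} (x : V) :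
    k ≤ (L x ∩ (B \ C)).card + (L x \ B).card + C.card := by
  have h1 := H.le_card_list_sdiff x C
  have h2 : (L x \ C).card ≤ (L x ∩ (B \ C)).card + (L x \ B).card := by
    refine le_trans (card_le_card fun d hd => ?_) (card_union_le _ _)
    simp only [mem_inter, mem_sdiff, mem_union] at hd ⊢
    tauto
  omega

lemma core_eq_stuck (hD : IsCore G L U s f D)
    (hB : (stuck G L U s f).card + 2 = k) : D = stuck G L U s f :=
  eq_of_subset_of_card_le hD.subset (by have := H.le_card_core hD; omega)

end Blocked

namespace Blocked

variable (H : Blocked G L U s b k v)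
include H

lemma three_le_card (hf : Near G L U s b f) : 3 ≤ U.card := by
  have h1 := H.le_card_stuck hf
  have h2 := card_le_card (stuck_subset (G := G) (L := L) (U := U) (s := s) (f := f))
  have h3 := card_low_add (U := U) (f := f) H.s_pos
  have h4 := H.s_pos
  have h9 := H.nine_le
  nlinarith

omit H in
lemma sum_colored_split {C B : Finset ℕ} (h : C ⊆ B) (φ : V → ℕ) :
    ∑ x ∈ colored U f B, φ x = ∑ x ∈ colored U f C, φ x + ∑ x ∈ colored U f (B \ C), φ x := by
  have hdisj : Disjoint (colored U f C) (colored U f (B \ C)) := by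
    refine disjoint_left.2 fun x hx hx' => ?_
    exact (mem_sdiff.1 (mem_colored.1 hx').2).2 (mem_colored.1 hx).2
  rw [← sum_union hdisj]
  congr 1
  ext x
  simp only [mem_colored, mem_union, mem_sdiff]
  have := @h (f x)
  tauto

omit H in
lemma card_mul_le_sum {C : Finset ℕ} (hs : 0 < s) (hC : C ⊆ fullColors U f s) {φ : V → ℕ} {m : ℕ}
    (h : ∀ x ∈ colored U f C, m ≤ φ x) : C.card * s * m ≤ ∑ x ∈ colored U f C, φ x := by
  rw [← card_colored hs hC, ← smul_eq_mul]
  exact card_nsmul_le_sum _ _ _ h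

lemma exists_many_solo_of_full_eq (hf : Near G L U s b f)
    (hB : (stuck G L U s f).card + 2 = k) (hF : fullColors U f s = stuck G L U s f) :
    ∃ w ∈ U, f w ∉ fullColors U f s ∧ 6 ≤ (soloNbrs G L U f (stuck G L U s f) w).card ∧
      (8 ≤ (soloNbrs G L U f (stuck G L U s f) w).card ∨
        ∀ C ⊆ stuck G L U s f, C.card = 2 → ¬ MoveClosed G L U f C) := by
  set B := stuck G L U s f with hBdef
  have hBF : B ⊆ fullColors U f s := stuck_subset
  have h9 := H.nine_le
  have hs := H.s_pos
  have hU := H.card_U_lt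
  have hN := card_low_add (U := U) (f := f) hs
  have hclosed : MoveClosed G L U f B := moveClosed_stuck
  have hcB : colored U f B ⊆ U := filter_subset _ _
  have hedges := H.sum_nbrs_low_le (f := f) _ hcB
  have ha : ∀ x, 2 ≤ (L x \ B).card := fun x => by
    have := H.le_card_list_sdiff x B; omega
  have hN2 : (low U f s).card + 1 ≤ 2 * s := by
    rw [hF] at hN
    have : k = B.card + 2 := hB.symm
    subst this
    nlinarith
  by_cases hC : ∀ C ⊆ B, C.card = 2 → ¬ MoveClosed G L U f C
  · have hsum : B.card * s * 4 ≤ ∑ y ∈ colored U f B, 2 * (L y \ fullColors U f s).card := by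
      refine card_mul_le_sum hs hBF fun x _ => ?_
      have := ha x
      rw [hF]; omega
    obtain ⟨w, hw, hwF, hm⟩ := hclosed.exists_many_solo hBF Subset.rfl (m := B.card - 2) (by
      obtain ⟨m, hm⟩ : ∃ m, B.card = m + 2 := ⟨B.card - 2, by omega⟩
      have hkm : k = m + 4 := by omega
      rw [hm] at hsum ⊢
      rw [hkm] at hedges
      simp only [Nat.add_sub_cancel]
      nlinarith)
    have := card_le_card (inter_subset_left (s₁ := soloNbrs G L U f B w) (s₂ := colored U f B))
    exact ⟨w, hw, hwF, by omega, .inr hC⟩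
  · push Not at hC
    obtain ⟨C, hCB, hC2, hCc⟩ := hC
    have hcut := H.sum_add_sum_le hclosed hCc hCB (H.three_le_card hf)
    have h1 := card_mul_le_sum (m := 2) hs (sdiff_subset.trans hBF) (C := B \ C)
      (φ := fun x => (L x \ B).card) fun x _ => ha x
    have h2 := card_mul_le_sum (m := k - 2) hs (hCB.trans hBF)
      (φ := fun x => (L x ∩ (B \ C)).card + (L x \ B).card) fun x _ => by
        have := H.le_card_list_inter (B := B) (C := C) x
        omega
    rw [sum_add_distrib] at h2
    have h3 := sum_colored_split (U := U) (f := f) hCB fun x => (L x \ B).card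
    have h4 := card_sdiff_add_card_eq_card hCB
    obtain ⟨w, hw, hwF, hm⟩ := hclosed.exists_many_solo hBF Subset.rfl (m := B.card) (by
      rw [hF, ← mul_sum, h3]
      obtain ⟨m, hm⟩ : ∃ m, B.card = m + 2 := ⟨B.card - 2, by omega⟩
      have hkm : k = m + 4 := by omega
      have hBC : (B \ C).card = m := by omega
      rw [hBC] at h1
      rw [hC2, hkm] at h2
      rw [hkm] at hedges hU h9
      rw [hm]
      have h5 : m + 4 - 2 = m + 2 := by omega
      rw [h5] at h2
      have h6 := Nat.mul_le_mul_right (2 * m + 6) hN2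
      have h7 : s * 5 ≤ s * m := Nat.mul_le_mul_left s (by omega)
      nlinarith)
    have := card_le_card (inter_subset_left (s₁ := soloNbrs G L U f B w) (s₂ := colored U f B))
    exact ⟨w, hw, hwF, by omega, .inl (by omega)⟩

lemma false_of_full_eq (hf : Near G L U s b f)
    (hB : (stuck G L U s f).card + 2 = k) (hF : fullColors U f s = stuck G L U s f) : False := by
  obtain ⟨w, hw, hwF, h6, halt⟩ := H.exists_many_solo_of_full_eq hf hB hF
  obtain ⟨D, hD⟩ := H.exists_core hf
  have hDB := H.core_eq_stuck hD hB
  subst hDB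
  obtain ⟨y, hy⟩ := card_pos.1 (by omega : 0 < (soloNbrs G L U f (stuck G L U s f) w).card)
  obtain ⟨g, -, -, hg, hgF, ⟨c, hc, hcg⟩, -⟩ := H.exists_release hf hD hw hwF Subset.rfl
    (fun d hd hdB hdw => H.exists_adj_of_solo hf hD hw hwF hy hd (hF ▸ hdB) hdw) h6
    (halt.imp_right .inl)
  have h1 := H.le_card_stuck hg
  have h2 : (stuck G L U s g).card < (stuck G L U s f).card := by
    refine card_lt_card (ssubset_of_subset_of_ne ?_ ?_)
    · rw [← hF, ← hgF]; exact stuck_subset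
    · rintro h; exact hcg (h ▸ hc)
  omega

end Blocked

lemma exists_leaving_move {F : Finset ℕ} {c d : ℕ} (h : ReflTransGen (CanMove G L U f) c d)
    (hc : c ∈ F) (hd : d ∉ F) : ∃ a ∈ F, ∃ e ∉ F, CanMove G L U f a e := by
  induction h using ReflTransGen.head_induction_on with
  | refl => exact absurd hc hd
  | @head a e hae _ ih =>
    by_cases he : e ∈ F
    · exact ih he
    · exact ⟨a, hc, e, he, hae⟩

namespace Blocked

variable (H : Blocked G L U s b k v)
include H

lemma b_eq_of_card_full (hf : Near G L U s b f) (hF : (fullColors U f s).card + 1 = k) :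
    U.card + 1 = s * k ∧ (low U f s).card + 1 = s := by
  have h1 := hf.full_le
  have h2 := H.b_lt
  have h3 := H.card_add
  have h4 := card_low_add (U := U) (f := f) H.s_pos
  have h5 : U.card + 1 = s * k := by omega
  refine ⟨h5, ?_⟩
  rw [← h4, ← hF] at h5
  nlinarith

lemma not_closed_pair (hf : Near G L U s b f) (hB : (stuck G L U s f).card + 2 = k)
    (hF : (fullColors U f s).card + 1 = k) {C : Finset ℕ} (hCB : C ⊆ stuck G L U s f)
    (hC2 : C.card = 2) : ¬ MoveClosed G L U f C := by
  intro hCc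
  set B := stuck G L U s f with hBdef
  have hBF : B ⊆ fullColors U f s := stuck_subset
  have h9 := H.nine_le
  have hs := H.s_pos
  obtain ⟨hU, hN⟩ := H.b_eq_of_card_full hf hF
  have hclosed : MoveClosed G L U f B := moveClosed_stuck
  have hcB : colored U f B ⊆ U := filter_subset _ _
  have hedges := H.sum_nbrs_low_le (f := f) _ hcB
  have hcut := H.sum_add_sum_le hclosed hCc hCB (H.three_le_card hf)
  have h1 := card_mul_le_sum (m := 2) hs (sdiff_subset.trans hBF) (C := B \ C)
    (φ := fun x => (L x \ B).card) fun x _ => by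
      have := H.le_card_list_sdiff x B; omega
  have hFB : (fullColors U f s \ B).card = 1 := by
    have := card_sdiff_add_card_eq_card hBF; omega
  have h2 := card_mul_le_sum (m := k - 3) hs (hCB.trans hBF)
    (φ := fun x => (L x ∩ (B \ C)).card + (L x \ fullColors U f s).card) fun x _ => by
      have h3 := H.le_card_list_inter (B := B) (C := C) x
      have h4 : (L x \ B).card ≤ (L x \ fullColors U f s).card + 1 := by
        rw [← hFB]
        refine le_trans (card_le_card fun d hd => ?_) (card_union_le _ _)
        simp only [mem_sdiff, mem_union] at hd ⊢
        tauto
      omega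
  rw [sum_add_distrib] at h2
  have h3 := card_mul_le_sum (m := 1) hs (sdiff_subset.trans hBF) (C := B \ C)
    (φ := fun x => (L x \ fullColors U f s).card) fun x _ => by
      have := H.le_card_list_sdiff x (fullColors U f s); omega
  have h4 := sum_colored_split (U := U) (f := f) hCB fun x => (L x \ fullColors U f s).card
  have h5 : ∑ x ∈ colored U f B, (L x \ fullColors U f s).card ≤
      ∑ x ∈ colored U f B, (nbrs G (low U f s) x).card := sum_le_sum fun x hx =>
    hclosed.card_sdiff_full_le hBF (mem_colored.1 hx).1 (mem_colored.1 hx).2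
  have h6 := card_sdiff_add_card_eq_card hCB
  obtain ⟨m, rfl⟩ : ∃ m, k = m + 9 := ⟨k - 9, by omega⟩
  have h7 : (B \ C).card = m + 5 := by omega
  have h8 : m + 9 - 3 = m + 6 := by omega
  rw [h7] at h1 h3
  rw [hC2, h8] at h2
  obtain ⟨n, rfl⟩ : ∃ n, s = n + 1 := ⟨s - 1, by omega⟩
  have hn : (low U f (n + 1)).card = n := by omega
  rw [hn] at hedges
  nlinarith

lemma exists_many_solo_avoiding (hf : Near G L U s b f)
    (hB : (stuck G L U s f).card + 2 = k) (hF : (fullColors U f s).card + 1 = k) (x₀ : V) :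
    ∃ w ∈ U, f w ∉ fullColors U f s ∧ 6 ≤ (soloNbrs G L U f (stuck G L U s f) w ∩
      (colored U f (stuck G L U s f) \ nbrs G U x₀)).card := by
  set B := stuck G L U s f with hBdef
  have hBF : B ⊆ fullColors U f s := stuck_subset
  have h9 := H.nine_le
  have hs := H.s_pos
  obtain ⟨hU, hN⟩ := H.b_eq_of_card_full hf hF
  have hclosed : MoveClosed G L U f B := moveClosed_stuck
  have hcB : colored U f B ⊆ U := filter_subset _ _
  have hedges := H.sum_nbrs_low_le (f := f) _ hcB
  have ha : ∀ x, 1 ≤ (L x \ fullColors U f s).card := fun x => by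
    have := H.le_card_list_sdiff x (fullColors U f s); omega
  have hcard := card_colored hs hBF
  have hsplit := card_sdiff_add_card_inter (colored U f B) (nbrs G U x₀)
  have hr : (colored U f B ∩ nbrs G U x₀).card ≤ k :=
    (card_le_card inter_subset_right).trans (H.deg_le x₀)
  have h1 : (colored U f B \ nbrs G U x₀).card * 2 ≤
      ∑ y ∈ colored U f B \ nbrs G U x₀, 2 * (L y \ fullColors U f s).card := by
    rw [← smul_eq_mul]
    refine card_nsmul_le_sum _ _ _ fun x _ => ?_
    have := ha x; omega
  have h2 : (colored U f B ∩ nbrs G U x₀).card * 1 ≤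
      ∑ y ∈ colored U f B ∩ nbrs G U x₀, (nbrs G (low U f s) y).card := by
    rw [← smul_eq_mul]
    refine card_nsmul_le_sum _ _ _ fun x hx => (ha x).trans ?_
    have := mem_colored.1 (mem_inter.1 hx).1
    exact hclosed.card_sdiff_full_le hBF this.1 this.2
  have h3 := sum_inter_add_sum_sdiff (colored U f B) (nbrs G U x₀)
    fun y => (nbrs G (low U f s) y).card
  obtain ⟨w, hw, hwF, hm⟩ := hclosed.exists_many_solo hBF
    (Y := colored U f B \ nbrs G U x₀) sdiff_subset (m := k - 4) (by
      obtain ⟨m, rfl⟩ : ∃ m, k = m + 9 := ⟨k - 9, by omega⟩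
      obtain ⟨n, rfl⟩ : ∃ n, s = n + 1 := ⟨s - 1, by omega⟩
      have hn : (low U f (n + 1)).card = n := by omega
      have hm : m + 9 - 4 = m + 5 := by omega
      have hBm : B.card = m + 7 := by omega
      rw [hn] at hedges ⊢
      rw [hm]
      rw [hBm] at hcard
      nlinarith)
  exact ⟨w, hw, hwF, by omega⟩

/-- In a blocked situation, all but one color is stuck. -/
lemma le_card_stuck_succ (hf : Near G L U s b f) : k ≤ (stuck G L U s f).card + 1 := by
  by_contra! hlt
  have hB : (stuck G L U s f).card + 2 = k := by
    have := H.le_card_stuck hf; omega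
  have hBF : stuck G L U s f ⊆ fullColors U f s := stuck_subset
  by_cases hFB : fullColors U f s = stuck G L U s f
  · exact H.false_of_full_eq hf hB hFB
  have hF : (fullColors U f s).card + 1 = k := by
    have h1 := card_lt_card (ssubset_of_subset_of_ne hBF (Ne.symm hFB))
    have h2 := hf.full_le
    have h3 := H.b_lt
    omega
  obtain ⟨X, hXF, hXB⟩ := exists_of_ssubset (ssubset_of_subset_of_ne hBF (Ne.symm hFB))
  have hX : ∀ a ∈ fullColors U f s, a ∉ stuck G L U s f → a = X := by
    intro a ha haB
    have h1 : (fullColors U f s \ stuck G L U s f).card ≤ 1 := by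
      have := card_sdiff_add_card_eq_card hBF; omega
    exact card_le_one.1 h1 a (mem_sdiff.2 ⟨ha, haB⟩) X (mem_sdiff.2 ⟨hXF, hXB⟩)
  obtain ⟨d, hXd, hd⟩ : ∃ d, ReflTransGen (CanMove G L U f) X d ∧ d ∉ fullColors U f s := by
    by_contra! hcon; exact hXB (mem_stuck.2 hcon)
  obtain ⟨a, haF, δ, hδF, hmove⟩ := exists_leaving_move hXd hXF hd
  have haB : a ∉ stuck G L U s f := fun h => hδF (hBF (moveClosed_stuck a h δ hmove))
  obtain rfl := hX a haF haB
  obtain ⟨x₀, hx₀, rfl, hδ, hδne, hfree⟩ := hmove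
  obtain ⟨w, hw, hwF, h6⟩ := H.exists_many_solo_avoiding hf hB hF x₀
  obtain ⟨D, hD⟩ := H.exists_core hf
  have hDB := H.core_eq_stuck hD hB
  have hx₀w : x₀ ≠ w := by rintro rfl; exact hwF haF
  set S := soloNbrs G L U f (stuck G L U s f) w ∩
      (colored U f (stuck G L U s f) \ nbrs G U x₀) with hS
  have hSx : ∀ y ∈ S, ¬ G.Adj x₀ y := by
    intro y hy hxy
    obtain ⟨hyB, hyN⟩ := mem_sdiff.1 (mem_inter.1 hy).2
    exact hyN (mem_nbrs.2 ⟨(mem_colored.1 hyB).1, hxy⟩)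
  have hSsub : S ⊆ soloNbrs G L U f D w := by rw [hDB]; exact inter_subset_left
  obtain ⟨y, hy⟩ := card_pos.1 (by omega : 0 < S.card)
  obtain ⟨g, y₁, hy₁, hg, hgF, ⟨c, hc, hcg⟩, hout, hin, hgw, hgy⟩ :=
    H.exists_release hf hD hw hwF hSsub (fun d hd hdB hdw => by
      by_cases hdF : d ∈ fullColors U f s
      · obtain rfl := hX d hdF hdB
        exact H.exists_adj_of_solo_of_move hf hD hw hwF (hSsub hy) hx₀ hXF hXB hδ hδF hfree
          (hSx y hy) hd
      · exact H.exists_adj_of_solo hf hD hw hwF (hSsub hy) hd hdF hdw) h6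
      (.inr (.inl fun C hCB hC2 => H.not_closed_pair hf hB hF hCB hC2))
  have hgx₀ : g x₀ = f x₀ := hout x₀ hx₀ haB hx₀w
  have hXg : f x₀ ∉ stuck G L U s g := by
    intro hst
    refine hδF (hgF ▸ mem_stuck.1 hst δ (.single ⟨x₀, hx₀, hgx₀, hδ, hδne,
      fun z hz hxz hgz => ?_⟩))
    have hzy : z ≠ y₁ := by rintro rfl; exact hSx _ hy₁ hxz
    have hzw : z ≠ w := by rintro rfl; exact hδF (hBF (hgz ▸ hgw))
    by_cases hzB : f z ∈ stuck G L U s f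
    · exact hδF (hBF (hgz ▸ hin z hz hzB hzy))
    · exact hfree z hz hxz (hout z hz hzB hzw ▸ hgz)
  have h1 := H.le_card_stuck hg
  have h2 : stuck G L U s g ⊆ ((fullColors U f s).erase (f x₀)).erase c := by
    intro e he
    refine mem_erase.2 ⟨?_, mem_erase.2 ⟨?_, hgF ▸ stuck_subset he⟩⟩
    · rintro rfl; exact hcg he
    · rintro rfl; exact hXg he
  have h3 := card_le_card h2
  have h4 : c ∈ (fullColors U f s).erase (f x₀) :=
    mem_erase.2 ⟨by rintro rfl; exact haB hc, hBF hc⟩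
  rw [card_erase_of_mem h4, card_erase_of_mem haF] at h3
  have h9 := H.nine_le
  omega

end Blocked

/-- Moving `w` into the class of two of its neighbours while these take the color of `w`. -/
lemma ProperOn.exists_pair_swap (hf : ProperOn G L U f) {w y y' : V} (hw : w ∈ U) (hyy : y ≠ y')
    (hfy : f y = f y') (hyw : f y ≠ f w) (hy : y ∈ soloNbrs G L U f D w)
    (hy' : y' ∈ soloNbrs G L U f D w) (hL : f y ∈ L w)
    (huniq : ∀ z ∈ U, G.Adj w z → f z = f y → z = y ∨ z = y') :
    ∃ g, ProperOn G L U g ∧ ∀ e, classSize U g e + (if e = f y then 1 else 0) =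
      classSize U f e + (if e = f w then 1 else 0) := by
  obtain ⟨⟨hyU, -⟩, hwy, hLy, hsolo⟩ := mem_soloNbrs.1 hy
  obtain ⟨⟨hyU', -⟩, hwy', hLy', hsolo'⟩ := mem_soloNbrs.1 hy'
  have hnadj : ¬ G.Adj y y' := fun h => hf.2 y hyU y' hyU' h hfy
  set f₁ := Function.update (Function.update f w (f y)) y (f w) with hf₁
  have hf₁y' : f₁ y' = f y' := by
    rw [hf₁, Function.update_of_ne hyy.symm, Function.update_of_ne hwy'.ne.symm]
  have hf₁L : ∀ z ∈ U, f₁ z ∈ L z := by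
    intro z hz
    rcases eq_or_ne z y with rfl | h
    · simpa [hf₁] using hLy
    · rcases eq_or_ne z w with rfl | h'
      · simpa [hf₁, h] using hL
      · simpa [hf₁, h, h'] using hf.1 z hz
  refine ⟨Function.update f₁ y' (f w), ⟨fun z hz => ?_, ?_⟩, fun e => ?_⟩
  · rcases eq_or_ne z y' with rfl | h
    · simpa using hLy'
    · simpa [h] using hf₁L z hz
  · have hval : ∀ z, Function.update f₁ y' (f w) z =
        if z = y ∨ z = y' then f w else if z = w then f y else f z := by
      intro z
      rcases eq_or_ne z y' with rfl | h
      · simp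
      · rcases eq_or_ne z y with rfl | h1
        · simp [h, hf₁]
        · rcases eq_or_ne z w with rfl | h2
          · simp [h, h1, hf₁]
          · simp [h, h1, h2, hf₁]
    have hsym : ∀ z ∈ U, ∀ z' ∈ U, G.Adj z z' → (z = y ∨ z = y') →
        Function.update f₁ y' (f w) z ≠ Function.update f₁ y' (f w) z' := by
      intro z hz z' hz' hzz hzy
      have hz'y : ¬ (z' = y ∨ z' = y') := by
        rintro (rfl | rfl) <;> rcases hzy with rfl | rfl
        · exact G.irrefl hzz
        · exact hnadj hzz.symm
        · exact hnadj hzz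
        · exact G.irrefl hzz
      rw [hval z, hval z', if_pos hzy, if_neg hz'y]
      split_ifs with h
      · exact hyw.symm
      · intro heq
        rcases hzy with rfl | rfl
        · exact h (hsolo z' hz' hzz heq.symm)
        · exact h (hsolo' z' hz' hzz heq.symm)
    intro z hz z' hz' hzz
    by_cases h1 : z = y ∨ z = y'
    · exact hsym z hz z' hz' hzz h1
    by_cases h2 : z' = y ∨ z' = y'
    · exact (hsym z' hz' z hz hzz.symm h2).symm
    rw [hval z, hval z', if_neg h1, if_neg h2]
    split_ifs with h3 h4 h4
    · subst h3; subst h4; exact absurd hzz G.irrefl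
    · subst h3; exact fun h => h2 (huniq z' hz' hzz h.symm)
    · subst h4; exact fun h => h1 (huniq z hz hzz.symm h)
    · exact hf.2 z hz z' hz' hzz
  · have h1 := classSize_update_update (f := f) hw hyU hwy.ne (f y) (f w) e
    have h2 := classSize_update (f := f₁) hyU' (f w) e
    rw [← hf₁] at h1
    rw [hf₁y', ← hfy] at h2
    omega

namespace Blocked

variable (H : Blocked G L U s b k v)
include H

lemma card_full_eq (hf : Near G L U s b f) : (fullColors U f s).card + 1 = k := by
  have h1 := H.le_card_stuck_succ hf
  have h2 := card_le_card (stuck_subset (G := G) (L := L) (U := U) (s := s) (f := f))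
  have h3 := hf.full_le
  have h4 := H.b_lt
  omega

lemma full_eq_stuck (hf : Near G L U s b f) : stuck G L U s f = fullColors U f s :=
  eq_of_subset_of_card_le stuck_subset (by
    have := H.le_card_stuck_succ hf; have := H.card_full_eq hf; omega)

lemma exists_many_solo_core (hf : Near G L U s b f) (hD : IsCore G L U s f D) :
    ∃ w ∈ U, f w ∉ fullColors U f s ∧ 7 ≤ (soloNbrs G L U f D w).card := by
  have hF := H.card_full_eq hf
  have hDF : D ⊆ fullColors U f s := hD.subset.trans stuck_subset
  have h9 := H.nine_le
  have hs := H.s_pos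
  obtain ⟨hU, hN⟩ := H.b_eq_of_card_full hf hF
  have hDk := H.le_card_core hD
  have hclosed : MoveClosed G L U f (fullColors U f s) := by
    rw [← H.full_eq_stuck hf]; exact moveClosed_stuck
  have hedges := H.sum_nbrs_low_le (f := f) (colored U f (fullColors U f s)) (filter_subset _ _)
  have ha : ∀ x, 1 ≤ (L x \ fullColors U f s).card := fun x => by
    have := H.le_card_list_sdiff x (fullColors U f s); omega
  rw [sum_colored_split hDF] at hedges
  have h1 := card_mul_le_sum (m := 1) hs sdiff_subset (C := fullColors U f s \ D)
    (φ := fun x => (nbrs G (low U f s) x).card) fun x hx => by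
      have := mem_colored.1 hx
      exact (ha x).trans
        (hclosed.card_sdiff_full_le Subset.rfl this.1 (mem_sdiff.1 this.2).1)
  have h2 := card_mul_le_sum (m := 2) hs hDF
    (φ := fun x => 2 * (L x \ fullColors U f s).card) fun x _ => by
      have := ha x; omega
  have h3 := card_sdiff_add_card_eq_card hDF
  obtain ⟨w, hw, hwF, hm⟩ := hD.closed.exists_many_solo hDF Subset.rfl (m := k - 3) (by
    obtain ⟨m, rfl⟩ : ∃ m, k = m + 9 := ⟨k - 9, by omega⟩
    obtain ⟨n, rfl⟩ : ∃ n, s = n + 1 := ⟨s - 1, by omega⟩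
    obtain ⟨i, hi⟩ : ∃ i, D.card = m + 7 + i := ⟨D.card - (m + 7), by omega⟩
    have hn : (low U f (n + 1)).card = n := by omega
    have hm : m + 9 - 3 = m + 6 := by omega
    rw [hn] at hedges ⊢
    rw [hm]
    have h4 : (fullColors U f (n + 1) \ D).card + i = 1 := by omega
    have h5 : ((fullColors U f (n + 1) \ D).card + i) * (n + 1) = n + 1 := by rw [h4, one_mul]
    rw [hi] at h2
    nlinarith)
  have := card_le_card (inter_subset_left (s₁ := soloNbrs G L U f D w) (s₂ := colored U f D))
  exact ⟨w, hw, hwF, by omega⟩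

lemma not_closed_pair_of_size (hf : Near G L U s b f) {w : V}
    (hwF : f w ∉ fullColors U f s) (hsize : s ≤ classSize U f (f w) + 1) {C : Finset ℕ}
    (hCF : C ⊆ fullColors U f s) (hC2 : C.card = 2) : ¬ MoveClosed G L U f C := by
  intro hCc
  have hF := H.card_full_eq hf
  have h9 := H.nine_le
  have hs := H.s_pos
  obtain ⟨hU, hN⟩ := H.b_eq_of_card_full hf hF
  have hclosed : MoveClosed G L U f (fullColors U f s) := by
    rw [← H.full_eq_stuck hf]; exact moveClosed_stuck
  have hall : low U f s = U.filter (f · = f w) := by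
    refine (eq_of_subset_of_card_le (fun x hx => ?_) ?_).symm
    · obtain ⟨hxU, hxw⟩ := mem_filter.1 hx
      exact mem_low.2 ⟨hxU, hxw ▸ hwF⟩
    · unfold classSize at hsize
      omega
  have hone : ∀ x ∈ colored U f C, (L x \ fullColors U f s).card ≤ 1 := by
    intro x hx
    rw [mem_colored] at hx
    have hcol : ∀ d ∈ L x \ fullColors U f s, d = f w := by
      intro d hd
      obtain ⟨hdL, hdF⟩ := mem_sdiff.1 hd
      obtain ⟨z, hz, -, rfl⟩ := hclosed.exists_adj hx.1 (hCF hx.2) hdL hdF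
      have : z ∈ low U f s := mem_low.2 ⟨hz, hdF⟩
      rw [hall] at this
      exact (mem_filter.1 this).2
    exact card_le_one.2 fun d hd e he => (hcol d hd).trans (hcol e he).symm
  have hcut := H.sum_add_sum_le hclosed hCc hCF (H.three_le_card hf)
  have h1 := card_mul_le_sum (m := k - 3) hs hCF
    (φ := fun x => (L x ∩ (fullColors U f s \ C)).card) fun x hx => by
      have h3 := H.le_card_list_inter (B := fullColors U f s) (C := C) x
      have h4 := hone x hx
      omega
  have h2 := card_mul_le_sum (m := 1) hs sdiff_subset (C := fullColors U f s \ C)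
    (φ := fun x => (L x \ fullColors U f s).card) fun x _ => by
      have := H.le_card_list_sdiff x (fullColors U f s); omega
  have h3 := card_sdiff_add_card_eq_card hCF
  obtain ⟨m, rfl⟩ : ∃ m, k = m + 9 := ⟨k - 9, by omega⟩
  have h4 : (fullColors U f s \ C).card = m + 6 := by omega
  have h5 : m + 9 - 3 = m + 6 := by omega
  rw [hC2, h5] at h1
  rw [h4] at h2
  nlinarith

/-- A blocked situation admits no near-equitable coloring of the colored set. -/
theorem not_near (f : V → ℕ) : ¬ Near G L U s b f := by
  intro hf
  obtain ⟨D, hD⟩ := H.exists_core hf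
  obtain ⟨w, hw, hwF, h7⟩ := H.exists_many_solo_core hf hD
  have hBF := H.full_eq_stuck hf
  have hs := H.s_pos
  obtain ⟨y, hy⟩ := card_pos.1 (by omega : 0 < (soloNbrs G L U f D w).card)
  obtain ⟨g, -, -, hg, hgF, ⟨c, hc, hcg⟩, -⟩ := H.exists_release hf hD hw hwF Subset.rfl
    (fun d hd hdB hdw => H.exists_adj_of_solo hf hD hw hwF hy hd (hBF ▸ hdB) hdw) (by omega) (by
      by_cases hsize : s ≤ classSize U f (f w) + 1
      · exact .inr (.inl fun C hC hC2 => H.not_closed_pair_of_size hf hwF hsize (hBF ▸ hC) hC2)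
      · refine .inr (.inr ⟨h7, ?_⟩)
        rintro ⟨y, hy, y', hy', hne, heq, hyL, huniq⟩
        have hyF : f y ∈ fullColors U f s :=
          stuck_subset (hD.subset (mem_soloNbrs.1 hy).1.2)
        have hyw : f y ≠ f w := fun h => hwF (h ▸ hyF)
        obtain ⟨g, hg, hgsize⟩ :=
          hf.proper.exists_pair_swap hw hne heq hyw hy hy' hyL huniq
        have hgN := hf.of_shift hs hg hyF hwF hgsize
        have hsub : fullColors U g s ⊆ (fullColors U f s).erase (f y) := by
          intro e he
          rw [mem_fullColors hs] at he
          rw [mem_erase, mem_fullColors hs]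
          have h1 := hgsize e
          have h2 := hf.size_le e
          by_cases h3 : e = f w
          · rw [if_pos h3] at h1
            rw [← h3] at hsize
            omega
          · rw [if_neg h3] at h1
            split_ifs at h1 with h4
            · omega
            · exact ⟨h4, by omega⟩
        have h1 := card_le_card hsub
        have h2 := card_erase_add_one hyF
        have h3 := H.card_full_eq hf
        have h4 := H.card_full_eq hgN
        omega)
  rw [H.full_eq_stuck hf, ← hgF, ← H.full_eq_stuck hg] at hc
  exact hcg hc

end Blocked

end ListRecoloring

section EquitableExtension

variable {V : Type*} [DecidableEq V] {G : SimpleGraph V} [DecidableRel G.Adj]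
  {L : V → Finset ℕ} {k : ℕ}

lemma sum_nbrs_erase {W X : Finset V} {x : V} (hXW : X ⊆ W) (hx : x ∈ X) :
    ∑ z ∈ X.erase x, (nbrs G (W \ X.erase x) z).card + (nbrs G (W \ X) x).card =
      ∑ z ∈ X, (nbrs G (W \ X) z).card + (nbrs G X x).card := by
  have h1 : W \ X.erase x = (W \ X) ∪ {x} := by
    rw [sdiff_erase (hXW hx), insert_eq, union_comm]
  have hdisj : Disjoint (W \ X) {x} := by simp [hx]
  have h2 : ∑ z ∈ X.erase x, (nbrs G {x} z).card = (nbrs G X x).card := by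
    rw [sum_nbrs_comm, sum_singleton]
    congr 1
    ext y
    simp only [mem_nbrs, mem_erase]
    exact ⟨fun h => ⟨h.1.2, h.2⟩, fun h => ⟨⟨h.2.ne', h.1⟩, h.2⟩⟩
  rw [h1, sum_congr rfl fun z _ => card_nbrs_union hdisj z, sum_add_distrib, h2,
    ← add_sum_erase X _ hx]
  ring

lemma exists_card_nbrs_le {W : Finset V} (hW : W.Nonempty)
    (sparse : ∀ X Y : Finset V, Disjoint X Y → 3 ≤ X.card + Y.card →
      ∑ x ∈ X, (nbrs G Y x).card + 4 ≤ 2 * (X.card + Y.card)) :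
    ∃ v ∈ W, (nbrs G W v).card ≤ 6 := by
  by_contra! hcon
  obtain ⟨X, hX, hmax⟩ := exists_max_image W.powerset
    (fun X => ∑ x ∈ X, (nbrs G (W \ X) x).card) ⟨∅, by simp⟩
  simp only [mem_powerset] at hX hmax
  have hhalf : ∀ X ⊆ W, (∀ X' ⊆ W, ∑ x ∈ X', (nbrs G (W \ X') x).card ≤
      ∑ x ∈ X, (nbrs G (W \ X) x).card) → X.card * 4 ≤ ∑ x ∈ X, (nbrs G (W \ X) x).card := by
    intro X hX hmax
    rw [← smul_eq_mul]
    refine card_nsmul_le_sum _ _ _ fun x hx => ?_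
    have h1 := hmax (X.erase x) ((erase_subset _ _).trans hX)
    have h2 := sum_nbrs_erase (G := G) hX hx
    have h3 := hcon x (hX hx)
    have h4 := card_nbrs_union (G := G) (disjoint_sdiff (s := X) (t := W)) x
    rw [union_sdiff_of_subset hX] at h4
    omega
  have hsym : ∑ x ∈ W \ X, (nbrs G (W \ (W \ X)) x).card = ∑ x ∈ X, (nbrs G (W \ X) x).card := by
    rw [Finset.sdiff_sdiff_eq_self hX, sum_nbrs_comm]
  have h1 := hhalf X hX hmax
  have h2 := hhalf (W \ X) sdiff_subset fun X' hX' => by rw [hsym]; exact hmax X' hX'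
  rw [hsym] at h2
  have h3 := card_sdiff_add_card_eq_card hX
  obtain ⟨v, hv⟩ := hW
  have h4 := hcon v hv
  have h5 : (nbrs G W v).card ≤ W.card := card_le_card (filter_subset _ _)
  have h6 := sparse X (W \ X) disjoint_sdiff (by omega)
  omega

lemma exists_near_succ (hk : 9 ≤ k) (hL : ∀ x, (L x).card = k)
    (hdeg : ∀ (U : Finset V) (x : V), (nbrs G U x).card ≤ k)
    (sparse : ∀ X Y : Finset V, Disjoint X Y → 3 ≤ X.card + Y.card →
      ∑ x ∈ X, (nbrs G Y x).card + 4 ≤ 2 * (X.card + Y.card)) {t b : ℕ}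
    (ih : ∀ U : Finset V, U.card = t * k + b → ∃ f, Near G L U (t + 1) b f)
    (hb : b + 1 ≤ k) {U : Finset V} (hU : U.card = t * k + (b + 1)) :
    ∃ f, Near G L U (t + 1) (b + 1) f := by
  obtain ⟨v, hv, hvdeg⟩ := exists_card_nbrs_le (card_pos.1 (by omega : 0 < U.card)) sparse
  have hcard := card_erase_add_one hv
  obtain ⟨f, hf⟩ := ih (U.erase v) (by omega)
  by_contra hno
  refine Blocked.not_near (k := k) (v := v) ⟨hk, t.succ_pos, hL, hdeg _, by simp,
    (card_le_card (filter_subset_filter _ (erase_subset _ _))).trans hvdeg, ?_, by omega,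
    sparse, by rwa [insert_erase hv]⟩ f hf
  rw [Nat.succ_mul]
  omega

/-- Equitable list colorings of all vertex subsets, by adding vertices one at a time. -/
theorem exists_near (hk : 9 ≤ k) (hL : ∀ x, (L x).card = k)
    (hdeg : ∀ (U : Finset V) (x : V), (nbrs G U x).card ≤ k)
    (sparse : ∀ X Y : Finset V, Disjoint X Y → 3 ≤ X.card + Y.card →
      ∑ x ∈ X, (nbrs G Y x).card + 4 ≤ 2 * (X.card + Y.card)) (t b : ℕ) (hb : b ≤ k)
    (U : Finset V) (hU : U.card = t * k + b) : ∃ f, Near G L U (t + 1) b f := by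
  induction t generalizing b U with
  | zero =>
    induction b generalizing U with
    | zero =>
      obtain rfl : U = ∅ := card_eq_zero.1 (by simpa using hU)
      exact ⟨fun _ => 0, ⟨by simp, by simp⟩, by simp [classSize], by simp [fullColors]⟩
    | succ b ih => exact exists_near_succ hk hL hdeg sparse (ih (by omega)) hb hU
  | succ t iht =>
    induction b generalizing U with
    | zero =>
      obtain ⟨f, hf⟩ := iht k le_rfl U (by rw [hU]; ring)
      refine ⟨f, hf.proper, fun c => (hf.size_le c).trans (by omega), ?_⟩
      rw [Nat.le_zero, card_eq_zero, fullColors, filter_eq_empty_iff]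
      intro c _ h
      have := hf.size_le c
      omega
    | succ b ih => exact exists_near_succ hk hL hdeg sparse (ih (by omega)) hb hU

end EquitableExtension

/-- **Kierstead–Kostochka–Xiang (2024).** Let `G` be a graph such that
`‖X,Y‖ ≤ 2|X ∪ Y| - 4` for all disjoint `X, Y ⊆ V(G)` with `|X ∪ Y| ≥ 3`, where
`‖X,Y‖` is the number of edges with one endpoint in `X` and the other in `Y`. Then `G`
is strongly equitably `k`-choosable for every `k ≥ max {9, Δ(G)}`. -/
theorem se_choosable_of_bibound {V : Type*} [Fintype V] [DecidableEq V]
    (G : SimpleGraph V) [DecidableRel G.Adj]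
    (hsparse : ∀ X Y : Finset V, Disjoint X Y → 3 ≤ (X ∪ Y).card →
      ((X ×ˢ Y).filter fun p => G.Adj p.1 p.2).card ≤ 2 * (X ∪ Y).card - 4)
    (k : ℕ) (hk : max 9 G.maxDegree ≤ k) :
    SEChoosable G k := by
  intro L hL
  rcases isEmpty_or_nonempty V with hV | hV
  · exact ⟨fun _ => 0, fun v => hV.elim v, fun v => hV.elim v, by simp, by simp⟩
  have hk9 : 9 ≤ k := (le_max_left _ _).trans hk
  have hdeg : ∀ (U : Finset V) (x : V), (nbrs G U x).card ≤ k := by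
    intro U x
    refine le_trans (card_le_card fun y hy => ?_)
      ((G.degree_le_maxDegree x).trans ((le_max_right _ _).trans hk))
    exact (G.mem_neighborFinset x y).2 (mem_nbrs.1 hy).2
  have sparse : ∀ X Y : Finset V, Disjoint X Y → 3 ≤ X.card + Y.card →
      ∑ x ∈ X, (nbrs G Y x).card + 4 ≤ 2 * (X.card + Y.card) := by
    intro X Y hXY h3
    rw [← card_union_of_disjoint hXY] at h3 ⊢
    have h1 := hsparse X Y hXY h3
    have h2 : ((X ×ˢ Y).filter fun p => G.Adj p.1 p.2).card = ∑ x ∈ X, (nbrs G Y x).card := by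
      simp only [nbrs, card_filter, sum_product]
    omega
  have hn : 0 < Fintype.card V := Fintype.card_pos
  set n := Fintype.card V with hndef
  have hdm := Nat.div_add_mod (n - 1) k
  have hlt := Nat.mod_lt (n - 1) (by omega : 0 < k)
  set t := (n - 1) / k
  set r := (n - 1) % k
  have hnk : n = t * k + (r + 1) := by rw [mul_comm]; omega
  obtain ⟨f, hf⟩ := exists_near hk9 hL hdeg sparse t (r + 1) (by omega) univ
    (by rw [card_univ]; exact hnk)
  have hceil : (n + k - 1) / k = t + 1 := by
    have : n + k - 1 = r + k * (t + 1) := by rw [hnk]; ring_nf; omega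
    rw [this, Nat.add_mul_div_left _ _ (by omega), Nat.div_eq_of_lt hlt, zero_add]
  have hmod : modStar n k = r + 1 := by
    unfold modStar
    rw [hnk, Nat.mul_add_mod']
    rcases Nat.lt_or_ge (r + 1) k with h | h
    · rw [Nat.mod_eq_of_lt h, if_neg (by omega)]
    · have hrk : r + 1 = k := by omega
      rw [hrk, Nat.mod_self, if_pos rfl]
  refine ⟨f, fun v => hf.proper.1 v (mem_univ v),
    fun u v huv => hf.proper.2 u (mem_univ u) v (mem_univ v) huv, fun c => ?_, ?_⟩
  · rw [hceil]; exact hf.size_le c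
  · rw [hceil, hmod]; exact hf.full_le
end

section
/- Let G be a graph with minimum degree δ(G) ≥ 2. If 6‖G[A]‖ ≤ 7|A| + 2 for every nonempty subset A ⊆ V(G), then G is strongly equitably (SE) 3-choosable; and if 4‖G[A]‖ ≤ 5|A| + 2 for every nonempty subset A ⊆ V(G), then G is strongly equitably (SE) 4-choosable. -/
/-- The number of edges of the subgraph of `G` induced by the finite vertex set `A`:
each unordered edge inside `A` is counted twice by the ordered-pair filter, so we
divide by `2`. -/
def inducedEdgeCount {V : Type*} [DecidableEq V] (G : SimpleGraph V) [DecidableRel G.Adj]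
    (A : Finset V) : ℕ :=
  ((A ×ˢ A).filter fun p => G.Adj p.1 p.2).card / 2

section Sparse

variable {V : Type*} (G : SimpleGraph V) [DecidableRel G.Adj]

/-- The number of neighbours of `v` inside `A`. -/
def degIn (A : Finset V) (v : V) : ℕ := (A.filter (G.Adj v)).card

/-- The total excess over degree two in the subgraph induced by `A`. -/
def excess (A : Finset V) : ℕ := ∑ v ∈ A, (degIn G A v - 2)

/-- `F` is a nonempty union of components of `G[W]` in which all degrees are two. -/
structure IsCycleSet (W F : Finset V) : Prop where
  nonempty : F.Nonempty
  subset : F ⊆ W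
  closed : ∀ v ∈ F, ∀ u ∈ W, G.Adj v u → u ∈ F
  deg : ∀ v ∈ F, degIn G W v = 2

/-- A family of pairwise disjoint cycle sets. -/
def IsCycleFamily (W : Finset V) (𝓕 : Finset (Finset V)) : Prop :=
  (∀ F ∈ 𝓕, IsCycleSet G W F) ∧ ∀ F ∈ 𝓕, ∀ F' ∈ 𝓕, F ≠ F' → Disjoint F F'

/-- The potential of `G[W]` (excess plus the number of cycle components) is at most `p`. -/
def PotLE (W : Finset V) (p : ℕ) : Prop :=
  ∀ 𝓕, IsCycleFamily G W 𝓕 → excess G W + 𝓕.card ≤ p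

variable {G}

/-! ### Degrees inside a set -/

lemma degIn_mono {A B : Finset V} (h : A ⊆ B) (v : V) : degIn G A v ≤ degIn G B v :=
  Finset.card_le_card (Finset.filter_subset_filter _ h)

lemma card_le_degIn {T S : Finset V} {v : V} (h : ∀ u ∈ T, u ∈ S ∧ G.Adj v u) :
    T.card ≤ degIn G S v :=
  Finset.card_le_card fun u hu => Finset.mem_filter.2 (h u hu)

lemma one_le_degIn {S : Finset V} {v u : V} (hu : u ∈ S) (h : G.Adj v u) : 1 ≤ degIn G S v :=
  Finset.card_pos.2 ⟨u, Finset.mem_filter.2 ⟨hu, h⟩⟩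

lemma exists_adj_notMem {W T : Finset V} {v : V} (h : T.card < degIn G W v) :
    ∃ u ∈ W, G.Adj v u ∧ u ∉ T := by
  obtain ⟨u, hu, huT⟩ := Finset.exists_mem_notMem_of_card_lt_card h
  rw [Finset.mem_filter] at hu
  exact ⟨u, hu.1, hu.2, huT⟩

lemma exists_adj {W : Finset V} {v : V} (h : 1 ≤ degIn G W v) : ∃ u ∈ W, G.Adj v u := by
  obtain ⟨u, hu, hvu, -⟩ := exists_adj_notMem (T := ∅) (Nat.lt_of_lt_of_le (by simp) h)
  exact ⟨u, hu, hvu⟩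

lemma sum_degIn_comm (A B : Finset V) :
    ∑ v ∈ A, degIn G B v = ∑ y ∈ B, degIn G A y := by
  have := Finset.sum_card_bipartiteAbove_eq_sum_card_bipartiteBelow (s := A) (t := B) G.Adj
  simp only [Finset.bipartiteAbove, Finset.bipartiteBelow] at this
  simpa [degIn, G.adj_comm] using this

lemma card_filter_adj_product (A : Finset V) :
    ((A ×ˢ A).filter fun p => G.Adj p.1 p.2).card = ∑ v ∈ A, degIn G A v := by
  simp only [degIn, Finset.card_filter, Finset.sum_product]

lemma PotLE.mono {W : Finset V} {p q : ℕ} (h : PotLE G W p) (hpq : p ≤ q) : PotLE G W q :=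
  fun 𝓕 h𝓕 => (h 𝓕 h𝓕).trans hpq

lemma PotLE.excess_le {W : Finset V} {p : ℕ} (h : PotLE G W p) : excess G W ≤ p := by
  simpa using h ∅ ⟨by simp, by simp⟩

lemma exists_adj_ne {W : Finset V} {v : V} (h : 2 ≤ degIn G W v) (a : V) :
    ∃ u ∈ W, G.Adj v u ∧ u ≠ a := by
  obtain ⟨u, hu, hvu, hua⟩ := exists_adj_notMem (T := {a}) (Nat.lt_of_lt_of_le (by simp) h)
  exact ⟨u, hu, hvu, by simpa using hua⟩

lemma card_eq_card_filter_add (W : Finset V) :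
    W.card = (W.filter fun v => 3 ≤ degIn G W v).card
      + (W.filter fun v => degIn G W v ≤ 2).card := by
  have h : W.filter (fun v => degIn G W v ≤ 2) = W.filter (fun v => ¬ 3 ≤ degIn G W v) :=
    Finset.filter_congr fun v _ => by omega
  rw [h, Finset.card_filter_add_card_filter_not]

lemma excess_eq_sum_filter (W : Finset V) :
    excess G W = ∑ v ∈ W.filter (fun v => 3 ≤ degIn G W v), (degIn G W v - 2) := by
  rw [excess, Finset.sum_filter]
  refine Finset.sum_congr rfl fun v _ => ?_
  split_ifs <;> omega

/-- Discharging: a lower bound on the potential from local estimates at the vertices of degree at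
least three. -/
lemma two_mul_card_le_sum {W : Finset V} (g : V → ℕ)
    (hg : 2 * (W.filter fun v => degIn G W v ≤ 2).card ≤
      ∑ v ∈ W.filter (fun v => 3 ≤ degIn G W v), g v) :
    2 * W.card ≤ ∑ v ∈ W.filter (fun v => 3 ≤ degIn G W v), (2 + g v) := by
  rw [Finset.sum_add_distrib, card_eq_card_filter_add (G := G) W, Finset.sum_const, smul_eq_mul]
  omega

variable (G) in
/-- The vertices of degree at least three in `G[W]`. -/
def bigSet (W : Finset V) : Finset V := W.filter fun v => 3 ≤ degIn G W v

variable (G) in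
/-- The vertices of degree at most two in `G[W]`. -/
def smallSet (W : Finset V) : Finset V := W.filter fun v => degIn G W v ≤ 2

variable (G) in
/-- The vertices of degree at most two with exactly one neighbour of degree at least three. -/
def heavySet (W : Finset V) : Finset V :=
  (smallSet G W).filter fun y => degIn G (bigSet G W) y = 1

lemma mem_bigSet {W : Finset V} {v : V} : v ∈ bigSet G W ↔ v ∈ W ∧ 3 ≤ degIn G W v :=
  Finset.mem_filter

lemma mem_smallSet {W : Finset V} {v : V} : v ∈ smallSet G W ↔ v ∈ W ∧ degIn G W v ≤ 2 :=
  Finset.mem_filter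

lemma heavySet_subset (W : Finset V) : heavySet G W ⊆ smallSet G W := Finset.filter_subset _ _

lemma smallSet_subset (W : Finset V) : smallSet G W ⊆ W := Finset.filter_subset _ _

variable [DecidableEq V]

lemma degIn_sdiff_add {S W : Finset V} (h : S ⊆ W) (v : V) :
    degIn G (W \ S) v + degIn G S v = degIn G W v := by
  unfold degIn
  rw [← Finset.card_union_of_disjoint]
  · congr 1
    rw [← Finset.filter_union, Finset.sdiff_union_of_subset h]
  · exact Finset.disjoint_filter_filter Finset.sdiff_disjoint

lemma two_le_degIn {S : Finset V} {v a b : V} (hab : a ≠ b) (ha : a ∈ S) (hb : b ∈ S)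
    (hva : G.Adj v a) (hvb : G.Adj v b) : 2 ≤ degIn G S v := by
  rw [← Finset.card_pair hab]
  exact card_le_degIn (by simp [*])

lemma three_le_degIn {S : Finset V} {v a b c : V} (hab : a ≠ b) (hac : a ≠ c) (hbc : b ≠ c)
    (ha : a ∈ S) (hb : b ∈ S) (hc : c ∈ S)
    (hva : G.Adj v a) (hvb : G.Adj v b) (hvc : G.Adj v c) : 3 ≤ degIn G S v := by
  have : ({a, b, c} : Finset V).card = 3 := Finset.card_eq_three.2 ⟨a, b, c, hab, hac, hbc, rfl⟩
  rw [← this]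
  exact card_le_degIn (by simp [*])

lemma exists_adj_ne_ne {W : Finset V} {v : V} (h : 3 ≤ degIn G W v) (a b : V) :
    ∃ u ∈ W, G.Adj v u ∧ u ≠ a ∧ u ≠ b := by
  obtain ⟨u, hu, hvu, hua⟩ := exists_adj_notMem (T := {a, b}) (v := v) (W := W) (G := G)
    (lt_of_le_of_lt Finset.card_le_two h)
  simp only [Finset.mem_insert, Finset.mem_singleton, not_or] at hua
  exact ⟨u, hu, hvu, hua⟩

lemma even_sum_degIn (A : Finset V) : Even (∑ v ∈ A, degIn G A v) := by
  induction A using Finset.induction_on with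
  | empty => simp
  | insert a A ha ih =>
    have key : ∀ v, degIn G (insert a A) v = degIn G A v + if G.Adj v a then 1 else 0 := by
      intro v
      unfold degIn
      rw [Finset.filter_insert]
      split_ifs with h
      · rw [Finset.card_insert_of_notMem (by simp [ha])]
      · simp
    rw [Finset.sum_insert ha, key a]
    simp only [key, SimpleGraph.irrefl, if_false, Finset.sum_add_distrib]
    have h2 : ∑ v ∈ A, (if G.Adj v a then 1 else 0) = degIn G A a := by
      rw [degIn, Finset.card_filter]
      simp only [G.adj_comm]
    rw [h2]
    obtain ⟨c, hc⟩ := ih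
    exact ⟨degIn G A a + c, by omega⟩

lemma two_mul_inducedEdgeCount (A : Finset V) :
    2 * inducedEdgeCount G A = ∑ v ∈ A, degIn G A v := by
  unfold inducedEdgeCount
  rw [card_filter_adj_product]
  exact Nat.two_mul_div_two_of_even (even_sum_degIn A)

/-! ### How the potential changes when vertices are removed -/

/-- A cycle set of `G[W \ S]` that is not one of `G[W]` has a vertex adjacent to `S`. -/
lemma IsCycleSet.exists_adj_of_not {S W F : Finset V} (hS : S ⊆ W)
    (hF : IsCycleSet G (W \ S) F) (h : ¬ IsCycleSet G W F) :
    ∃ v ∈ F, ∃ s ∈ S, G.Adj v s := by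
  by_contra! hno
  refine h ⟨hF.nonempty, hF.subset.trans Finset.sdiff_subset, fun v hv u hu hvu => ?_,
    fun v hv => ?_⟩
  · exact hF.closed v hv u (Finset.mem_sdiff.2 ⟨hu, fun hs => hno v hv u hs hvu⟩) hvu
  · rw [← degIn_sdiff_add hS, hF.deg v hv]
    have : degIn G S v = 0 := Finset.card_eq_zero.2 (Finset.filter_eq_empty_iff.2 (hno v hv))
    omega

/-- The decrease of the excess at a single vertex caused by removing `S`. -/
lemma potLE_sdiff_aux {S W : Finset V} {p : ℕ} (hS : S ⊆ W) (hp : PotLE G W p) (h : V → ℕ) (j : ℕ)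
    (hh : ∑ v ∈ W \ S, (degIn G (W \ S) v - 2) + ∑ v ∈ W \ S, h v + j ≤
      ∑ v ∈ W \ S, (degIn G W v - 2))
    (hF : ∀ F, IsCycleSet G (W \ S) F → ¬ IsCycleSet G W F → ∃ v ∈ F, 1 ≤ h v) :
    PotLE G (W \ S) (p - (∑ v ∈ S, (degIn G W v - 2) + j)) := by
  classical
  intro 𝓕 h𝓕
  set A := 𝓕.filter (IsCycleSet G W) with hA
  set B := 𝓕.filter (fun F => ¬ IsCycleSet G W F) with hB
  have hcard : A.card + B.card = 𝓕.card := Finset.card_filter_add_card_filter_not _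
  have h1 : excess G W + A.card ≤ p := by
    refine hp A ⟨fun F hF => (Finset.mem_filter.1 hF).2, fun F hF F' hF' => ?_⟩
    exact h𝓕.2 F (Finset.mem_filter.1 hF).1 F' (Finset.mem_filter.1 hF').1
  have h2 : B.card ≤ ∑ v ∈ W \ S, h v := by
    have hex : ∀ F ∈ B, 1 ≤ ∑ v ∈ F, h v := by
      intro F hFB
      obtain ⟨hF1, hF2⟩ := Finset.mem_filter.1 hFB
      obtain ⟨v, hv, hv1⟩ := hF F (h𝓕.1 F hF1) hF2
      exact hv1.trans (Finset.single_le_sum (f := h) (fun _ _ => Nat.zero_le _) hv)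
    calc B.card = ∑ F ∈ B, 1 := by simp
      _ ≤ ∑ F ∈ B, ∑ v ∈ F, h v := Finset.sum_le_sum hex
      _ = ∑ v ∈ B.biUnion id, h v := by
        rw [Finset.sum_biUnion]
        · rfl
        · intro F hF F' hF' hne
          exact h𝓕.2 F (Finset.mem_filter.1 hF).1 F' (Finset.mem_filter.1 hF').1 hne
      _ ≤ ∑ v ∈ W \ S, h v := by
        refine Finset.sum_le_sum_of_subset ?_
        rw [Finset.biUnion_subset]
        exact fun F hF => (h𝓕.1 F (Finset.mem_filter.1 hF).1).subset
  have h3 : excess G W = ∑ v ∈ W \ S, (degIn G W v - 2) + ∑ v ∈ S, (degIn G W v - 2) :=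
    (Finset.sum_sdiff hS).symm
  have h4 : excess G (W \ S) = ∑ v ∈ W \ S, (degIn G (W \ S) v - 2) := rfl
  omega

lemma IsCycleSet.three_le {S W F : Finset V} (hS : S ⊆ W) (hF : IsCycleSet G (W \ S) F)
    {v s : V} (hv : v ∈ F) (hs : s ∈ S) (hvs : G.Adj v s) : 3 ≤ degIn G W v := by
  have := degIn_sdiff_add (G := G) hS v
  have := hF.deg v hv
  have := one_le_degIn hs hvs
  omega

lemma PotLE.sdiff {S W : Finset V} {p : ℕ} (hp : PotLE G W p) (hS : S ⊆ W) :
    PotLE G (W \ S) (p - ∑ v ∈ S, (degIn G W v - 2)) := by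
  refine potLE_sdiff_aux hS hp
    (fun v => (degIn G W v - 2) - (degIn G (W \ S) v - 2)) 0 ?_ ?_
  · rw [add_zero, ← Finset.sum_add_distrib]
    refine Finset.sum_le_sum fun v _ => ?_
    have := degIn_mono (G := G) (Finset.sdiff_subset : W \ S ⊆ W) v
    omega
  · intro F hF hnot
    obtain ⟨v, hv, s, hs, hvs⟩ := hF.exists_adj_of_not hS hnot
    refine ⟨v, hv, ?_⟩
    have := hF.three_le hS hv hs hvs
    have := hF.deg v hv
    omega

/-- The potential drops by one more if a vertex `u` of degree at least three is adjacent to `S`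
and its drop is not used up by a new cycle component. -/
lemma PotLE.sdiff_succ {S W : Finset V} {p : ℕ} (hp : PotLE G W p) (hS : S ⊆ W) {u s : V}
    (hu : u ∈ W \ S) (hs : s ∈ S) (hus : G.Adj u s) (hdu : 3 ≤ degIn G W u)
    (hcyc : ∀ F, IsCycleSet G (W \ S) F → u ∈ F → degIn G W u = 3 →
      ∃ v ∈ F, v ≠ u ∧ ∃ s ∈ S, G.Adj v s) :
    PotLE G (W \ S) (p - (∑ v ∈ S, (degIn G W v - 2) + 1)) := by
  refine potLE_sdiff_aux hS hp
    (fun v => (degIn G W v - 2) - (degIn G (W \ S) v - 2) - if v = u then 1 else 0) 1 ?_ ?_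
  · have h1 : ∑ v ∈ W \ S, (if v = u then 1 else 0) = 1 := by simp [hu]
    rw [← Finset.sum_add_distrib]
    conv_lhs => rw [← h1]
    rw [← Finset.sum_add_distrib]
    refine Finset.sum_le_sum fun v _ => ?_
    have h2 := degIn_sdiff_add (G := G) hS v
    split_ifs with hvu
    · subst hvu
      have := one_le_degIn hs hus
      omega
    · omega
  · intro F hF hnot
    by_cases huF : u ∈ F
    · by_cases h3 : degIn G W u = 3
      · obtain ⟨v, hv, hvu, s, hs, hvs⟩ := hcyc F hF huF h3
        refine ⟨v, hv, ?_⟩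
        have := hF.three_le hS hv hs hvs
        have := hF.deg v hv
        simp only [hvu, if_false]
        omega
      · refine ⟨u, huF, ?_⟩
        have := hF.deg u huF
        simp only [if_true]
        omega
    · obtain ⟨v, hv, s, hs, hvs⟩ := hF.exists_adj_of_not hS hnot
      refine ⟨v, hv, ?_⟩
      have hvu : v ≠ u := fun h => huF (h ▸ hv)
      have := hF.three_le hS hv hs hvs
      have := hF.deg v hv
      simp only [hvu, if_false]
      omega

lemma PotLE.sdiff_of_mem {S W : Finset V} {p j : ℕ} (hp : PotLE G W p) (hS : S ⊆ W) {v : V}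
    (hv : v ∈ S) (hj : j + 2 ≤ degIn G W v) : PotLE G (W \ S) (p - j) := by
  refine (hp.sdiff hS).mono ?_
  have := Finset.single_le_sum (f := fun v => degIn G W v - 2) (fun _ _ => Nat.zero_le _) hv
  omega

lemma PotLE.sdiff_of_mem_of_mem {S W : Finset V} {p : ℕ} (hp : PotLE G W p) (hS : S ⊆ W)
    {u v : V} (huv : u ≠ v) (hu : u ∈ S) (hv : v ∈ S) (hdu : 3 ≤ degIn G W u)
    (hdv : 3 ≤ degIn G W v) : PotLE G (W \ S) (p - 2) := by
  refine (hp.sdiff hS).mono ?_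
  have h := Finset.sum_le_sum_of_subset (f := fun v => degIn G W v - 2)
    (show ({u, v} : Finset V) ⊆ S by
      intro x hx
      simp only [Finset.mem_insert, Finset.mem_singleton] at hx
      rcases hx with rfl | rfl <;> assumption)
  rw [Finset.sum_pair huv] at h
  omega

lemma PotLE.sdiff_of_four_le {S W : Finset V} {p : ℕ} (hp : PotLE G W p) (hS : S ⊆ W) {u s : V}
    (hu : u ∈ W) (huS : u ∉ S) (hs : s ∈ S) (hus : G.Adj u s) (hdu : 4 ≤ degIn G W u) :
    PotLE G (W \ S) (p - 1) := by
  refine (hp.sdiff_succ hS (Finset.mem_sdiff.2 ⟨hu, huS⟩) hs hus (by omega) ?_).mono (by omega)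
  intro F _ _ h
  omega

/-- Removing part of a component that is a cycle lowers the potential. -/
lemma PotLE.sdiff_of_isCycleSet {S W C : Finset V} {p : ℕ} (hp : PotLE G W p)
    (hC : IsCycleSet G W C) (hmin : ∀ F, IsCycleSet G W F → C.card ≤ F.card)
    (hSC : S ⊆ C) (hne : S.Nonempty) : PotLE G (W \ S) (p - 1) := by
  intro 𝓕 h𝓕
  have hS : S ⊆ W := hSC.trans hC.subset
  have hcyc : ∀ F ∈ 𝓕, IsCycleSet G W F := by
    intro F hF
    by_contra hnot
    obtain ⟨v, hv, s, hs, hvs⟩ := (h𝓕.1 F hF).exists_adj_of_not hS hnot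
    have h3 := (h𝓕.1 F hF).three_le hS hv hs hvs
    have hvW := (Finset.mem_sdiff.1 ((h𝓕.1 F hF).subset hv)).1
    have := hC.deg v (hC.closed s (hSC hs) v hvW hvs.symm)
    omega
  have hdisj : ∀ F ∈ 𝓕, Disjoint F C := by
    intro F hF
    by_contra hnd
    have hFC : IsCycleSet G W (F ∩ C) := by
      refine ⟨?_, Finset.inter_subset_right.trans hC.subset, fun v hv u hu hvu => ?_,
        fun v hv => hC.deg v (Finset.mem_inter.1 hv).2⟩
      · rwa [Finset.nonempty_iff_ne_empty, ne_eq, ← Finset.disjoint_iff_inter_eq_empty]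
      · rw [Finset.mem_inter] at hv ⊢
        exact ⟨(hcyc F hF).closed v hv.1 u hu hvu, hC.closed v hv.2 u hu hvu⟩
    obtain ⟨s, hs⟩ := hne
    have heq := Finset.eq_of_subset_of_card_le Finset.inter_subset_right (hmin _ hFC)
    have hsF : s ∈ F := (Finset.mem_inter.1 (heq ▸ hSC hs)).1
    exact (Finset.mem_sdiff.1 ((h𝓕.1 F hF).subset hsF)).2 hs
  have hCnot : C ∉ 𝓕 := fun h =>
    hC.nonempty.ne_empty (Finset.disjoint_self_iff_empty _ |>.1 (hdisj C h))
  have h1 := hp (insert C 𝓕) ⟨by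
      intro F hF
      rcases Finset.mem_insert.1 hF with rfl | hF
      exacts [hC, hcyc F hF], by
      intro F hF F' hF' hne
      rcases Finset.mem_insert.1 hF with h | h <;> rcases Finset.mem_insert.1 hF' with h' | h'
      · exact absurd (h.trans h'.symm) hne
      · exact h ▸ (hdisj F' h').symm
      · exact h' ▸ hdisj F h
      · exact h𝓕.2 F h F' h' hne⟩
  rw [Finset.card_insert_of_notMem hCnot] at h1
  have h2 : excess G (W \ S) ≤ excess G W := by
    refine (Finset.sum_le_sum fun v _ => ?_).trans
      (Finset.sum_le_sum_of_subset (Finset.sdiff_subset : W \ S ⊆ W))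
    exact Nat.sub_le_sub_right (degIn_mono Finset.sdiff_subset v) 2
  omega

/-! ### Removable vertices and pairs -/

/-- In a `2`-degenerate graph of positive excess, some vertex of degree at most two can be removed
so that the potential drops. -/
lemma exists_vertex_potLE {W : Finset V} {p : ℕ} (hp : PotLE G W p)
    (hdeg : ∀ A : Finset V, A.Nonempty → ∃ v ∈ A, degIn G A v ≤ 2)
    (hB : ∃ u ∈ W, 3 ≤ degIn G W u) :
    ∃ x ∈ W, degIn G W x ≤ 2 ∧ PotLE G (W \ {x}) (p - 1) := by
  obtain ⟨u, hu, x, hx, hdu, hdx, hux⟩ :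
      ∃ u ∈ W, ∃ x ∈ W, 3 ≤ degIn G W u ∧ degIn G W x ≤ 2 ∧ G.Adj u x := by
    obtain ⟨u₀, hu₀, hdu₀⟩ := hB
    obtain ⟨u, hu, hu2⟩ := hdeg (W.filter fun v => 3 ≤ degIn G W v)
      ⟨u₀, Finset.mem_filter.2 ⟨hu₀, hdu₀⟩⟩
    rw [Finset.mem_filter] at hu
    have hsub : W.filter (fun v => 3 ≤ degIn G W v) ⊆ W := Finset.filter_subset _ _
    have h1 := degIn_sdiff_add (G := G) hsub u
    obtain ⟨x, hx, hux⟩ := exists_adj (G := G)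
      (W := W \ W.filter fun v => 3 ≤ degIn G W v) (v := u) (by omega)
    simp only [Finset.mem_sdiff, Finset.mem_filter, not_and, not_le] at hx
    exact ⟨u, hu.1, x, hx.1, hu.2, by have := hx.2 hx.1; omega, hux⟩
  by_cases hgood : ∀ F, IsCycleSet G (W \ {x}) F → u ∈ F → degIn G W u = 3 →
      ∃ v ∈ F, v ≠ u ∧ ∃ s ∈ ({x} : Finset V), G.Adj v s
  · refine ⟨x, hx, hdx, ?_⟩
    refine (hp.sdiff_succ (Finset.singleton_subset_iff.2 hx) (u := u) (s := x) ?_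
      (Finset.mem_singleton_self x) hux hdu hgood).mono (by omega)
    simp [hu, hux.ne]
  · push Not at hgood
    obtain ⟨F, hF, huF, hdu3, hno⟩ := hgood
    replace hno : ∀ v ∈ F, v ≠ u → ¬ G.Adj v x := fun v hv hvu => hno v hv hvu x (by simp)
    have hFW : ∀ v ∈ F, v ∈ W := fun v hv => (Finset.mem_sdiff.1 (hF.subset hv)).1
    have hFx : ∀ v ∈ F, v ≠ x := fun v hv => by
      have := (Finset.mem_sdiff.1 (hF.subset hv)).2
      simpa using this
    have hFdeg : ∀ v ∈ F, v ≠ u → degIn G W v = 2 := by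
      intro v hv hvu
      have h1 := degIn_sdiff_add (G := G) (Finset.singleton_subset_iff.2 hx) v
      have h2 : degIn G {x} v = 0 := by
        rw [degIn, Finset.card_eq_zero, Finset.filter_eq_empty_iff]
        intro s hs
        rw [Finset.mem_singleton.1 hs]
        exact hno v hv hvu
      have := hF.deg v hv
      omega
    have hFclosed : ∀ v ∈ F, v ≠ u → ∀ w ∈ W, G.Adj v w → w ∈ F := by
      intro v hv hvu w hw hvw
      refine hF.closed v hv w (Finset.mem_sdiff.2 ⟨hw, ?_⟩) hvw
      rw [Finset.mem_singleton]
      rintro rfl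
      exact hno v hv hvu hvw
    obtain ⟨x', hx'W, hux'⟩ := exists_adj (G := G) (W := W \ {x}) (v := u)
      (by rw [hF.deg u huF]; omega)
    have hx'F : x' ∈ F := hF.closed u huF x' hx'W hux'
    have hx'u : x' ≠ u := hux'.ne'
    have hdx' := hFdeg x' hx'F hx'u
    obtain ⟨y, hyW, hx'y, hyu⟩ := exists_adj_ne (G := G) (W := W) (v := x') (by omega) u
    have hyF : y ∈ F := hFclosed x' hx'F hx'u y hyW hx'y
    have hx'W' : ({x'} : Finset V) ⊆ W := Finset.singleton_subset_iff.2 (hFW x' hx'F)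
    have hx'adj : ∀ w ∈ W, G.Adj x' w → w = u ∨ w = y := by
      intro w hw hw'
      by_contra! hne
      have := three_le_degIn (G := G) hyu.symm hne.1.symm hne.2.symm hu hyW hw hux'.symm hx'y hw'
      omega
    refine ⟨x', hFW x' hx'F, hdx'.le, (hp.sdiff_succ hx'W' (u := u) (s := x')
      (by simp [hu, hux'.ne]) (Finset.mem_singleton_self x') hux' hdu ?_).mono (by omega)⟩
    intro F' hF' huF' _
    exfalso
    have hyF' : y ∉ F' := by
      intro hy
      have h1 := degIn_sdiff_add (G := G) hx'W' y
      have h2 := one_le_degIn (G := G) (Finset.mem_singleton_self x') hx'y.symm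
      have h3 := hF'.deg y hy
      have h4 := hFdeg y hyF hyu
      omega
    set M := (F \ {x'}) \ F' with hM
    have hyM : y ∈ M := by simp [hM, hyF, hyF', hx'y.ne']
    have hMdeg : ∀ v ∈ M, degIn G M v + (if v = y then 1 else 0) = 2 := by
      intro v hv
      simp only [hM, Finset.mem_sdiff, Finset.mem_singleton] at hv
      obtain ⟨⟨hvF, hvx'⟩, hvF'⟩ := hv
      have hvu : v ≠ u := fun h => hvF' (h ▸ huF')
      have hsplit : W.filter (G.Adj v) = M.filter (G.Adj v) ∪ ({x'} : Finset V).filter (G.Adj v) := by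
        ext w
        simp only [hM, Finset.mem_filter, Finset.mem_union, Finset.mem_sdiff, Finset.mem_singleton]
        constructor
        · rintro ⟨hw, hvw⟩
          by_cases hwx : w = x'
          · exact Or.inr ⟨hwx, hvw⟩
          · refine Or.inl ⟨⟨⟨hFclosed v hvF hvu w hw hvw, hwx⟩, fun hwF' => hvF' ?_⟩, hvw⟩
            exact hF'.closed w hwF' v (by simp [hFW v hvF, hvx']) hvw.symm
        · rintro (⟨⟨⟨hw, -⟩, -⟩, hvw⟩ | ⟨rfl, hvw⟩)
          exacts [⟨hFW w hw, hvw⟩, ⟨hFW w hx'F, hvw⟩]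
      have hdisj : Disjoint (M.filter (G.Adj v)) (({x'} : Finset V).filter (G.Adj v)) := by
        refine Finset.disjoint_filter_filter ?_
        simp [hM]
      have h1 : degIn G W v = degIn G M v + (({x'} : Finset V).filter (G.Adj v)).card := by
        rw [degIn, hsplit, Finset.card_union_of_disjoint hdisj, degIn]
      rw [hFdeg v hvF hvu, Finset.filter_singleton] at h1
      have h2 : G.Adj v x' ↔ v = y := by
        constructor
        · intro h
          exact (hx'adj v (hFW v hvF) h.symm).resolve_left hvu
        · rintro rfl
          exact hx'y.symm
      simp only [h2] at h1
      split_ifs at h1 ⊢ <;> simp at h1 <;> omega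
    have hsum : ∑ v ∈ M, degIn G M v + 1 = 2 * M.card := by
      have h1 : ∑ v ∈ M, (if v = y then 1 else 0) = 1 := by simp [hyM]
      conv_lhs => rw [← h1]
      rw [← Finset.sum_add_distrib, Finset.sum_congr rfl hMdeg]
      simp [mul_comm]
    obtain ⟨c, hc⟩ := even_sum_degIn (G := G) M
    omega

lemma exists_pair_potLE {W : Finset V} {p : ℕ} (hp : PotLE G W p)
    (hmin : ∀ v ∈ W, 2 ≤ degIn G W v) (hz : ∀ F, ¬ IsCycleSet G W F)
    (hB : ∃ u ∈ W, 3 ≤ degIn G W u) (hcount : 2 * excess G W ≤ W.card + 1) :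
    ∃ x ∈ W, ∃ y ∈ W, G.Adj x y ∧ degIn G W x = 2 ∧ degIn G W y ≤ 3 ∧
      PotLE G (W \ {x, y}) (p - 1) := by
  by_contra! hno
  have hne3 : ∀ x ∈ W, ∀ y ∈ W, G.Adj x y → degIn G W x = 2 → degIn G W y ≠ 3 := by
    intro x hx y hy hxy hdx hdy
    exact hno x hx y hy hxy hdx hdy.le
      (hp.sdiff_of_mem (by simp [Finset.insert_subset_iff, hx, hy]) (v := y) (by simp) (by omega))
  have hne2 : ∀ x ∈ W, ∀ y ∈ W, ∀ u ∈ W, G.Adj x y → G.Adj x u → degIn G W x = 2 →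
      degIn G W y = 2 → degIn G W u = 2 := by
    intro x hx y hy u hu hxy hxu hdx hdy
    by_contra hdu
    have h3 := hne3 x hx u hu hxu hdx
    have h2 := hmin u hu
    refine hno x hx y hy hxy hdx (by omega)
      (hp.sdiff_of_four_le (u := u) (s := x) ?_ hu ?_ (by simp) hxu.symm (by omega))
    · simp [Finset.insert_subset_iff, hx, hy]
    · simp only [Finset.mem_insert, Finset.mem_singleton, not_or]
      exact ⟨hxu.ne', fun h => hdu (h ▸ hdy)⟩
  have hfour : ∀ x ∈ W, ∀ y ∈ W, G.Adj x y → degIn G W x = 2 → 4 ≤ degIn G W y := by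
    by_contra! hcon
    obtain ⟨x, hx, y, hy, hxy, hdx, hdy⟩ := hcon
    have h3 := hne3 x hx y hy hxy hdx
    have h2 := hmin y hy
    refine hz (W.filter fun v => degIn G W v = 2 ∧ ∀ w ∈ W, G.Adj v w → degIn G W w = 2)
      ⟨⟨x, ?_⟩, Finset.filter_subset _ _, ?_, ?_⟩
    · rw [Finset.mem_filter]
      exact ⟨hx, hdx, fun w hw hxw => hne2 x hx y hy w hw hxy hxw hdx (by omega)⟩
    · intro v hv u hu hvu
      rw [Finset.mem_filter] at hv ⊢
      have hdu := hv.2.2 u hu hvu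
      exact ⟨hu, hdu, fun w hw huw => hne2 u hu v hv.1 w hw hvu.symm huw hdu hv.2.1⟩
    · intro v hv
      exact (Finset.mem_filter.1 hv).2.1
  set B := W.filter (fun v => 3 ≤ degIn G W v) with hBdef
  set R := W.filter (fun v => degIn G W v ≤ 2) with hRdef
  have hRB : 2 * R.card ≤ ∑ v ∈ B, degIn G R v := by
    rw [sum_degIn_comm, mul_comm, ← smul_eq_mul, ← Finset.sum_const]
    refine Finset.sum_le_sum fun y hy => ?_
    rw [hRdef, Finset.mem_filter] at hy
    have h2 := hmin y hy.1
    refine h2.trans (Finset.card_le_card fun u hu => ?_)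
    rw [Finset.mem_filter] at hu ⊢
    refine ⟨Finset.mem_filter.2 ⟨hu.1, ?_⟩, hu.2⟩
    have := hfour y hy.1 u hu.1 hu.2 (by omega)
    omega
  have h1 : 2 * W.card ≤ ∑ v ∈ B, (2 + degIn G R v) := two_mul_card_le_sum (degIn G R) hRB
  have h2 : ∑ v ∈ B, (2 + degIn G R v + 2) ≤ ∑ v ∈ B, 4 * (degIn G W v - 2) := by
    refine Finset.sum_le_sum fun v hv => ?_
    rw [hBdef, Finset.mem_filter] at hv
    have hle : degIn G R v ≤ degIn G W v := degIn_mono (Finset.filter_subset _ _) v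
    by_cases h3 : degIn G W v = 3
    · have h0 : degIn G R v = 0 := by
        rw [degIn, Finset.card_eq_zero, Finset.filter_eq_empty_iff]
        intro y hy hvy
        rw [hRdef, Finset.mem_filter] at hy
        have := hmin y hy.1
        exact hne3 y hy.1 v hv.1 hvy.symm (by omega) h3
      omega
    · omega
  rw [← Finset.mul_sum, ← excess_eq_sum_filter, Finset.sum_add_distrib, Finset.sum_const,
    smul_eq_mul] at h2
  have hB1 : B.card ≤ 1 := by omega
  obtain ⟨v, hv, hdv⟩ := hB
  have hvB : v ∈ B := Finset.mem_filter.2 ⟨hv, hdv⟩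
  have hBv : ∀ u ∈ W, 3 ≤ degIn G W u → u = v := fun u hu hdu =>
    Finset.card_le_one.1 hB1 u (Finset.mem_filter.2 ⟨hu, hdu⟩) v hvB
  obtain ⟨x, hx, hvx⟩ := exists_adj (G := G) (W := W) (v := v) (by omega)
  have hdx : degIn G W x = 2 := by
    by_contra hdx
    have := hmin x hx
    exact hvx.ne' (hBv x hx (by omega))
  obtain ⟨w, hw, hxw, hwv⟩ := exists_adj_ne (G := G) (W := W) (v := x) (by omega) v
  have := hfour x hx w hw hxw hdx
  exact hwv (hBv w hw (by omega))

/-! ### The case where the number of vertices is divisible by the number of colours -/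

/-- No removal of one, two or three vertices is available in `G[W]`. -/
structure IsReducedSet (G : SimpleGraph V) [DecidableRel G.Adj] (W : Finset V) (p : ℕ) : Prop where
  pot : PotLE G W p
  no_cycle : ∀ F, ¬ IsCycleSet G W F
  pos : ∀ x ∈ W, 1 ≤ degIn G W x
  leaf : ∀ x ∈ W, ∀ y ∈ W, G.Adj x y → degIn G W x = 1 → 3 ≤ degIn G W y
  triple : ∀ a ∈ W, ∀ b ∈ W, ∀ c ∈ W, a ≠ b → a ≠ c → b ≠ c →
    degIn G (W \ {a, b, c}) a = 0 → degIn G (W \ {a, b, c}) b ≤ 1 →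
    degIn G (W \ {a, b, c}) c ≤ 2 → ¬ PotLE G (W \ {a, b, c}) (p - 1)

lemma triple_subset {W : Finset V} {a b c : V} (ha : a ∈ W) (hb : b ∈ W) (hc : c ∈ W) :
    ({a, b, c} : Finset V) ⊆ W := by
  simp [Finset.insert_subset_iff, ha, hb, hc]

lemma quad_subset {W : Finset V} {a b c d : V} (ha : a ∈ W) (hb : b ∈ W) (hc : c ∈ W)
    (hd : d ∈ W) : ({a, b, c, d} : Finset V) ⊆ W := by
  simp [Finset.insert_subset_iff, ha, hb, hc, hd]

namespace IsReducedSet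

variable {W : Finset V} {p : ℕ}

/-- A neighbour of degree two of a vertex of degree three has no other neighbour of degree at
most two. -/
lemma three_le_of_path (h : IsReducedSet G W p) {c x y : V} (hc : c ∈ W) (hx : x ∈ W) (hy : y ∈ W)
    (hcx : G.Adj c x) (hxy : G.Adj x y) (hyc : y ≠ c) (hdc : degIn G W c = 3)
    (hdx : degIn G W x = 2) : 3 ≤ degIn G W y := by
  by_contra hdy
  have hS := triple_subset hx hy hc
  refine h.triple x hx y hy c hc hxy.ne hcx.ne' hyc ?_ ?_ ?_
    (h.pot.sdiff_of_mem hS (v := c) (by simp) (by omega))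
  · have h1 := degIn_sdiff_add (G := G) hS x
    have h2 := two_le_degIn (G := G) (S := {x, y, c}) hyc (by simp) (by simp) hxy hcx.symm
    omega
  · have h1 := degIn_sdiff_add (G := G) hS y
    have h2 := one_le_degIn (G := G) (S := {x, y, c}) (by simp) hxy.symm
    omega
  · have h1 := degIn_sdiff_add (G := G) hS c
    have h2 := one_le_degIn (G := G) (S := {x, y, c}) (by simp) hcx
    omega

/-- Every vertex of degree at least three next to a removed set contributes to the drop of the
potential. -/
lemma potLE_sdiff (h : IsReducedSet G W p) {S : Finset V} (hS : S ⊆ W) {u s : V} (hu : u ∈ W)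
    (huS : u ∉ S) (hs : s ∈ S) (hus : G.Adj u s) (hdu : 3 ≤ degIn G W u) :
    PotLE G (W \ S) (p - (∑ v ∈ S, (degIn G W v - 2) + 1)) := by
  refine h.pot.sdiff_succ hS (Finset.mem_sdiff.2 ⟨hu, huS⟩) hs hus hdu ?_
  intro F hF huF hdu3
  by_contra! hno
  have hFW : ∀ v ∈ F, v ∈ W := fun v hv => (Finset.mem_sdiff.1 (hF.subset hv)).1
  have hdeg : ∀ v ∈ F, v ≠ u → degIn G W v = 2 := by
    intro v hv hvu
    have h1 := degIn_sdiff_add (G := G) hS v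
    have h2 : degIn G S v = 0 := by
      rw [degIn, Finset.card_eq_zero, Finset.filter_eq_empty_iff]
      exact hno v hv hvu
    have := hF.deg v hv
    omega
  obtain ⟨x, hx, hux⟩ := exists_adj (G := G) (W := W \ S) (v := u) (by rw [hF.deg u huF]; omega)
  have hxF := hF.closed u huF x hx hux
  obtain ⟨y, hy, hxy, hyu⟩ := exists_adj_ne (G := G) (W := W \ S) (v := x)
    (by rw [hF.deg x hxF]) u
  have hyF := hF.closed x hxF y hy hxy
  have h1 := h.three_le_of_path hu (hFW x hxF) (hFW y hyF) hux hxy hyu hdu3 (hdeg x hxF hux.ne')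
  have h2 := hdeg y hyF hyu
  omega

/-- Every vertex of degree at most two has a neighbour of degree at least three. -/
lemma exists_adj_three_le (h : IsReducedSet G W p) {y : V} (hy : y ∈ W) (hdy : degIn G W y ≤ 2) :
    ∃ u ∈ W, G.Adj y u ∧ 3 ≤ degIn G W u := by
  have hpath : ∀ a ∈ W, ∀ b ∈ W, ∀ u ∈ W, degIn G W a = 2 → degIn G W b = 2 →
      (∀ w ∈ W, G.Adj b w → degIn G W w = 2) → G.Adj a b → G.Adj a u → degIn G W u < 3 := by
    intro a ha b hb u hu hda hdb hbw hab hau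
    by_contra hdu
    obtain ⟨c, hc, hbc, hca⟩ := exists_adj_ne (G := G) (W := W) (v := b) (by omega) a
    have hdc := hbw c hc hbc
    have hS := triple_subset hb ha hc
    have huS : u ∉ ({b, a, c} : Finset V) := by
      simp only [Finset.mem_insert, Finset.mem_singleton]
      rintro (rfl | rfl | rfl) <;> omega
    refine h.triple b hb a ha c hc hab.ne' hbc.ne hca.symm ?_ ?_ ?_
      ((h.potLE_sdiff hS (s := a) hu huS (by simp) hau.symm (by omega)).mono (by omega))
    · have h1 := degIn_sdiff_add (G := G) hS b
      have h2 := two_le_degIn (G := G) (S := {b, a, c}) hca (by simp) (by simp) hbc hab.symm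
      omega
    · have h1 := degIn_sdiff_add (G := G) hS a
      have h2 := one_le_degIn (G := G) (S := {b, a, c}) (by simp) hab
      omega
    · have h1 := degIn_mono (G := G) (Finset.sdiff_subset : W \ {b, a, c} ⊆ W) c
      omega
  by_contra! hno
  have htwo : ∀ v ∈ W, degIn G W v ≤ 2 → (∀ u ∈ W, G.Adj v u → degIn G W u < 3) →
      degIn G W v = 2 ∧ ∀ u ∈ W, G.Adj v u → degIn G W u = 2 := by
    intro v hv hdv hvu
    have hpos := h.pos v hv
    constructor
    · by_contra hne
      obtain ⟨u, hu, hvu'⟩ := exists_adj hpos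
      have h1 := h.leaf v hv u hu hvu' (by omega)
      have h2 := hvu u hu hvu'
      omega
    · intro u hu hvu'
      have h1 := h.pos u hu
      have h2 := hvu u hu hvu'
      have h3 : degIn G W u ≠ 1 := fun h1 => by
        have := h.leaf u hu v hv hvu'.symm h1
        omega
      omega
  refine h.no_cycle
    (W.filter fun v => degIn G W v = 2 ∧ ∀ w ∈ W, G.Adj v w → degIn G W w = 2)
    ⟨⟨y, ?_⟩, Finset.filter_subset _ _, ?_, ?_⟩
  · rw [Finset.mem_filter]
    exact ⟨hy, htwo y hy hdy hno⟩
  · intro v hv u hu hvu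
    rw [Finset.mem_filter] at hv ⊢
    have hdu := hv.2.2 u hu hvu
    exact ⟨hu, htwo u hu hdu.le fun w hw huw =>
      hpath u hu v hv.1 w hw hdu hv.2.1 hv.2.2 hvu.symm huw⟩
  · intro v hv
    exact (Finset.mem_filter.1 hv).2.1

/-- If a vertex `v` of degree at most four has a leaf neighbour, then its other neighbours have
degree at least three. -/
lemma three_le_of_leaf (h : IsReducedSet G W p) {x v y : V} (hx : x ∈ W) (hv : v ∈ W) (hy : y ∈ W)
    (hvx : G.Adj v x) (hvy : G.Adj v y) (hxy : x ≠ y) (hdx : degIn G W x = 1)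
    (hdv : degIn G W v ≤ 4) : 3 ≤ degIn G W y := by
  by_contra hdy
  have hS := triple_subset hx hy hv
  have hdv3 := h.leaf x hx v hv hvx.symm hdx
  refine h.triple x hx y hy v hv hxy hvx.ne' hvy.ne' ?_ ?_ ?_
    (h.pot.sdiff_of_mem hS (v := v) (by simp) (by omega))
  · have h1 := degIn_sdiff_add (G := G) hS x
    have h2 := one_le_degIn (G := G) (S := {x, y, v}) (by simp) hvx.symm
    omega
  · have h1 := degIn_sdiff_add (G := G) hS y
    have h2 := one_le_degIn (G := G) (S := {x, y, v}) (by simp) hvy.symm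
    omega
  · have h1 := degIn_sdiff_add (G := G) hS v
    have h2 := two_le_degIn (G := G) (S := {x, y, v}) hxy (by simp) (by simp) hvx hvy
    omega

/-- If a vertex `v` of degree three has a leaf neighbour, then its other neighbours have degree at
least four. -/
lemma four_le_of_leaf (h : IsReducedSet G W p) {x v y : V} (hx : x ∈ W) (hv : v ∈ W) (hy : y ∈ W)
    (hvx : G.Adj v x) (hvy : G.Adj v y) (hxy : x ≠ y) (hdx : degIn G W x = 1)
    (hdv : degIn G W v = 3) : 4 ≤ degIn G W y := by
  by_contra hdy
  have hS := triple_subset hx hv hy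
  refine h.triple x hx v hv y hy hvx.ne' hxy hvy.ne ?_ ?_ ?_
    (h.pot.sdiff_of_mem hS (v := v) (by simp) (by omega))
  · have h1 := degIn_sdiff_add (G := G) hS x
    have h2 := one_le_degIn (G := G) (S := {x, v, y}) (by simp) hvx.symm
    omega
  · have h1 := degIn_sdiff_add (G := G) hS v
    have h2 := two_le_degIn (G := G) (S := {x, v, y}) hxy (by simp) (by simp) hvx hvy
    omega
  · have h1 := degIn_sdiff_add (G := G) hS y
    have h2 := one_le_degIn (G := G) (S := {x, v, y}) (by simp) hvy.symm
    omega

end IsReducedSet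

/-- A heavy vertex is a leaf or has a second neighbour of degree at most two. -/
lemma eq_one_or_exists_of_mem_heavySet {W : Finset V} {v y : V} (hv : v ∈ bigSet G W)
    (hy : y ∈ heavySet G W) (hvy : G.Adj v y) :
    degIn G W y = 1 ∨ ∃ a ∈ W, G.Adj y a ∧ a ≠ v ∧ degIn G W a ≤ 2 ∧ degIn G W y = 2 := by
  rw [heavySet, Finset.mem_filter, mem_smallSet] at hy
  have hvW := (mem_bigSet.1 hv).1
  have h1 := one_le_degIn (G := G) hvW hvy.symm
  by_cases hd : degIn G W y = 1
  · exact Or.inl hd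
  · right
    obtain ⟨a, ha, hya, hav⟩ := exists_adj_ne (G := G) (W := W) (v := y) (by omega) v
    refine ⟨a, ha, hya, hav, ?_, by omega⟩
    by_contra hda
    have := two_le_degIn (G := G) hav (mem_bigSet.2 ⟨ha, by omega⟩) hv hya hvy.symm
    omega

namespace IsReducedSet

variable {W : Finset V} {p : ℕ}

/-- In a reduced graph every vertex of degree at most two sends charge two to its neighbours of
degree at least three. -/
lemma two_mul_card_le (h : IsReducedSet G W p) :
    2 * W.card ≤
      ∑ v ∈ bigSet G W, (2 + (degIn G (smallSet G W) v + degIn G (heavySet G W) v)) := by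
  refine two_mul_card_le_sum _ ?_
  change 2 * (smallSet G W).card ≤ ∑ v ∈ bigSet G W, _
  rw [Finset.sum_add_distrib, sum_degIn_comm, sum_degIn_comm (bigSet G W) (heavySet G W),
    heavySet, Finset.sum_filter, ← Finset.sum_add_distrib, mul_comm, ← smul_eq_mul,
    ← Finset.sum_const]
  refine Finset.sum_le_sum fun y hy => ?_
  rw [mem_smallSet] at hy
  obtain ⟨u, hu, hyu, hdu⟩ := h.exists_adj_three_le hy.1 hy.2
  have := one_le_degIn (G := G) (mem_bigSet.2 ⟨hu, hdu⟩) hyu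
  split_ifs <;> omega

/-- A heavy neighbour of a vertex of degree three is a leaf. -/
lemma leaf_of_heavy (h : IsReducedSet G W p) {v y : V} (hv : v ∈ bigSet G W)
    (hdv : degIn G W v = 3) (hy : y ∈ heavySet G W) (hvy : G.Adj v y) : degIn G W y = 1 := by
  rcases eq_one_or_exists_of_mem_heavySet hv hy hvy with h1 | ⟨a, ha, hya, hav, hda, hdy⟩
  · exact h1
  · have hyW := smallSet_subset W (heavySet_subset W hy)
    have := h.three_le_of_path (mem_bigSet.1 hv).1 hyW ha hvy hya hav hdv hdy
    omega

lemma lt_three_mul_excess (h : IsReducedSet G W p) (hB : ∃ u ∈ W, 3 ≤ degIn G W u) :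
    W.card < 3 * excess G W := by
  have h1 := h.two_mul_card_le
  have h2 : ∑ v ∈ bigSet G W, (2 + (degIn G (smallSet G W) v + degIn G (heavySet G W) v)) <
      ∑ v ∈ bigSet G W, 6 * (degIn G W v - 2) := by
    obtain ⟨u, hu, hdu⟩ := hB
    refine Finset.sum_lt_sum_of_nonempty ⟨u, mem_bigSet.2 ⟨hu, hdu⟩⟩ fun v hv => ?_
    have hv' := mem_bigSet.1 hv
    have h3 := degIn_mono (G := G) (heavySet_subset (G := G) W) v
    have h4 := degIn_mono (G := G) (smallSet_subset (G := G) W) v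
    by_cases hd : degIn G W v = 3
    · by_contra hcon
      obtain ⟨x, hx, hvx⟩ := exists_adj (G := G) (W := heavySet G W) (v := v) (by omega)
      obtain ⟨y, hy, hvy, hyx⟩ := exists_adj_ne (G := G) (W := smallSet G W) (v := v) (by omega) x
      have hdx := h.leaf_of_heavy hv hd hx hvx
      have hxW := smallSet_subset W (heavySet_subset W hx)
      have hy' := mem_smallSet.1 hy
      have := h.three_le_of_leaf hxW hv'.1 hy'.1 hvx hvy hyx.symm hdx (by omega)
      omega
    · omega
  rw [← Finset.mul_sum] at h2
  have h3 : excess G W = ∑ v ∈ bigSet G W, (degIn G W v - 2) := excess_eq_sum_filter W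
  omega

end IsReducedSet

variable (G) in
/-- No removal of four vertices is available in `G[W]`. -/
def NoQuadRemoval (W : Finset V) (p : ℕ) : Prop :=
  ∀ a ∈ W, ∀ b ∈ W, ∀ c ∈ W, ∀ d ∈ W, a ≠ b → a ≠ c → a ≠ d → b ≠ c → b ≠ d → c ≠ d →
    degIn G (W \ {a, b, c, d}) a = 0 → degIn G (W \ {a, b, c, d}) b ≤ 1 →
    degIn G (W \ {a, b, c, d}) c ≤ 2 → degIn G (W \ {a, b, c, d}) d ≤ 3 →
    ¬ PotLE G (W \ {a, b, c, d}) (p - 2)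

namespace IsReducedSet

variable {W : Finset V} {p : ℕ}

lemma not_small_path (h : IsReducedSet G W p) (hq : NoQuadRemoval G W p) {v x a y : V}
    (hv : v ∈ W) (hx : x ∈ W) (ha : a ∈ W) (hy : y ∈ W) (hvx : G.Adj v x) (hvy : G.Adj v y)
    (hxa : G.Adj x a) (hav : a ≠ v) (hxy : x ≠ y) (hay : a ≠ y) (hdx : degIn G W x = 2)
    (hda : degIn G W a ≤ 2) (hdy : degIn G W y ≤ 2) (hdv : 4 ≤ degIn G W v) :
    6 ≤ degIn G W v := by
  by_contra hdv'
  have hS := quad_subset hx ha hy hv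
  refine hq x hx a ha y hy v hv hxa.ne hxy hvx.ne' hay hav hvy.ne' ?_ ?_ ?_ ?_
    (h.pot.sdiff_of_mem hS (v := v) (by simp) (by omega))
  · have h1 := degIn_sdiff_add (G := G) hS x
    have h2 := two_le_degIn (G := G) (S := {x, a, y, v}) hav (by simp) (by simp) hxa hvx.symm
    omega
  · have h1 := degIn_sdiff_add (G := G) hS a
    have h2 := one_le_degIn (G := G) (S := {x, a, y, v}) (by simp) hxa.symm
    omega
  · have h1 := degIn_sdiff_add (G := G) hS y
    omega
  · have h1 := degIn_sdiff_add (G := G) hS v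
    have h2 := two_le_degIn (G := G) (S := {x, a, y, v}) hxy (by simp) (by simp) hvx hvy
    omega

lemma not_small_star (h : IsReducedSet G W p) (hq : NoQuadRemoval G W p) {v x y z : V}
    (hv : v ∈ W) (hx : x ∈ W) (hy : y ∈ W) (hz : z ∈ W) (hvx : G.Adj v x) (hvy : G.Adj v y)
    (hvz : G.Adj v z) (hxy : x ≠ y) (hxz : x ≠ z) (hyz : y ≠ z)
    (hdx : degIn G W x ≤ degIn G {x, y, z, v} x)
    (hdy : degIn G W y ≤ 2) (hdz : degIn G W z ≤ 2) (hdv : 4 ≤ degIn G W v) :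
    7 ≤ degIn G W v := by
  by_contra hdv'
  have hS := quad_subset hx hy hz hv
  refine hq x hx y hy z hz v hv hxy hxz hvx.ne' hyz hvy.ne' hvz.ne' ?_ ?_ ?_ ?_
    (h.pot.sdiff_of_mem hS (v := v) (by simp) (by omega))
  · have h1 := degIn_sdiff_add (G := G) hS x
    omega
  · have h1 := degIn_sdiff_add (G := G) hS y
    have h2 := one_le_degIn (G := G) (S := {x, y, z, v}) (by simp) hvy.symm
    omega
  · have h1 := degIn_sdiff_add (G := G) hS z
    omega
  · have h1 := degIn_sdiff_add (G := G) hS v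
    have h2 := three_le_degIn (G := G) (S := {x, y, z, v}) hxy hxz hyz (by simp) (by simp)
      (by simp) hvx hvy hvz
    omega

/-- A vertex of degree four has at most one heavy neighbour. -/
lemma degIn_heavySet_le_one (h : IsReducedSet G W p) (hq : NoQuadRemoval G W p) {v : V}
    (hv : v ∈ bigSet G W) (hdv : degIn G W v = 4) : degIn G (heavySet G W) v ≤ 1 := by
  by_contra hcon
  have hvW := (mem_bigSet.1 hv).1
  obtain ⟨x, hx, hvx⟩ := exists_adj (G := G) (W := heavySet G W) (v := v) (by omega)
  obtain ⟨y, hy, hvy, hyx⟩ := exists_adj_ne (G := G) (W := heavySet G W) (v := v) (by omega) x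
  have hx' := mem_smallSet.1 (heavySet_subset W hx)
  have hy' := mem_smallSet.1 (heavySet_subset W hy)
  rcases eq_one_or_exists_of_mem_heavySet hv hx hvx with hdx | ⟨a, ha, hxa, hav, hda, hdx⟩
  · have := h.three_le_of_leaf hx'.1 hvW hy'.1 hvx hvy hyx.symm hdx hdv.le
    omega
  · by_cases hay : a = y
    · subst hay
      have hS := triple_subset hx'.1 hy'.1 hvW
      refine h.triple x hx'.1 a ha v hvW hxa.ne hvx.ne' hav ?_ ?_ ?_
        (h.pot.sdiff_of_mem hS (v := v) (by simp) (by omega))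
      · have h1 := degIn_sdiff_add (G := G) hS x
        have h2 := two_le_degIn (G := G) (S := {x, a, v}) hav (by simp) (by simp) hxa hvx.symm
        omega
      · have h1 := degIn_sdiff_add (G := G) hS a
        have h2 := one_le_degIn (G := G) (S := {x, a, v}) (by simp) hvy.symm
        omega
      · have h1 := degIn_sdiff_add (G := G) hS v
        have h2 := two_le_degIn (G := G) (S := {x, a, v}) hyx (by simp) (by simp) hvy hvx
        omega
    · have := h.not_small_path hq hvW hx'.1 ha hy'.1 hvx hvy hxa hav hyx.symm hay hdx hda hy'.2
        hdv.ge
      omega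

/-- A vertex of degree five has at most two heavy neighbours. -/
lemma degIn_heavySet_le_two (h : IsReducedSet G W p) (hq : NoQuadRemoval G W p) {v : V}
    (hv : v ∈ bigSet G W) (hdv : degIn G W v = 5) : degIn G (heavySet G W) v ≤ 2 := by
  by_contra hcon
  have hvW := (mem_bigSet.1 hv).1
  obtain ⟨x, hx, hvx⟩ := exists_adj (G := G) (W := heavySet G W) (v := v) (by omega)
  obtain ⟨y, hy, hvy, hyx⟩ := exists_adj_ne (G := G) (W := heavySet G W) (v := v) (by omega) x
  obtain ⟨z, hz, hvz, hzx, hzy⟩ :=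
    exists_adj_ne_ne (G := G) (W := heavySet G W) (v := v) (by omega) x y
  have hx' := mem_smallSet.1 (heavySet_subset W hx)
  have hy' := mem_smallSet.1 (heavySet_subset W hy)
  have hz' := mem_smallSet.1 (heavySet_subset W hz)
  have hstar : degIn G {x, y, z, v} x < degIn G W x := by
    by_contra! hle
    have := h.not_small_star hq hvW hx'.1 hy'.1 hz'.1 hvx hvy hvz hyx.symm hzx.symm hzy.symm hle
      hy'.2 hz'.2 (by omega)
    omega
  rcases eq_one_or_exists_of_mem_heavySet hv hx hvx with hdx | ⟨a, ha, hxa, hav, hda, hdx⟩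
  · have := one_le_degIn (G := G) (S := {x, y, z, v}) (by simp) hvx.symm
    omega
  · by_cases hay : a = y
    · have := two_le_degIn (G := G) (S := {x, y, z, v}) hav (by simp [hay]) (by simp) hxa hvx.symm
      omega
    · have := h.not_small_path hq hvW hx'.1 ha hy'.1 hvx hvy hxa hav hyx.symm hay hdx hda hy'.2
        (by omega)
      omega

/-- A vertex of degree three has at most two neighbours of degree at most two. -/
lemma degIn_smallSet_le_two (h : IsReducedSet G W p) (hq : NoQuadRemoval G W p) {v : V}
    (hv : v ∈ W) (hdv : degIn G W v = 3) : degIn G (smallSet G W) v ≤ 2 := by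
  by_contra hcon
  obtain ⟨x, hx, hvx⟩ := exists_adj (G := G) (W := smallSet G W) (v := v) (by omega)
  obtain ⟨y, hy, hvy, hyx⟩ := exists_adj_ne (G := G) (W := smallSet G W) (v := v) (by omega) x
  obtain ⟨z, hz, hvz, hzx, hzy⟩ :=
    exists_adj_ne_ne (G := G) (W := smallSet G W) (v := v) (by omega) x y
  rw [mem_smallSet] at hx hy hz
  have hdx : degIn G W x = 2 := by
    have h1 := h.pos x hx.1
    by_contra hne
    have := h.three_le_of_leaf hx.1 hv hy.1 hvx hvy hyx.symm (by omega) (by omega)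
    omega
  obtain ⟨u, hu, hxu, huv⟩ := exists_adj_ne (G := G) (W := W) (v := x) (by omega) v
  have hdu := h.three_le_of_path hv hx.1 hu hvx hxu huv hdv hdx
  have hS := quad_subset hv hx.1 hy.1 hz.1
  have huS : u ∉ ({v, x, y, z} : Finset V) := by
    simp only [Finset.mem_insert, Finset.mem_singleton]
    rintro (rfl | rfl | rfl | rfl)
    · exact huv rfl
    all_goals omega
  have hsum := Finset.single_le_sum (f := fun v => degIn G W v - 2) (fun _ _ => Nat.zero_le _)
    (show v ∈ ({v, x, y, z} : Finset V) by simp)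
  refine hq v hv x hx.1 y hy.1 z hz.1 hvx.ne hvy.ne hvz.ne hyx.symm hzx.symm hzy.symm ?_ ?_ ?_ ?_
    ((h.potLE_sdiff hS (s := x) hu huS (by simp) hxu.symm hdu).mono (by omega))
  · have h1 := degIn_sdiff_add (G := G) hS v
    have h2 := three_le_degIn (G := G) (S := {v, x, y, z}) hyx.symm hzx.symm hzy.symm (by simp)
      (by simp) (by simp) hvx hvy hvz
    omega
  · have h1 := degIn_sdiff_add (G := G) hS x
    have h2 := one_le_degIn (G := G) (S := {v, x, y, z}) (by simp) hvx.symm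
    omega
  · have h1 := degIn_sdiff_add (G := G) hS y
    omega
  · have h1 := degIn_sdiff_add (G := G) hS z
    omega

/-- A vertex of degree three that receives charge two has a neighbour of degree at least four. -/
lemma exists_adj_four_le (h : IsReducedSet G W p) (hq : NoQuadRemoval G W p) {v : V}
    (hv : v ∈ bigSet G W) (hdv : degIn G W v = 3)
    (hc : 2 ≤ degIn G (smallSet G W) v + degIn G (heavySet G W) v) :
    degIn G (smallSet G W) v + degIn G (heavySet G W) v = 2 ∧ ∃ u ∈ W, 4 ≤ degIn G W u := by
  have hvW := (mem_bigSet.1 hv).1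
  have hsub := degIn_mono (G := G) (heavySet_subset (G := G) W) v
  by_cases hheavy : 1 ≤ degIn G (heavySet G W) v
  · obtain ⟨x, hx, hvx⟩ := exists_adj hheavy
    have hdx := h.leaf_of_heavy hv hdv hx hvx
    have hxW := smallSet_subset W (heavySet_subset W hx)
    have hone : degIn G (smallSet G W) v ≤ 1 := by
      by_contra hcon
      obtain ⟨y, hy, hvy, hyx⟩ := exists_adj_ne (G := G) (W := smallSet G W) (v := v) (by omega) x
      rw [mem_smallSet] at hy
      have := h.three_le_of_leaf hxW hvW hy.1 hvx hvy hyx.symm hdx (by omega)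
      omega
    obtain ⟨y, hy, hvy, hyx⟩ := exists_adj_ne (G := G) (W := W) (v := v) (by omega) x
    exact ⟨by omega, y, hy, h.four_le_of_leaf hxW hvW hy hvx hvy hyx.symm hdx hdv⟩
  · have h2 := h.degIn_smallSet_le_two hq hvW hdv
    refine ⟨by omega, ?_⟩
    obtain ⟨x, hx, hvx⟩ := exists_adj (G := G) (W := smallSet G W) (v := v) (by omega)
    obtain ⟨y, hy, hvy, hyx⟩ := exists_adj_ne (G := G) (W := smallSet G W) (v := v) (by omega) x
    obtain ⟨u, hu, hvu, hux, huy⟩ := exists_adj_ne_ne (G := G) (W := W) (v := v) (by omega) x y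
    have hdu : 3 ≤ degIn G W u := by
      by_contra hdu
      have := three_le_degIn (G := G) hyx.symm hux.symm huy.symm hx hy
        (mem_smallSet.2 ⟨hu, by omega⟩) hvx hvy hvu
      omega
    rw [mem_smallSet] at hx hy
    refine ⟨u, hu, ?_⟩
    by_contra hdu4
    have hS := quad_subset hvW hx.1 hy.1 hu
    refine hq v hvW x hx.1 y hy.1 u hu hvx.ne hvy.ne hvu.ne hyx.symm hux.symm huy.symm ?_ ?_ ?_ ?_
      (h.pot.sdiff_of_mem_of_mem hS hvu.ne (by simp) (by simp) hdv.ge hdu)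
    · have h1 := degIn_sdiff_add (G := G) hS v
      have h2 := three_le_degIn (G := G) (S := {v, x, y, u}) hyx.symm hux.symm huy.symm (by simp)
        (by simp) (by simp) hvx hvy hvu
      omega
    · have h1 := degIn_sdiff_add (G := G) hS x
      have h2 := one_le_degIn (G := G) (S := {v, x, y, u}) (by simp) hvx.symm
      omega
    · have h1 := degIn_sdiff_add (G := G) hS y
      omega
    · have h1 := degIn_sdiff_add (G := G) hS u
      omega

lemma lt_two_mul_excess (h : IsReducedSet G W p) (hq : NoQuadRemoval G W p)
    (hB : ∃ u ∈ W, 3 ≤ degIn G W u) : W.card < 2 * excess G W := by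
  have h1 := h.two_mul_card_le
  have hlocal : ∀ v ∈ bigSet G W, 4 ≤ degIn G W v →
      2 + (degIn G (smallSet G W) v + degIn G (heavySet G W) v) < 4 * (degIn G W v - 2) := by
    intro v hv hdv
    have h3 := degIn_mono (G := G) (heavySet_subset (G := G) W) v
    have h4 := degIn_mono (G := G) (smallSet_subset (G := G) W) v
    by_cases hd4 : degIn G W v = 4
    · have := h.degIn_heavySet_le_one hq hv hd4
      omega
    · by_cases hd5 : degIn G W v = 5
      · have := h.degIn_heavySet_le_two hq hv hd5
        omega
      · omega
  have h2 : ∑ v ∈ bigSet G W, (2 + (degIn G (smallSet G W) v + degIn G (heavySet G W) v)) <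
      ∑ v ∈ bigSet G W, 4 * (degIn G W v - 2) := by
    by_cases h4 : ∃ u ∈ W, 4 ≤ degIn G W u
    · obtain ⟨u, hu, hdu⟩ := h4
      have huB : u ∈ bigSet G W := mem_bigSet.2 ⟨hu, by omega⟩
      refine Finset.sum_lt_sum (fun v hv => ?_) ⟨u, huB, hlocal u huB hdu⟩
      by_cases hdv : 4 ≤ degIn G W v
      · exact (hlocal v hv hdv).le
      · have hdv3 := (mem_bigSet.1 hv).2
        have := h.exists_adj_four_le hq hv (by omega)
        omega
    · obtain ⟨u, hu, hdu⟩ := hB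
      refine Finset.sum_lt_sum_of_nonempty ⟨u, mem_bigSet.2 ⟨hu, hdu⟩⟩ fun v hv => ?_
      have hv' := mem_bigSet.1 hv
      have hdv : degIn G W v = 3 := by
        by_contra hne
        exact h4 ⟨v, hv'.1, by omega⟩
      by_contra hcon
      exact h4 (h.exists_adj_four_le hq hv hdv (by omega)).2
  rw [← Finset.mul_sum] at h2
  have h3 : excess G W = ∑ v ∈ bigSet G W, (degIn G W v - 2) := excess_eq_sum_filter W
  omega

end IsReducedSet

end Sparse

/-! ### Extending partial colourings -/

section Coloring

variable {V : Type*} {G : SimpleGraph V} {L : V → Finset ℕ}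

variable (G) in
/-- `U` has an `L`-colouring in which all colour classes have at most `q` vertices, except that at
most `m` of them, among which are all the classes meeting `T`, may have `q + 1` vertices. -/
def PartialSE (L : V → Finset ℕ) (U T : Finset V) (q m : ℕ) : Prop :=
  ∃ (f : V → ℕ) (D : Finset ℕ), (∀ v ∈ U, f v ∈ L v) ∧
    (∀ u ∈ U, ∀ v ∈ U, G.Adj u v → f u ≠ f v) ∧ D.card ≤ m ∧
    (∀ c, (U.filter fun v => f v = c).card ≤ q + if c ∈ D then 1 else 0) ∧ ∀ v ∈ T, f v ∈ D

lemma PartialSE.weaken {U T : Finset V} {q m : ℕ} (h : PartialSE G L U T q m) :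
    PartialSE G L U ∅ (q + 1) 0 := by
  obtain ⟨f, D, hf, hadj, -, hcls, -⟩ := h
  refine ⟨f, ∅, hf, hadj, by simp, fun c => (hcls c).trans ?_, by simp⟩
  rw [if_neg (Finset.notMem_empty c)]
  split_ifs <;> omega

lemma PartialSE.forget {U T : Finset V} {q m : ℕ} (h : PartialSE G L U T q m) :
    PartialSE G L U ∅ q m := by
  obtain ⟨f, D, hf, hadj, hD, hcls, -⟩ := h
  exact ⟨f, D, hf, hadj, hD, hcls, by simp⟩

lemma SEChoosable.of_partialSE [Fintype V] {k : ℕ} (hk : k = 3 ∨ k = 4) (hV : 0 < Fintype.card V)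
    (h : ∀ L : V → Finset ℕ, (∀ v, (L v).card = k) → ∀ q m : ℕ,
      Fintype.card V = k * q + m → m ≤ k → PartialSE G L Finset.univ ∅ q m) :
    SEChoosable G k := by
  intro L hL
  obtain ⟨q, m, hn, hm, hmk⟩ : ∃ q m, Fintype.card V = k * q + m ∧ 1 ≤ m ∧ m ≤ k := by
    refine ⟨(Fintype.card V - 1) / k, (Fintype.card V - 1) % k + 1, ?_, by omega, ?_⟩
    · have := Nat.div_add_mod (Fintype.card V - 1) k
      omega
    · exact Nat.mod_lt _ (by omega)
  obtain ⟨f, D, hf, hadj, hD, hcls, -⟩ := h L hL q m hn hmk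
  have hceil : (Fintype.card V + k - 1) / k = q + 1 := by
    rcases hk with rfl | rfl <;> omega
  have hmod : modStar (Fintype.card V) k = m := by
    unfold modStar
    rcases hk with rfl | rfl <;> split_ifs <;> omega
  rw [SELColorable, hceil, hmod]
  refine ⟨f, fun v => hf v (Finset.mem_univ v),
    fun u v => hadj u (Finset.mem_univ u) v (Finset.mem_univ v), fun c => ?_, ?_⟩
  · refine (hcls c).trans ?_
    split_ifs <;> omega
  · refine (Finset.card_le_card fun c hc => ?_).trans hD
    have h1 := (Finset.mem_filter.1 hc).2
    have h2 := hcls c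
    by_contra hcD
    rw [if_neg hcD] at h2
    omega

variable [DecidableRel G.Adj]

variable (G) in
/-- The vertices of the list have few neighbours in `U`, with a bound that increases along the
list up to `t - 1`. -/
def ListBound (U : Finset V) (t : ℕ) : List V → Prop
  | [] => True
  | v :: l => degIn G U v + l.length < t ∧ ListBound U t l

variable [DecidableEq V]

lemma PartialSE.insert {U T : Finset V} {q m : ℕ} (h : PartialSE G L U T q m) {v : V}
    (hv : v ∉ U) (hTU : T ⊆ U) (hd : degIn G (U \ T) v + m < (L v).card) :
    PartialSE G L (insert v U) (insert v T) q (m + 1) := by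
  obtain ⟨f, D, hf, hadj, hD, hcls, hT⟩ := h
  have hcard : ((((U \ T).filter (G.Adj v)).image f) ∪ D).card < (L v).card := by
    have h1 := Finset.card_union_le (((U \ T).filter (G.Adj v)).image f) D
    have h2 : (((U \ T).filter (G.Adj v)).image f).card ≤ degIn G (U \ T) v :=
      Finset.card_image_le
    omega
  obtain ⟨c, hcL, hc⟩ := Finset.exists_mem_notMem_of_card_lt_card hcard
  simp only [Finset.mem_union, Finset.mem_image, Finset.mem_filter, Finset.mem_sdiff,
    not_or] at hc
  have hne : ∀ u ∈ U, u ≠ v := fun u hu huv => hv (huv ▸ hu)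
  have hcv : ∀ u ∈ U, G.Adj v u → f u ≠ c := by
    intro u hu hvu huc
    by_cases huT : u ∈ T
    · exact hc.2 (huc ▸ hT u huT)
    · exact hc.1 ⟨u, ⟨⟨hu, huT⟩, hvu⟩, huc⟩
  refine ⟨Function.update f v c, Insert.insert c D, ?_, ?_, ?_, ?_, ?_⟩
  · intro u hu
    rcases Finset.mem_insert.1 hu with rfl | hu
    · simpa using hcL
    · simpa [hne u hu] using hf u hu
  · intro u hu w hw huw
    rcases Finset.mem_insert.1 hu with rfl | hu' <;>
      rcases Finset.mem_insert.1 hw with rfl | hw'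
    · exact absurd huw (G.loopless.irrefl _)
    · simpa [hne w hw'] using (hcv w hw' huw).symm
    · simpa [hne u hu'] using hcv u hu' huw.symm
    · simpa [hne u hu', hne w hw'] using hadj u hu' w hw' huw
  · exact (Finset.card_insert_le _ _).trans (by omega)
  · intro d
    have hU : U.filter (fun u => Function.update f v c u = d) = U.filter (fun u => f u = d) :=
      Finset.filter_congr fun u hu => by simp [hne u hu]
    have hle := hcls d
    rw [Finset.filter_insert, hU, Function.update_self]
    by_cases hcd : c = d
    · subst hcd
      have := Finset.card_insert_le v (U.filter fun u => f u = c)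
      rw [if_neg hc.2] at hle
      simp only [if_true, Finset.mem_insert_self]
      omega
    · simpa [hcd, Ne.symm hcd] using hle
  · intro u hu
    rcases Finset.mem_insert.1 hu with rfl | hu
    · simp
    · simpa [hne u (hTU hu)] using Or.inr (hT u hu)

lemma PartialSE.append {U : Finset V} {q m k t : ℕ} (h : PartialSE G L U ∅ q m)
    (hL : ∀ v, (L v).card = k) (ht : t + m ≤ k) :
    ∀ l : List V, l.Nodup → (∀ v ∈ l, v ∉ U) → ListBound G U t l →
      PartialSE G L (U ∪ l.toFinset) l.toFinset q (m + l.length)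
  | [], _, _, _ => by simpa using h
  | v :: l, hl, hU, hb => by
    rw [List.nodup_cons] at hl
    have ih := PartialSE.append h hL ht l hl.2 (fun u hu => hU u (by simp [hu])) hb.2
    have hdisj : Disjoint U l.toFinset := by
      rw [Finset.disjoint_right]
      exact fun u hu => hU u (by simp [List.mem_toFinset.1 hu])
    have hstep := ih.insert (v := v) (by simp [hl.1, hU v (by simp)]) Finset.subset_union_right
      (by
        rw [Finset.union_sdiff_cancel_right hdisj, hL]
        have := hb.1
        omega)
    simpa [add_assoc] using hstep

/-! ### The induction -/

/-- The bound on the potential of a graph with `n` vertices needed to colour it from lists of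
size `k`. -/
def CountBound (k n p : ℕ) : Prop :=
  (k = 3 → 3 * p ≤ n + 2) ∧ (k = 4 → 2 * p ≤ n + 2 ∧ (4 ∣ n → 2 * p ≤ n))

/-- A list of at most `m` vertices of `W` that can be coloured last, with `p` bounding the
potential of what remains. -/
structure IsRemovable (G : SimpleGraph V) [DecidableRel G.Adj] (k m : ℕ) (W : Finset V) (p : ℕ)
    (l : List V) : Prop where
  ne_nil : l ≠ []
  nodup : l.Nodup
  mem : ∀ v ∈ l, v ∈ W
  length_le : l.length ≤ m
  bound : ListBound G (W \ l.toFinset) (k - m + l.length) l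
  pot : PotLE G (W \ l.toFinset) p
  count : CountBound k (W.card - l.length) p

section Removable

variable {W : Finset V} {k m p q : ℕ}

lemma isRemovable_one {x : V} (hx : x ∈ W) (hm : 1 ≤ m) (hd : degIn G W x ≤ k - m)
    (hp : PotLE G (W \ {x}) p) (hc : CountBound k (W.card - 1) p) :
    IsRemovable G k m W p [x] where
  ne_nil := by simp
  nodup := by simp
  mem := by simpa using hx
  length_le := by simpa using hm
  bound := by
    have := degIn_mono (G := G) (Finset.sdiff_subset : W \ {x} ⊆ W) x
    simp only [ListBound, List.toFinset_cons, List.toFinset_nil, insert_empty_eq,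
      List.length_cons, List.length_nil, and_true]
    omega
  pot := by simpa using hp
  count := by simpa using hc

lemma isRemovable_two {x y : V} (hx : x ∈ W) (hy : y ∈ W) (hxy : x ≠ y) (hm : 2 ≤ m)
    (hdx : degIn G (W \ {x, y}) x ≤ k - m) (hdy : degIn G (W \ {x, y}) y ≤ k - m + 1)
    (hp : PotLE G (W \ {x, y}) p) (hc : CountBound k (W.card - 2) p) :
    IsRemovable G k m W p [x, y] where
  ne_nil := by simp
  nodup := by simpa using hxy
  mem := by simp [hx, hy]
  length_le := by simpa using hm
  bound := by
    simp only [ListBound, List.toFinset_cons, List.toFinset_nil, insert_empty_eq,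
      List.length_cons, List.length_nil, and_true]
    omega
  pot := by simpa using hp
  count := by simpa using hc

lemma isRemovable_three {x y z : V} (hx : x ∈ W) (hy : y ∈ W) (hz : z ∈ W) (hxy : x ≠ y)
    (hxz : x ≠ z) (hyz : y ≠ z) (hm : 3 ≤ m) (hdx : degIn G (W \ {x, y, z}) x ≤ k - m)
    (hdy : degIn G (W \ {x, y, z}) y ≤ k - m + 1) (hdz : degIn G (W \ {x, y, z}) z ≤ k - m + 2)
    (hp : PotLE G (W \ {x, y, z}) p) (hc : CountBound k (W.card - 3) p) :
    IsRemovable G k m W p [x, y, z] where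
  ne_nil := by simp
  nodup := by simp [hxy, hxz, hyz]
  mem := by simp [hx, hy, hz]
  length_le := by simpa using hm
  bound := by
    simp only [ListBound, List.toFinset_cons, List.toFinset_nil, insert_empty_eq,
      List.length_cons, List.length_nil, and_true]
    omega
  pot := by simpa using hp
  count := by simpa using hc

lemma isRemovable_four {x y z w : V} (hx : x ∈ W) (hy : y ∈ W) (hz : z ∈ W) (hw : w ∈ W)
    (hxy : x ≠ y) (hxz : x ≠ z) (hxw : x ≠ w) (hyz : y ≠ z) (hyw : y ≠ w) (hzw : z ≠ w)
    (hm : 4 ≤ m) (hdx : degIn G (W \ {x, y, z, w}) x ≤ k - m)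
    (hdy : degIn G (W \ {x, y, z, w}) y ≤ k - m + 1)
    (hdz : degIn G (W \ {x, y, z, w}) z ≤ k - m + 2)
    (hdw : degIn G (W \ {x, y, z, w}) w ≤ k - m + 3)
    (hp : PotLE G (W \ {x, y, z, w}) p) (hc : CountBound k (W.card - 4) p) :
    IsRemovable G k m W p [x, y, z, w] where
  ne_nil := by simp
  nodup := by simp [hxy, hxz, hxw, hyz, hyw, hzw]
  mem := by simp [hx, hy, hz, hw]
  length_le := by simpa using hm
  bound := by
    simp only [ListBound, List.toFinset_cons, List.toFinset_nil, insert_empty_eq,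
      List.length_cons, List.length_nil, and_true]
    omega
  pot := by simpa using hp
  count := by simpa using hc

lemma exists_isRemovable_of_isCycleSet (hp : PotLE G W p) (hk : k = 3 ∨ k = 4) (hm : 1 ≤ m)
    (hmk : m ≤ k) (hn : W.card = k * q + m) (hc : CountBound k W.card p)
    (hcyc : ∃ F, IsCycleSet G W F) : ∃ p' l, IsRemovable G k m W p' l := by
  obtain ⟨C, hC, hmin⟩ : ∃ C, IsCycleSet G W C ∧ ∀ F, IsCycleSet G W F → C.card ≤ F.card := by
    obtain ⟨C, hC, hmin⟩ :=
      (measure (Finset.card (α := V))).wf.has_min {F | IsCycleSet G W F} hcyc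
    exact ⟨C, hC, fun F hF => not_lt.1 (hmin F hF)⟩
  obtain ⟨x, hx⟩ := hC.nonempty
  have hxW := hC.subset hx
  have hdx := hC.deg x hx
  obtain ⟨y, hyW, hxy⟩ := exists_adj (G := G) (W := W) (v := x) (by omega)
  have hy := hC.closed x hx y hyW hxy
  have hdy := hC.deg y hy
  have hpot : ∀ S ⊆ C, S.Nonempty → PotLE G (W \ S) (p - 1) := fun S hS hne =>
    hp.sdiff_of_isCycleSet hC hmin hS hne
  have hn1 : 1 ≤ W.card := by omega
  unfold CountBound at hc
  by_cases h2 : m + 2 ≤ k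
  · refine ⟨p - 1, [x], isRemovable_one hxW hm (by omega) (hpot _ (by simpa using hx) (by simp)) ?_⟩
    unfold CountBound
    rcases hk with rfl | rfl <;> omega
  by_cases h1 : m + 1 = k
  · have hS : ({x, y} : Finset V) ⊆ W := by simp [Finset.insert_subset_iff, hxW, hyW]
    refine ⟨p - 1, [x, y], isRemovable_two hxW hyW hxy.ne (by omega) ?_ ?_
      (hpot _ (by simp [Finset.insert_subset_iff, hx, hy]) (by simp)) ?_⟩
    · have h1 := degIn_sdiff_add (G := G) hS x
      have h2 := one_le_degIn (G := G) (S := {x, y}) (by simp) hxy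
      omega
    · have h1 := degIn_sdiff_add (G := G) hS y
      omega
    · unfold CountBound
      rcases hk with rfl | rfl <;> omega
  · obtain ⟨z, hzW, hxz, hzy⟩ := exists_adj_ne (G := G) (W := W) (v := x) (by omega) y
    have hz := hC.closed x hx z hzW hxz
    have hdz := hC.deg z hz
    have hS := triple_subset hxW hyW hzW
    refine ⟨p - 1, [x, y, z], isRemovable_three hxW hyW hzW hxy.ne hxz.ne hzy.symm (by omega)
      ?_ ?_ ?_ (hpot _ (triple_subset hx hy hz) (by simp)) ?_⟩
    · have h1 := degIn_sdiff_add (G := G) hS x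
      have h2 := two_le_degIn (G := G) (S := {x, y, z}) hzy (by simp) (by simp) hxz hxy
      omega
    · have h1 := degIn_sdiff_add (G := G) hS y
      have h2 := one_le_degIn (G := G) (S := {x, y, z}) (by simp) hxy.symm
      omega
    · have h1 := degIn_sdiff_add (G := G) hS z
      omega
    · unfold CountBound
      rcases hk with rfl | rfl <;> omega

lemma PotLE.sdiff_self_le (hp : PotLE G W p) {S : Finset V} (hS : S ⊆ W) : PotLE G (W \ S) p :=
  (hp.sdiff hS).mono (Nat.sub_le _ _)

lemma exists_isRemovable_of_add_two_le
    (hdeg : ∀ A : Finset V, A.Nonempty → ∃ v ∈ A, degIn G A v ≤ 2)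
    (hp : PotLE G W p) (hk : k = 3 ∨ k = 4) (hm : 1 ≤ m) (hmk : m + 2 ≤ k)
    (hn : W.card = k * q + m) (hc : CountBound k W.card p)
    (hcyc : ∀ F, ¬ IsCycleSet G W F) : ∃ p' l, IsRemovable G k m W p' l := by
  unfold CountBound at hc
  by_cases hB : ∃ u ∈ W, 3 ≤ degIn G W u
  · obtain ⟨x, hx, hdx, hpx⟩ := exists_vertex_potLE hp hdeg hB
    refine ⟨p - 1, [x], isRemovable_one hx hm (by omega) hpx ?_⟩
    unfold CountBound
    rcases hk with rfl | rfl <;> omega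
  · have hW : W.Nonempty := Finset.card_pos.1 (by omega)
    obtain ⟨x, hx, hdx⟩ := hdeg W hW
    have h0 : PotLE G W 0 := by
      intro 𝓕 h𝓕
      have h1 : 𝓕 = ∅ := Finset.eq_empty_of_forall_notMem fun F hF => hcyc F (h𝓕.1 F hF)
      have h2 : excess G W = 0 := Finset.sum_eq_zero fun v hv => by
        by_contra hv0
        exact hB ⟨v, hv, by omega⟩
      simp [h1, h2]
    refine ⟨0, [x], isRemovable_one hx hm (by omega) (h0.sdiff_self_le (by simpa using hx)) ?_⟩
    unfold CountBound
    omega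

lemma exists_isRemovable_of_add_one_eq (hp : PotLE G W p) (hk : k = 3 ∨ k = 4) (hmk : m + 1 = k)
    (hn : W.card = k * q + m) (hc : CountBound k W.card p)
    (hcyc : ∀ F, ¬ IsCycleSet G W F) : ∃ p' l, IsRemovable G k m W p' l := by
  unfold CountBound at hc
  by_cases h1 : ∃ x ∈ W, degIn G W x ≤ 1
  · obtain ⟨x, hx, hdx⟩ := h1
    refine ⟨p, [x], isRemovable_one hx (by omega) (by omega)
      (hp.sdiff_self_le (by simpa using hx)) ?_⟩
    unfold CountBound
    rcases hk with rfl | rfl <;> omega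
  · push Not at h1
    have hB : ∃ u ∈ W, 3 ≤ degIn G W u := by
      by_contra! hB
      refine hcyc W ⟨Finset.card_pos.1 (by omega), subset_rfl, fun _ _ u hu _ => hu, fun v hv => ?_⟩
      have := h1 v hv
      have := hB v hv
      omega
    have hle := hp.excess_le
    obtain ⟨x, hx, y, hy, hxy, hdx, hdy, hpxy⟩ := exists_pair_potLE hp h1 hcyc hB
      (by rcases hk with rfl | rfl <;> omega)
    have hS : ({x, y} : Finset V) ⊆ W := by simp [Finset.insert_subset_iff, hx, hy]
    refine ⟨p - 1, [x, y], isRemovable_two hx hy hxy.ne (by omega) ?_ ?_ hpxy ?_⟩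
    · have h1 := degIn_sdiff_add (G := G) hS x
      have h2 := one_le_degIn (G := G) (S := {x, y}) (by simp) hxy
      omega
    · have h1 := degIn_sdiff_add (G := G) hS y
      have h2 := one_le_degIn (G := G) (S := {x, y}) (by simp) hxy.symm
      omega
    · unfold CountBound
      rcases hk with rfl | rfl <;> omega

lemma exists_isRemovable_of_eq (hp : PotLE G W p) (hk : k = 3 ∨ k = 4)
    (hn : W.card = k * q + k) (hc : CountBound k W.card p)
    (hcyc : ∀ F, ¬ IsCycleSet G W F) : ∃ p' l, IsRemovable G k k W p' l := by
  by_contra! hno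
  unfold CountBound at hc
  have hpos : ∀ x ∈ W, 1 ≤ degIn G W x := by
    intro x hx
    by_contra hdx
    refine hno p [x] (isRemovable_one hx (by omega) (by omega)
      (hp.sdiff_self_le (by simpa using hx)) ?_)
    unfold CountBound
    rcases hk with rfl | rfl <;> omega
  have hleaf : ∀ x ∈ W, ∀ y ∈ W, G.Adj x y → degIn G W x = 1 → 3 ≤ degIn G W y := by
    intro x hx y hy hxy hdx
    by_contra hdy
    have hS : ({x, y} : Finset V) ⊆ W := by simp [Finset.insert_subset_iff, hx, hy]
    refine hno p [x, y] (isRemovable_two hx hy hxy.ne (by omega) ?_ ?_ (hp.sdiff_self_le hS) ?_)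
    · have h1 := degIn_sdiff_add (G := G) hS x
      have h2 := one_le_degIn (G := G) (S := {x, y}) (by simp) hxy
      omega
    · have h1 := degIn_sdiff_add (G := G) hS y
      have h2 := one_le_degIn (G := G) (S := {x, y}) (by simp) hxy.symm
      omega
    · unfold CountBound
      rcases hk with rfl | rfl <;> omega
  have hB : ∃ u ∈ W, 3 ≤ degIn G W u := by
    by_contra! hB
    refine hcyc W ⟨Finset.card_pos.1 (by omega), subset_rfl, fun _ _ u hu _ => hu, fun v hv => ?_⟩
    have h1 := hpos v hv
    have h2 := hB v hv
    by_contra hdv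
    obtain ⟨u, hu, hvu⟩ := exists_adj h1
    have h3 := hleaf v hv u hu hvu (by omega)
    have h4 := hB u hu
    omega
  have hred : IsReducedSet G W p := by
    refine ⟨hp, hcyc, hpos, hleaf, ?_⟩
    intro a ha b hb c hc' hab hac hbc hda hdb hdc hpot
    refine hno (p - 1) [a, b, c] (isRemovable_three ha hb hc' hab hac hbc (by omega) (by omega)
      (by omega) (by omega) hpot ?_)
    unfold CountBound
    rcases hk with rfl | rfl <;> omega
  have hle := hp.excess_le
  rcases hk with rfl | rfl
  · have := hred.lt_three_mul_excess hB
    omega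
  · have hquad : NoQuadRemoval G W p := by
      intro a ha b hb c hc' d hd hab hac had hbc hbd hcd hda hdb hdc hdd hpot
      refine hno (p - 2) [a, b, c, d] (isRemovable_four ha hb hc' hd hab hac had hbc hbd hcd
        le_rfl (by omega) (by omega) (by omega) (by omega) hpot ?_)
      unfold CountBound
      omega
    have := hred.lt_two_mul_excess hquad hB
    omega

end Removable

theorem partialSE_of_potLE {k : ℕ} (hk : k = 3 ∨ k = 4) (hL : ∀ v, (L v).card = k)
    (hdeg : ∀ A : Finset V, A.Nonempty → ∃ v ∈ A, degIn G A v ≤ 2) (W : Finset V) :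
    ∀ p q m : ℕ, PotLE G W p → CountBound k W.card p → W.card = k * q + m → m ≤ k →
      PartialSE G L W ∅ q m := by
  induction W using Finset.strongInduction with
  | H W ih =>
    intro p
    have main : ∀ q m : ℕ, PotLE G W p → CountBound k W.card p → W.card = k * q + m → 1 ≤ m →
        m ≤ k → PartialSE G L W ∅ q m := by
      intro q m hp hc hn hm hmk
      obtain ⟨p', l, hl⟩ : ∃ p' l, IsRemovable G k m W p' l := by
        by_cases hcyc : ∃ F, IsCycleSet G W F
        · exact exists_isRemovable_of_isCycleSet hp hk hm hmk hn hc hcyc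
        push Not at hcyc
        rcases (by omega : m + 2 ≤ k ∨ m + 1 = k ∨ m = k) with h | h | rfl
        · exact exists_isRemovable_of_add_two_le hdeg hp hk hm h hn hc hcyc
        · exact exists_isRemovable_of_add_one_eq hp hk h hn hc hcyc
        · exact exists_isRemovable_of_eq hp hk hn hc hcyc
      have hsub : l.toFinset ⊆ W := fun v hv => hl.mem v (List.mem_toFinset.1 hv)
      have hcard : (W \ l.toFinset).card = W.card - l.length := by
        rw [Finset.card_sdiff_of_subset hsub, List.toFinset_card_of_nodup hl.nodup]
      have hlen := hl.length_le
      have hrest := ih (W \ l.toFinset)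
        (Finset.sdiff_ssubset hsub (List.toFinset_nonempty_iff l |>.2 hl.ne_nil))
        p' q (m - l.length) hl.pot (hcard ▸ hl.count) (by omega) (by omega)
      have hext := (hrest.append hL (t := k - m + l.length) (by omega) l hl.nodup
        (by simp +contextual) hl.bound).forget
      rwa [Finset.sdiff_union_of_subset hsub, Nat.sub_add_cancel hlen] at hext
    intro q m hp hc hn hmk
    rcases Nat.eq_zero_or_pos m with rfl | hm
    · rcases q with _ | q
      · have hW : W = ∅ := Finset.card_eq_zero.1 (by omega)
        subst hW
        exact ⟨fun _ => 0, ∅, by simp, by simp, by simp, by simp, by simp⟩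
      · exact (main q k hp hc (by rw [hn]; ring) (by omega) le_rfl).weaken
    · exact main q m hp hc hn hm hmk

end Coloring

/-! ### The initial bound on the potential -/

section Sparse

variable {V : Type*} {G : SimpleGraph V} [DecidableRel G.Adj]

lemma IsCycleSet.three_le_card {W F : Finset V} (hF : IsCycleSet G W F) : 3 ≤ F.card := by
  obtain ⟨x, hx⟩ := hF.nonempty
  have hsub : W.filter (G.Adj x) ⊂ F := by
    refine (Finset.ssubset_iff_of_subset fun y hy => ?_).2 ⟨x, hx, by simp⟩
    rw [Finset.mem_filter] at hy
    exact hF.closed x hx y hy.1 hy.2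
  have h1 := Finset.card_lt_card hsub
  have h2 : (W.filter (G.Adj x)).card = 2 := hF.deg x hx
  omega

variable [DecidableEq V]

lemma exists_degIn_le_two {A : Finset V} (hA : A.Nonempty)
    (h : 4 * inducedEdgeCount G A ≤ 5 * A.card + 2) : ∃ v ∈ A, degIn G A v ≤ 2 := by
  by_contra! hno
  have h1 : A.card * 3 ≤ ∑ v ∈ A, degIn G A v := by
    rw [← smul_eq_mul]
    exact Finset.card_nsmul_le_sum _ _ _ hno
  rw [← two_mul_inducedEdgeCount] at h1
  obtain ⟨v, hv⟩ := hA
  have h2 : degIn G A v < A.card :=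
    Finset.card_lt_card (Finset.filter_ssubset.2 ⟨v, hv, G.loopless.irrefl v⟩)
  have h3 := hno v hv
  omega

/-- Deleting the members of a cycle family does not change the excess. -/
lemma exists_excess_eq {W : Finset V} (hmin : ∀ v ∈ W, 2 ≤ degIn G W v)
    {𝓕 : Finset (Finset V)} (h𝓕 : IsCycleFamily G W 𝓕) :
    ∃ A : Finset V, A.card + 3 * 𝓕.card ≤ W.card ∧
      excess G W + 2 * A.card = 2 * inducedEdgeCount G A := by
  set U := 𝓕.biUnion id with hU
  have hUW : U ⊆ W := Finset.biUnion_subset.2 fun F hF => (h𝓕.1 F hF).subset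
  refine ⟨W \ U, ?_, ?_⟩
  · have h1 : U.card = ∑ F ∈ 𝓕, F.card :=
      Finset.card_biUnion fun F hF F' hF' hne => h𝓕.2 F hF F' hF' hne
    have h2 : 𝓕.card * 3 ≤ ∑ F ∈ 𝓕, F.card := by
      rw [← smul_eq_mul]
      exact Finset.card_nsmul_le_sum _ _ _ fun F hF => (h𝓕.1 F hF).three_le_card
    have h3 := Finset.card_sdiff_add_card_eq_card hUW
    omega
  · have hdeg : ∀ v ∈ W \ U, degIn G (W \ U) v = degIn G W v := by
      intro v hv
      have h1 := degIn_sdiff_add (G := G) hUW v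
      have h2 : degIn G U v = 0 := by
        rw [degIn, Finset.card_eq_zero, Finset.filter_eq_empty_iff]
        intro u hu hvu
        rw [hU, Finset.mem_biUnion] at hu
        obtain ⟨F, hF, huF⟩ := hu
        rw [Finset.mem_sdiff] at hv
        exact hv.2 (Finset.mem_biUnion.2
          ⟨F, hF, (h𝓕.1 F hF).closed u huF v hv.1 hvu.symm⟩)
      omega
    have hzero : ∑ v ∈ U, (degIn G W v - 2) = 0 := by
      refine Finset.sum_eq_zero fun v hv => ?_
      rw [hU, Finset.mem_biUnion] at hv
      obtain ⟨F, hF, hvF⟩ := hv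
      simp [(h𝓕.1 F hF).deg v hvF]
    rw [two_mul_inducedEdgeCount, excess, ← Finset.sum_sdiff hUW, hzero, add_zero, mul_comm,
      ← smul_eq_mul, ← Finset.sum_const, ← Finset.sum_add_distrib]
    refine Finset.sum_congr rfl fun v hv => ?_
    have := hmin v (Finset.mem_sdiff.1 hv).1
    rw [hdeg v hv]
    omega

lemma seChoosable_of_potLE [Fintype V] {k p : ℕ} (hk : k = 3 ∨ k = 4) (hV : 0 < Fintype.card V)
    (hs : ∀ A : Finset V, A.Nonempty → 4 * inducedEdgeCount G A ≤ 5 * A.card + 2)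
    (hp : PotLE G Finset.univ p) (hc : CountBound k (Fintype.card V) p) : SEChoosable G k :=
  SEChoosable.of_partialSE hk hV fun _ hL q m hn hm =>
    partialSE_of_potLE hk hL (fun A hA => exists_degIn_le_two hA (hs A hA)) _ p q m hp hc hn hm

end Sparse

/-- **Kierstead–Kostochka–Xiang (2024).** Let `G` be a graph with `δ(G) ≥ 2`. If
`6‖G[A]‖ ≤ 7|A| + 2` for every nonempty `A ⊆ V(G)`, then `G` is strongly equitably
`3`-choosable; and if `4‖G[A]‖ ≤ 5|A| + 2` for every nonempty `A ⊆ V(G)`, then `G` is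
strongly equitably `4`-choosable. -/
theorem se_choosable_sparse {V : Type*} [Fintype V] [DecidableEq V]
    (G : SimpleGraph V) [DecidableRel G.Adj] (hδ : 2 ≤ G.minDegree) :
    ((∀ A : Finset V, A.Nonempty → 6 * inducedEdgeCount G A ≤ 7 * A.card + 2) →
      SEChoosable G 3) ∧
    ((∀ A : Finset V, A.Nonempty → 4 * inducedEdgeCount G A ≤ 5 * A.card + 2) →
      SEChoosable G 4) := by
  have hV : 0 < Fintype.card V := by
    rw [Fintype.card_pos_iff]
    by_contra hV
    rw [not_nonempty_iff] at hV
    rw [SimpleGraph.minDegree_of_subsingleton] at hδ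
    omega
  have hmin : ∀ v ∈ Finset.univ, 2 ≤ degIn G Finset.univ v := by
    intro v _
    have := G.minDegree_le_degree v
    rw [degIn, ← SimpleGraph.neighborFinset_eq_filter, SimpleGraph.card_neighborFinset_eq_degree]
    omega
  have hempty : inducedEdgeCount G ∅ = 0 := by simp [inducedEdgeCount]
  constructor
  · intro hs
    refine seChoosable_of_potLE (p := (Fintype.card V + 2) / 3) (Or.inl rfl) hV
      (fun A hA => ?_) (fun 𝓕 h𝓕 => ?_) ⟨fun _ => by omega, fun h => by omega⟩
    · have := hs A hA
      omega
    · obtain ⟨A, hA, he⟩ := exists_excess_eq hmin h𝓕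
      rw [Finset.card_univ] at hA
      rcases A.eq_empty_or_nonempty with rfl | hne
      · omega
      · have := hs A hne
        omega
  · intro hs
    refine seChoosable_of_potLE
      (p := if 4 ∣ Fintype.card V then Fintype.card V / 2 else (Fintype.card V + 2) / 2)
      (Or.inr rfl) hV hs (fun 𝓕 h𝓕 => ?_)
      ⟨fun h => by omega, fun _ => by split_ifs <;> omega⟩
    obtain ⟨A, hA, he⟩ := exists_excess_eq hmin h𝓕
    rw [Finset.card_univ] at hA
    rcases A.eq_empty_or_nonempty with rfl | hne
    · split_ifs <;> omega
    · have := hs A hne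
      rcases Nat.eq_zero_or_pos 𝓕.card with h0 | h0 <;> split_ifs <;> omega
end
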